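/- arXiv:1603.08901 — 2 statements merged into one kernel-verified Lean document; each statement's English description precedes it below -/
import Mathlib

section
/- Let ℓ ≥ 3 be a prime. The only solutions in integers z, y to the equation z³ + (z+1)³ = yˡ are (z, y) = (0, 1) and (z, y) = (−1, −1). -/
open QuadraticAlgebra

/-- The ring `ℤ[ω]` of Eisenstein integers, with `ω ^ 2 = -1 - ω`. -/
abbrev EisensteinInt : Type := QuadraticAlgebra ℤ (-1) (-1)

theorem exists_abs_two_mul_sub_le (a : ℤ) {n : ℤ} (hn : 0 < n) :
    ∃ q : ℤ, |2 * (a - n * q)| ≤ n := by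
  refine ⟨(2 * a + n) / (2 * n), abs_le.2 ?_⟩
  have h₁ := Int.mul_ediv_add_emod (2 * a + n) (2 * n)
  have h₂ := Int.emod_nonneg (2 * a + n) (b := 2 * n) (by positivity)
  have h₃ := Int.emod_lt_of_pos (2 * a + n) (b := 2 * n) (by positivity)
  constructor <;> linarith

theorem two_pow_succ_dvd_choose_mul_pow {u : ℤ} (hu : Even u) {l e : ℕ}
    (he : (2 : ℤ) ^ e ∣ l.choose 2 * u ^ 2) (i : ℕ) :
    (2 : ℤ) ^ (e + 1) ∣ l.choose (i + 3) * u ^ (i + 3) := by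
  obtain ⟨f, m, hm, hf⟩ := Nat.exists_eq_two_pow_mul_odd
    (n := (i + 3).choose 2) (Nat.choose_pos (by omega)).ne'
  have hle : f ≤ i := by
    have h₁ : 2 ^ (f + 1) ∣ (i + 3) * (i + 2) := by
      refine ⟨m, ?_⟩
      rw [pow_succ, mul_right_comm, ← hf, Nat.choose_two_right, Nat.div_mul_cancel]
      · rfl
      · exact (Nat.even_mul_pred_self _).two_dvd
    have h₂ : 2 ^ (f + 1) ≤ i + 3 := by
      have hc : (i + 3).Coprime (i + 2) := by
        rw [show i + 3 = i + 2 + 1 from rfl, Nat.coprime_self_add_left]; simp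
      rcases (hc.isPrimePow_dvd_mul (Nat.prime_two.isPrimePow.pow f.succ_ne_zero)).1 h₁ with h | h
      · exact Nat.le_of_dvd (by omega) h
      · exact (Nat.le_of_dvd (by omega) h).trans (by omega)
    have h₃ : i + 3 < 2 ^ (i + 2) := by
      clear * -
      induction i with
      | zero => norm_num
      | succ i ih => rw [show i + 1 + 2 = i + 2 + 1 from rfl, pow_succ]; omega
    have := (Nat.pow_lt_pow_iff_right (by norm_num : 1 < 2)).1 (h₂.trans_lt h₃)
    omega
  have hch : ((l.choose (i + 3) : ℕ) : ℤ) * (2 ^ f * m) = l.choose 2 * (l - 2).choose (i + 1) := by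
    have := Nat.choose_mul (n := l) (show 2 ≤ i + 3 by omega)
    rw [hf] at this
    exact_mod_cast this
  have hdvd : (2 : ℤ) ^ f * 2 ^ (e + 1) ∣ 2 ^ f * (m * (l.choose (i + 3) * u ^ (i + 3))) := by
    have : (2 : ℤ) ^ f * (m * (l.choose (i + 3) * u ^ (i + 3))) =
        (l.choose 2 * u ^ 2) * u ^ (i + 1) * (l - 2).choose (i + 1) := by
      linear_combination u ^ (i + 3) * hch
    rw [this, ← pow_add]
    refine Dvd.dvd.mul_right ((pow_dvd_pow 2 (show f + (e + 1) ≤ e + (i + 1) by omega)).trans ?_) _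
    rw [pow_add]
    exact mul_dvd_mul he (pow_dvd_pow_of_dvd hu.two_dvd _)
  refine IsCoprime.dvd_of_dvd_mul_left ?_ ((mul_dvd_mul_iff_left (by positivity)).1 hdvd)
  refine IsCoprime.pow_left ?_
  exact_mod_cast Nat.isCoprime_iff_coprime.2 (Nat.coprime_two_left.2 hm)

namespace EisensteinInt

theorem norm_eq (x : EisensteinInt) : norm x = x.re ^ 2 - x.re * x.im + x.im ^ 2 := by
  rw [norm_def]; ring

theorem norm_nonneg (x : EisensteinInt) : 0 ≤ norm x := by
  rw [norm_eq]; nlinarith [sq_nonneg (2 * x.re - x.im), sq_nonneg x.im]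

theorem norm_pos {x : EisensteinInt} (hx : x ≠ 0) : 0 < norm x := by
  refine lt_of_le_of_ne (norm_nonneg x) fun h => hx ?_
  rw [norm_eq] at h
  have him : x.im = 0 := by
    apply pow_eq_zero_iff (two_ne_zero) |>.1
    nlinarith [sq_nonneg (2 * x.re - x.im), sq_nonneg x.im]
  have hre : x.re = 0 := by simpa [him] using h.symm
  exact QuadraticAlgebra.ext hre him

theorem exists_norm_sub_mul_lt (x : EisensteinInt) {y : EisensteinInt} (hy : y ≠ 0) :
    ∃ q, norm (x - y * q) < norm y := by
  have hn := norm_pos hy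
  obtain ⟨r, hr⟩ := exists_abs_two_mul_sub_le (x * star y).re hn
  obtain ⟨s, hs⟩ := exists_abs_two_mul_sub_le (x * star y).im hn
  refine ⟨⟨r, s⟩, ?_⟩
  have key : norm (x - y * ⟨r, s⟩) * norm y =
      ((x * star y).re - norm y * r) ^ 2 -
        ((x * star y).re - norm y * r) * ((x * star y).im - norm y * s) +
        ((x * star y).im - norm y * s) ^ 2 := by
    simp only [norm_eq, re_sub, im_sub, re_mul, im_mul, re_star, im_star]
    ring
  have hr' := sq_le_sq.2 (hr.trans (le_abs_self _))
  have hs' := sq_le_sq.2 (hs.trans (le_abs_self _))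
  set e := (x * star y).re - norm y * r
  set f := (x * star y).im - norm y * s
  nlinarith [sq_nonneg (e + f)]

open Classical in
noncomputable instance : EuclideanDomain EisensteinInt :=
  { QuadraticAlgebra.instCommRing, (inferInstance : Nontrivial EisensteinInt) with
    quotient := fun x y => if hy : y = 0 then 0 else (exists_norm_sub_mul_lt x hy).choose
    remainder := fun x y =>
      x - y * (if hy : y = 0 then 0 else (exists_norm_sub_mul_lt x hy).choose)
    quotient_zero := fun x => dif_pos rfl
    quotient_mul_add_remainder_eq := fun x y => by ring
    r := fun x y => (norm x).natAbs < (norm y).natAbs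
    r_wellFounded := (measure fun x : EisensteinInt => (norm x).natAbs).wf
    remainder_lt := fun x y hy => by
      rw [dif_neg hy]
      exact Int.natAbs_lt_natAbs_of_nonneg_of_lt (norm_nonneg _)
        (exists_norm_sub_mul_lt x hy).choose_spec
    mul_left_not_lt := fun x y hy => by
      rw [map_mul, Int.natAbs_mul, not_lt]
      exact Nat.le_mul_of_pos_right _ (Int.natAbs_pos.2 (norm_pos hy).ne') }

theorem pow_six_eq_one_of_isUnit {x : EisensteinInt} (hx : IsUnit x) : x ^ 6 = 1 := by
  have h : norm x = 1 := by
    rcases Int.isUnit_iff.1 (isUnit_iff_norm_isUnit.1 hx) with h | h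
    · exact h
    · linarith [norm_nonneg x]
  obtain ⟨a, b⟩ := x
  simp only [norm_eq] at h
  have ha : a ^ 2 ≤ 1 := by nlinarith [sq_nonneg (a - 2 * b)]
  have hb : b ^ 2 ≤ 1 := by nlinarith [sq_nonneg (2 * a - b)]
  obtain ⟨ha₁, ha₂⟩ := abs_le.1 ((sq_le_one_iff_abs_le_one _).1 ha)
  obtain ⟨hb₁, hb₂⟩ := abs_le.1 ((sq_le_one_iff_abs_le_one _).1 hb)
  interval_cases a <;> interval_cases b <;>
    first | (norm_num at h; done) | (ext <;> simp [pow_succ])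

theorem exists_eq_pow_of_mul_eq_pow {x y c : EisensteinInt} {l : ℕ} (hl : l.Coprime 6)
    (hxy : IsCoprime x y) (h : x * y = c ^ l) : ∃ d, x = d ^ l := by
  obtain ⟨d, u, hu⟩ := exists_associated_pow_of_mul_eq_pow' hxy h
  have hu6 := pow_six_eq_one_of_isUnit u.isUnit
  have key : ∀ k, k % 6 = 1 → (u : EisensteinInt) ^ k = u := fun k hk => by
    rw [pow_eq_pow_mod k hu6, hk]; simp
  obtain ⟨m, -, hm⟩ := Nat.exists_mul_mod_eq_one_of_coprime hl (by norm_num)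
  exact ⟨d * u ^ m, by rw [mul_pow, ← pow_mul, mul_comm m, key _ hm, hu]⟩

theorem im_dvd_im_pow (x : EisensteinInt) (n : ℕ) : x.im ∣ (x ^ n).im := by
  induction n with
  | zero => simp
  | succ n ih =>
    rw [pow_succ, im_mul]
    exact (((dvd_mul_left _ _).add (ih.mul_right _))).add ((dvd_mul_left _ _))

theorem trace_dvd_trace_pow (x : EisensteinInt) {n : ℕ} (hn : Odd n) :
    trace x ∣ trace (x ^ n) := by
  rw [← algebraMap_dvd_iff_dvd (a := -1) (b := -1), algebraMap_trace_eq_add_star,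
    algebraMap_trace_eq_add_star, star_pow]
  exact hn.add_dvd_pow_add_pow _ _

theorem mk_one_eq (u : ℤ) : (⟨u, 1⟩ : EisensteinInt) = (u : EisensteinInt) + omega := by
  ext <;> simp

theorem omega_pow_three : (omega : EisensteinInt) ^ 3 = 1 := by
  ext <;> simp [pow_succ]

theorem omega_pow_three_mul_add (k i : ℕ) :
    (omega : EisensteinInt) ^ (3 * k + i) = omega ^ i := by
  rw [pow_add, pow_mul, omega_pow_three, one_pow, one_mul]

/-- The expansion of `(t + q θ) ^ (n + 1)` with `θ = 1 + 2 ω = √-3`. -/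
theorem exists_pow_succ_eq (t q : ℤ) (n : ℕ) : ∃ a b : ℤ,
    (t + q * ⟨1, 2⟩ : EisensteinInt) ^ (n + 1) =
      ((t ^ (n + 1) + 3 * q ^ 2 * a : ℤ) : EisensteinInt) +
        ((q * ((n + 1) * t ^ n + 3 * b) : ℤ) : EisensteinInt) * ⟨1, 2⟩ := by
  have hθ : (⟨1, 2⟩ : EisensteinInt) ^ 2 = -3 := by ext <;> simp [pow_succ]
  induction n with
  | zero => exact ⟨0, 0, by simp⟩
  | succ n ih =>
    obtain ⟨a, b, h⟩ := ih
    refine ⟨t * a - ((n + 1) * t ^ n + 3 * b), b * t + q ^ 2 * a, ?_⟩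
    rw [pow_succ, h]
    push_cast
    linear_combination
      ((q : EisensteinInt) ^ 2 * ((n + 1) * (t : EisensteinInt) ^ n + 3 * b)) * hθ

/-- If `x ^ l` has trace `-1`, comparing real parts of `(2 * x) ^ l` would give
`3 ^ (l - 1) ∣ 2 ^ (l - 1) ± 1` as soon as `3 ^ (l - 2)` divides its `ω`-coordinate. -/
theorem not_three_pow_dvd_im_pow {x : EisensteinInt} {l : ℕ} (hl : Odd l) (hl3 : l.Coprime 3)
    (hl' : 3 ≤ l) (htr : trace (x ^ l) = -1) : ¬ (3 : ℤ) ^ (l - 2) ∣ (x ^ l).im := by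
  intro hdvd
  have ht : IsUnit (trace x) :=
    isUnit_of_dvd_unit (trace_dvd_trace_pow x hl) (by rw [htr]; exact isUnit_one.neg)
  obtain ⟨n, rfl⟩ : ∃ n, l = n + 1 := ⟨l - 1, by omega⟩
  obtain ⟨a, b, hab⟩ := exists_pow_succ_eq (trace x) x.im n
  have hx : (trace x + x.im * ⟨1, 2⟩ : EisensteinInt) = (2 : ℤ) * x := by
    ext <;> simp [trace_def] <;> ring
  rw [hx, mul_pow, ← Int.cast_pow] at hab
  have him := congrArg QuadraticAlgebra.im hab
  have hre := congrArg QuadraticAlgebra.re hab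
  simp only [im_mul, re_mul, im_add, re_add, re_intCast, im_intCast, Int.cast_id] at him hre
  rw [trace_def] at htr
  have him' : 2 ^ n * (x ^ (n + 1)).im = x.im * ((n + 1) * trace x ^ n + 3 * b) := by
    rw [pow_succ] at him; linarith
  have hre' : 3 * (x.im ^ 2 * a) = -2 ^ n - trace x ^ (n + 1) := by
    rw [pow_succ 2] at hre
    linear_combination 2 ^ n * htr - hre + him'
  have hcop : IsCoprime ((3 : ℤ) ^ (n + 1 - 2)) ((n + 1) * trace x ^ n + 3 * b) := by
    refine IsCoprime.pow_left ?_
    rw [IsCoprime.add_mul_left_right_iff]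
    refine IsCoprime.mul_right ?_ (isCoprime_one_right.of_isCoprime_of_dvd_right (ht.pow n).dvd)
    exact_mod_cast (Nat.isCoprime_iff_coprime.2 hl3.symm)
  obtain ⟨c, hc⟩ := hcop.dvd_of_dvd_mul_right (him' ▸ hdvd.mul_left _)
  have hpow : (3 : ℤ) ^ n ∣ 2 ^ n + trace x ^ (n + 1) := by
    rw [← dvd_neg, neg_add', ← hre', hc]
    refine (pow_dvd_pow 3 (show n ≤ 1 + (n + 1 - 2) * 2 by omega)).trans ?_
    exact ⟨c ^ 2 * a, by ring⟩
  have h₂ : (4 : ℤ) ≤ 2 ^ n := by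
    calc (4 : ℤ) = 2 ^ 2 := by norm_num
      _ ≤ 2 ^ n := pow_le_pow_right₀ (by norm_num) (by omega)
  have h₃ : (2 : ℤ) ^ n + 1 < 3 ^ n := by
    clear * - hl'
    obtain ⟨m, rfl⟩ : ∃ m, n = m + 2 := ⟨n - 2, by omega⟩
    clear hl'
    induction m with
    | zero => norm_num
    | succ m ih =>
      rw [Nat.add_right_comm, pow_succ, pow_succ (3 : ℤ)]
      linarith [pow_pos (two_pos (α := ℤ)) (m + 2)]
  rcases Int.isUnit_iff.1 (ht.pow (n + 1)) with h | h <;> rw [h] at hpow <;>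
    linarith [Int.le_of_dvd (by linarith) hpow]

theorem im_mk_one_pow_eq {l : ℕ} (hl : l.Prime) (hl3 : 3 ≤ l) {u : ℤ}
    (hu : IsUnit ((⟨u, 1⟩ : EisensteinInt) ^ l).im)
    (hω : IsUnit ((omega : EisensteinInt) ^ l).im) :
    ((⟨u, 1⟩ : EisensteinInt) ^ l).im = ((omega : EisensteinInt) ^ l).im := by
  obtain ⟨r, hr⟩ := exists_add_pow_prime_eq hl (u : EisensteinInt) omega
  have h : (l : ℤ) ∣ ((⟨u, 1⟩ : EisensteinInt) ^ l).im - ((omega : EisensteinInt) ^ l).im := by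
    refine ⟨((u : EisensteinInt) * omega * r).im, ?_⟩
    rw [mk_one_eq, hr, mul_assoc, mul_assoc, ← mul_assoc (u : EisensteinInt), ← Int.cast_pow,
      im_add, im_add, im_intCast, im_mul]
    simp
  rcases Int.isUnit_iff.1 hu with h₁ | h₁ <;> rcases Int.isUnit_iff.1 hω with h₂ | h₂ <;>
    rw [h₁, h₂] at h ⊢
  · have := Int.le_of_dvd (by norm_num) h
    omega
  · have := Int.le_of_dvd (by norm_num) ((dvd_neg).2 h)
    omega

theorem exists_im_mk_one_pow_eq {u : ℤ} (hu : Even u) {l e : ℕ} (hl : 2 ≤ l)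
    (he : (2 : ℤ) ^ e ∣ l.choose 2 * u ^ 2) : ∃ r : ℤ,
    ((⟨u, 1⟩ : EisensteinInt) ^ l).im = ((omega : EisensteinInt) ^ l).im +
      l * u * ((omega : EisensteinInt) ^ (l - 1)).im +
      l.choose 2 * u ^ 2 * ((omega : EisensteinInt) ^ (l - 2)).im + 2 ^ (e + 1) * r := by
  obtain ⟨m, rfl⟩ : ∃ m, l = m + 2 := ⟨l - 2, by omega⟩
  rw [mk_one_eq, add_pow, Finset.sum_range_succ', Finset.sum_range_succ', Finset.sum_range_succ']
  have hdvd : (((2 : ℤ) ^ (e + 1) : ℤ) : EisensteinInt) ∣ ∑ i ∈ Finset.range m,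
      (u : EisensteinInt) ^ (i + 1 + 1 + 1) * (omega : EisensteinInt) ^ (m + 2 - (i + 1 + 1 + 1)) *
        ((m + 2).choose (i + 1 + 1 + 1) : ℕ) := by
    refine Finset.dvd_sum fun i _ => ?_
    obtain ⟨c, hc⟩ := two_pow_succ_dvd_choose_mul_pow hu he i
    refine ⟨c * (omega : EisensteinInt) ^ (m + 2 - (i + 3)), ?_⟩
    have hc' := congrArg (Int.cast : ℤ → EisensteinInt) hc
    push_cast at hc'
    rw [Int.cast_pow, Int.cast_ofNat]
    linear_combination (omega : EisensteinInt) ^ (m + 2 - (i + 3)) * hc'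
  obtain ⟨r, hr⟩ := hdvd
  rw [hr]
  refine ⟨r.im, ?_⟩
  simp only [im_add, im_mul, re_mul, ← Int.cast_pow, im_intCast, re_intCast, im_natCast, re_natCast]
  simp
  ring

theorem eq_zero_of_im_mk_one_pow_eq {u : ℤ} (hu : Even u) {l : ℕ} (hl : Odd l) (hl3 : l.Coprime 3)
    (hl' : 2 ≤ l)
    (h : ((⟨u, 1⟩ : EisensteinInt) ^ l).im = ((omega : EisensteinInt) ^ l).im) : u = 0 := by
  by_contra hu0
  have hmod : l % 3 = 1 ∨ l % 3 = 2 := by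
    have : ¬ 3 ∣ l := (Nat.Prime.coprime_iff_not_dvd Nat.prime_three).1 hl3.symm
    omega
  rcases hmod with hmod | hmod
  · have hD : (l.choose 2 * u ^ 2 : ℤ) ≠ 0 :=
      mul_ne_zero (by exact_mod_cast (Nat.choose_pos hl').ne') (pow_ne_zero _ hu0)
    have hfin : FiniteMultiplicity (2 : ℤ) (l.choose 2 * u ^ 2) :=
      Int.finiteMultiplicity_iff.2 ⟨by norm_num, hD⟩
    obtain ⟨r, hr⟩ := exists_im_mk_one_pow_eq hu hl'
      (pow_multiplicity_dvd (2 : ℤ) (l.choose 2 * u ^ 2))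
    obtain ⟨k, rfl⟩ : ∃ k, l = 3 * (k + 1) + 1 := ⟨l / 3 - 1, by omega⟩
    have h₁ := omega_pow_three_mul_add (k + 1) 0
    have h₂ := omega_pow_three_mul_add k 2
    rw [h, show 3 * (k + 1) + 1 - 1 = 3 * (k + 1) + 0 from rfl,
      show 3 * (k + 1) + 1 - 2 = 3 * k + 2 by omega, h₁, h₂] at hr
    refine hfin.not_pow_dvd_of_multiplicity_lt (Nat.lt_succ_self _) ⟨r, ?_⟩
    simp [pow_two] at hr ⊢
    linarith
  · obtain ⟨k, rfl⟩ : ∃ k, l = 3 * k + 2 := ⟨l / 3, by omega⟩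
    obtain ⟨r, hr⟩ := Polynomial.powAddExpansion (omega : EisensteinInt)
      (u : EisensteinInt) (3 * k + 2)
    rw [add_comm, ← mk_one_eq, show 3 * k + 2 - 1 = 3 * k + 1 from rfl,
      omega_pow_three_mul_add k 1, pow_one, ← Int.cast_pow] at hr
    have him := congrArg QuadraticAlgebra.im hr
    rw [im_add, im_add, h] at him
    simp [pow_two u] at him
    have hzero : u * ((3 * k + 2 : ℕ) + r.im * u) = 0 := by
      push_cast
      linarith
    have hodd : Odd (((3 * k + 2 : ℕ) : ℤ) + r.im * u) :=
      (Int.odd_coe_nat _ |>.2 hl).add_even (hu.mul_left _)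
    rcases mul_eq_zero.1 hzero with h0 | h0
    · exact hu0 h0
    · rw [h0] at hodd
      exact absurd hodd (by decide)

theorem isUnit_im_omega_pow {l : ℕ} (hl3 : l.Coprime 3) :
    IsUnit ((omega : EisensteinInt) ^ l).im := by
  have h : ¬ 3 ∣ l := (Nat.Prime.coprime_iff_not_dvd Nat.prime_three).1 hl3.symm
  rw [← Nat.div_add_mod l 3, omega_pow_three_mul_add]
  obtain h | h : l % 3 = 1 ∨ l % 3 = 2 := by omega
  · simp [h]
  · simp [h, pow_two]

theorem im_mk_one_sub_pow (u : ℤ) {l : ℕ} (hl : Odd l) :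
    ((⟨1 - u, 1⟩ : EisensteinInt) ^ l).im = ((⟨u, 1⟩ : EisensteinInt) ^ l).im := by
  have h : (⟨1 - u, 1⟩ : EisensteinInt) = -star ⟨u, 1⟩ := by
    ext <;> simp [sub_eq_add_neg]
  rw [h, hl.neg_pow, ← star_pow, im_neg, im_star, neg_neg]

theorem eq_zero_or_eq_one_of_isUnit_im_pow {u : ℤ} {l : ℕ} (hl : l.Prime) (hl5 : 5 ≤ l)
    (hu : IsUnit ((⟨u, 1⟩ : EisensteinInt) ^ l).im) : u = 0 ∨ u = 1 := by
  have hodd : Odd l := hl.odd_of_ne_two (by omega)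
  have hl3 : l.Coprime 3 := (Nat.coprime_primes hl Nat.prime_three).2 (by omega)
  have key : ∀ v : ℤ, Even v → IsUnit ((⟨v, 1⟩ : EisensteinInt) ^ l).im → v = 0 := fun v hv hv' =>
    eq_zero_of_im_mk_one_pow_eq hv hodd hl3 (by omega)
      (im_mk_one_pow_eq hl (by omega) hv' (isUnit_im_omega_pow hl3))
  rcases Int.even_or_odd u with he | ho
  · exact .inl (key u he hu)
  · have := key (1 - u) (odd_one.sub_odd ho) (by rwa [im_mk_one_sub_pow u hodd])
    right; linarith


end EisensteinInt

theorem Nat.Prime.coprime_six {l : ℕ} (hl : l.Prime) (hl5 : 5 ≤ l) : l.Coprime 6 :=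
  Nat.Coprime.mul_right (m := 2) (n := 3) ((Nat.coprime_primes hl Nat.prime_two).2 (by omega))
    ((Nat.coprime_primes hl Nat.prime_three).2 (by omega))

open EisensteinInt

/-- Nagell's theorem on `z ^ 2 + z + 1 = b ^ l` for prime `l ≥ 5`, in the case `3 ∤ b`. -/
theorem eq_zero_or_eq_neg_one_of_sq_add_self_add_one_eq_pow {l : ℕ} (hl : l.Prime) (hl5 : 5 ≤ l)
    {z b : ℤ} (hz : IsCoprime (z ^ 2 + z + 1) 3) (h : z ^ 2 + z + 1 = b ^ l) :
    z = 0 ∨ z = -1 := by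
  have hodd : Odd l := hl.odd_of_ne_two (by omega)
  have hcop : IsCoprime (⟨z, -1⟩ : EisensteinInt) ⟨z + 1, 1⟩ := by
    obtain ⟨m, n, hmn⟩ := hz
    refine ⟨⟨m * (z + 1) + n, m + 2 * n⟩, ⟨-n, -2 * n⟩, ?_⟩
    ext
    · simp; linarith
    · simp; ring
  have hmul : (⟨z, -1⟩ : EisensteinInt) * ⟨z + 1, 1⟩ = (b : EisensteinInt) ^ l := by
    rw [← Int.cast_pow, ← h]
    ext <;> simp [pow_two] <;> ring
  obtain ⟨d, hd⟩ := exists_eq_pow_of_mul_eq_pow (hl.coprime_six hl5) hcop hmul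
  have hdu : IsUnit d.im :=
    isUnit_of_dvd_unit (im_dvd_im_pow d l) (by rw [← hd]; exact isUnit_one.neg)
  obtain ⟨u, hu⟩ : ∃ u : ℤ, d = ⟨u, 1⟩ ∨ d = -⟨u, 1⟩ := by
    rcases Int.isUnit_iff.1 hdu with h₁ | h₁
    · exact ⟨d.re, .inl (by ext <;> simp [h₁])⟩
    · exact ⟨-d.re, .inr (by ext <;> simp [h₁])⟩
  have him : IsUnit ((⟨u, 1⟩ : EisensteinInt) ^ l).im := by
    rcases hu with rfl | rfl
    · rw [← hd]; exact isUnit_one.neg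
    · rw [hodd.neg_pow] at hd
      rw [neg_eq_iff_eq_neg.1 hd.symm]
      simp
  have hnorm : norm (⟨z, -1⟩ : EisensteinInt) = 1 := by
    have hu1 : norm (⟨u, 1⟩ : EisensteinInt) = 1 := by
      rcases eq_zero_or_eq_one_of_isUnit_im_pow hl hl5 him with rfl | rfl <;> simp [norm_eq]
    rw [hd, map_pow]
    rcases hu with rfl | rfl
    · rw [hu1, one_pow]
    · rw [QuadraticAlgebra.norm_neg, hu1, one_pow]
  have hz0 : z * (z + 1) = 0 := by
    simp only [norm_eq] at hnorm
    linarith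
  rcases mul_eq_zero.1 hz0 with h | h
  · exact .inl h
  · exact .inr (by linarith)

theorem three_mul_sq_add_ne_pow {l : ℕ} (hl : l.Prime) (hl5 : 5 ≤ l) {w b : ℤ}
    (hw : (3 : ℤ) ^ (l - 2) ∣ 2 * w + 1) : 3 * w ^ 2 + 3 * w + 1 ≠ b ^ l := by
  intro h
  have hcop : IsCoprime (⟨w, 2 * w + 1⟩ : EisensteinInt) ⟨-w - 1, -(2 * w + 1)⟩ :=
    ⟨-1, -1, by ext <;> simp⟩
  have hmul : (⟨w, 2 * w + 1⟩ : EisensteinInt) * ⟨-w - 1, -(2 * w + 1)⟩ =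
      (b : EisensteinInt) ^ l := by
    rw [← Int.cast_pow, ← h]
    ext <;> simp [pow_two] <;> ring
  obtain ⟨d, hd⟩ := exists_eq_pow_of_mul_eq_pow (hl.coprime_six hl5) hcop hmul
  refine not_three_pow_dvd_im_pow (x := d) (hl.odd_of_ne_two (by omega))
    ((Nat.coprime_primes hl Nat.prime_three).2 (by omega)) (by omega) ?_ ?_
  · rw [← hd, trace_def]; ring
  · rwa [← hd]

theorem eq_zero_or_eq_neg_one_of_cube_add_cube_eq_cube {z y : ℤ}
    (h : z ^ 3 + (z + 1) ^ 3 = y ^ 3) : z = 0 ∨ z = -1 := by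
  by_contra! hz
  refine fermatLastTheoremFor_iff_int.1 fermatLastTheoremThree z (z + 1) y hz.1
    (fun h0 => hz.2 (by linarith)) ?_ h
  rintro rfl
  have h0 : (2 * z + 1) * (z ^ 2 + z + 1) = 0 := by linarith
  rcases mul_eq_zero.1 h0 with h | h
  · omega
  · nlinarith [sq_nonneg (2 * z + 1)]

theorem eq_zero_or_eq_neg_one_of_cube_add_cube_eq_pow {l : ℕ} (hl : l.Prime) (hl5 : 5 ≤ l)
    {z y : ℤ} (h : z ^ 3 + (z + 1) ^ 3 = y ^ l) : z = 0 ∨ z = -1 := by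
  have hodd : Odd l := hl.odd_of_ne_two (by omega)
  have hmul : (2 * z + 1) * (z ^ 2 + z + 1) = y ^ l := by rw [← h]; ring
  by_cases h3 : (3 : ℤ) ∣ 2 * z + 1
  · exfalso
    obtain ⟨w, rfl⟩ : ∃ w, z = 3 * w + 1 := ⟨z / 3, by omega⟩
    have hy : (3 : ℤ) ∣ y := Int.prime_three.dvd_of_dvd_pow (hmul ▸ h3.mul_right _)
    obtain ⟨v, rfl⟩ := hy
    have hw : (2 * w + 1) * (3 * w ^ 2 + 3 * w + 1) = 3 ^ (l - 2) * v ^ l := by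
      obtain ⟨k, rfl⟩ : ∃ k, l = k + 2 := ⟨l - 2, by omega⟩
      rw [mul_pow, pow_add 3 k 2] at hmul
      rw [Nat.add_sub_cancel]
      linarith
    have hcop3 : IsCoprime ((3 : ℤ) ^ (l - 2)) (3 * w ^ 2 + 3 * w + 1) :=
      IsCoprime.pow_left ⟨-(w ^ 2 + w), 1, by ring⟩
    have hdvd : (3 : ℤ) ^ (l - 2) ∣ 2 * w + 1 := hcop3.dvd_of_dvd_mul_right ⟨_, hw⟩
    obtain ⟨m, hm⟩ := hdvd
    have hmv : m * (3 * w ^ 2 + 3 * w + 1) = v ^ l := by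
      rw [hm, mul_assoc] at hw
      exact mul_left_cancel₀ (by positivity) hw
    have hcop : IsCoprime m (3 * w ^ 2 + 3 * w + 1) := by
      refine IsCoprime.of_isCoprime_of_dvd_left (y := 2 * w + 1) ?_ ⟨_, hm.trans (mul_comm _ _)⟩
      exact ⟨-3 * (2 * w + 1), 4, by ring⟩
    obtain ⟨b, hb⟩ := Int.eq_pow_of_mul_eq_pow_odd_right hcop hodd hmv
    exact three_mul_sq_add_ne_pow hl hl5 ⟨m, hm⟩ hb
  · have hcop3 : IsCoprime (3 : ℤ) (2 * z + 1) := (Int.prime_three.coprime_iff_not_dvd).2 h3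
    have hcop : IsCoprime (2 * z + 1) (z ^ 2 + z + 1) := by
      obtain ⟨m, n, hmn⟩ := hcop3
      exact ⟨n - m * (2 * z + 1), 4 * m, by linear_combination hmn⟩
    obtain ⟨b, hb⟩ := Int.eq_pow_of_mul_eq_pow_odd_right hcop hodd hmul
    refine eq_zero_or_eq_neg_one_of_sq_add_self_add_one_eq_pow hl hl5 ?_ hb
    have : IsCoprime (3 : ℤ) ((2 * z + 1) ^ 2) := hcop3.pow_right
    obtain ⟨m, n, hmn⟩ := this
    exact ⟨4 * n, m - n, by linear_combination hmn⟩

/-- The only solutions in integers `z`, `y` to `z³ + (z+1)³ = yˡ`, for a prime `ℓ ≥ 3`,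
are `(z, y) = (0, 1)` and `(z, y) = (-1, -1)`. -/
theorem sum_two_consecutive_cubes_perfect_power (ℓ : ℕ) (hℓ : ℓ.Prime) (h3 : 3 ≤ ℓ)
    (z y : ℤ) :
    z ^ 3 + (z + 1) ^ 3 = y ^ ℓ ↔ (z = 0 ∧ y = 1) ∨ (z = -1 ∧ y = -1) := by
  have hodd : Odd ℓ := hℓ.odd_of_ne_two (by omega)
  constructor
  · intro h
    have hz : z = 0 ∨ z = -1 := by
      rcases h3.eq_or_lt with rfl | h3
      · exact eq_zero_or_eq_neg_one_of_cube_add_cube_eq_cube h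
      · have h4 : ℓ ≠ 4 := by rintro rfl; exact absurd hℓ (by norm_num)
        exact eq_zero_or_eq_neg_one_of_cube_add_cube_eq_pow hℓ (by omega) h
    rcases hz with rfl | rfl
    · exact .inl ⟨rfl, hodd.strictMono_pow.injective (by simpa using h.symm)⟩
    · exact .inr ⟨rfl, hodd.strictMono_pow.injective (by simpa [hodd.neg_one_pow] using h.symm)⟩
  · rintro (⟨rfl, rfl⟩ | ⟨rfl, rfl⟩)
    · simp
    · simp [hodd.neg_one_pow, Odd.neg_one_pow (show Odd 3 by decide)]
end

section
/- Let ℓ be a prime. The only solutions in integers x ≥ 1, y to the equation (x+1)³ + (x+2)³ + (x+3)³ = yˡ are (x, y, ℓ) = (22, 204, 2), (22, −204, 2) and (2, 6, 3). -/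
open Finset Polynomial

/-! ### Interpolation determinants -/

lemma sum_range_card_le_sum {ι : Type*} [Fintype ι] (r : ι → ℕ)
    (hr : ∀ i j, i ≠ j → r i = r j → Fintype.card ι ≤ r i) :
    Fintype.card ι * (Fintype.card ι - 1) / 2 ≤ ∑ i, r i := by
  classical
  set N := Fintype.card ι with hN
  have hcount : ∀ t < N, N - (t + 1) ≤ #{i : ι | t < r i} := by
    intro t ht
    have h1 : #{i : ι | r i ≤ t} ≤ t + 1 := by
      have := Finset.card_le_card_of_injOn (s := ({i : ι | r i ≤ t} : Finset ι))
        (t := range (t + 1)) r (by intro i hi; simp at hi ⊢; omega) (by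
          intro i hi j hj hij
          by_contra hne
          have := hr i j hne hij
          simp at hi
          omega)
      simpa using this
    have h2 := Finset.card_filter_add_card_filter_not (s := (univ : Finset ι)) (fun i => r i ≤ t)
    simp only [not_le, Finset.card_univ] at h2
    omega
  have h3 : ∀ i, #{t ∈ range N | t < r i} ≤ r i := by
    intro i
    calc #{t ∈ range N | t < r i} ≤ #(range (r i)) := by
          apply Finset.card_le_card; intro t; simp
      _ = r i := by simp
  have h5 : ∑ t ∈ range N, (N - (t + 1)) = N * (N - 1) / 2 := by
    rw [← Finset.sum_range_id, ← Finset.sum_range_reflect]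
    apply Finset.sum_congr rfl; intro t ht; simp at ht; omega
  calc N * (N - 1) / 2 = ∑ t ∈ range N, (N - (t + 1)) := h5.symm
    _ ≤ ∑ t ∈ range N, #{i : ι | t < r i} :=
        Finset.sum_le_sum (fun t ht => hcount t (by simpa using ht))
    _ = ∑ i, #{t ∈ range N | t < r i} := by
        simp only [Finset.card_filter]; exact Finset.sum_comm
    _ ≤ ∑ i, r i := Finset.sum_le_sum (fun i _ => h3 i)

lemma abs_det_le_factorial_mul_prod {ι : Type*} [Fintype ι] [DecidableEq ι] (A : Matrix ι ι ℝ)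
    (b : ι → ℝ) (h : ∀ i j, |A i j| ≤ b i) :
    |A.det| ≤ (Fintype.card ι).factorial * ∏ i, b i := by
  rw [← Matrix.det_transpose, Matrix.det_apply]
  calc _ ≤ ∑ σ : Equiv.Perm ι, ∏ i, b i := by
        refine (Finset.abs_sum_le_sum_abs _ _).trans (Finset.sum_le_sum fun σ _ => ?_)
        have : |Equiv.Perm.sign σ • ∏ i, A.transpose (σ i) i| = ∏ i, |A i (σ i)| := by
          rw [← Finset.abs_prod]
          rcases Int.units_eq_one_or (Equiv.Perm.sign σ) with h | h <;> simp [h]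
        rw [this]
        exact Finset.prod_le_prod (fun i _ => abs_nonneg _) (fun i _ => h _ _)
    _ = _ := by simp [Fintype.card_perm]

lemma abs_det_mul_pow_le {ι : Type*} [Fintype ι] [DecidableEq ι] (M : Matrix ι ι ℝ)
    (a : ι → ℕ → ℝ) (e : ι → ι → ℝ) (x : ι → ℝ) (X ρ : ℝ) (hX : 0 ≤ X) (hρ : 1 ≤ ρ)
    (ε w : ι → ℝ)
    (hM : ∀ i j, M i j = ∑ m ∈ range (Fintype.card ι), a i m * x j ^ m + e i j)
    (hx : ∀ j, |x j| ≤ X)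
    (he : ∀ i j, |e i j| * ρ ^ Fintype.card ι ≤ ε i)
    (hw : ∀ i, ∑ m ∈ range (Fintype.card ι), |a i m| * (ρ * X) ^ m + ε i ≤ w i) :
    |M.det| * ρ ^ (Fintype.card ι * (Fintype.card ι - 1) / 2) ≤
      (Fintype.card ι).factorial * ∏ i, w i := by
  set N := Fintype.card ι with hN
  have hρ0 : 0 < ρ := by linarith
  let G : ι → Fin (N + 1) → ι → ℝ := fun i m j =>
    if (m : ℕ) < N then a i m * x j ^ (m : ℕ) else e i j
  let c : ι → Fin (N + 1) → ℝ := fun i m =>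
    if (m : ℕ) < N then |a i m| * (ρ * X) ^ (m : ℕ) else ε i
  have hMG : M = fun i => ∑ m, G i m := by
    ext i j
    rw [hM, Finset.sum_apply, Fin.sum_univ_castSucc, Finset.sum_range]
    simp [G]
  have hε : ∀ i, 0 ≤ ε i := fun i => le_trans (by positivity) (he i i)
  have hc0 : ∀ i m, 0 ≤ c i m := by
    intro i m; simp only [c]; split_ifs
    · positivity
    · exact hε i
  have hcw : ∀ i, ∑ m, c i m ≤ w i := by
    intro i
    rw [Fin.sum_univ_castSucc]
    simpa [c, Finset.sum_range] using hw i
  have hG : ∀ i m j, |G i m j| * ρ ^ (m : ℕ) ≤ c i m := by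
    intro i m j
    simp only [G, c]
    split_ifs with h
    · rw [abs_mul, abs_pow, mul_pow, mul_assoc, mul_comm (ρ ^ _)]
      gcongr
      exact hx j
    · have : (m : ℕ) = N := by omega
      rw [this]; exact he i j
  have hterm : ∀ r : ι → Fin (N + 1),
      |Matrix.det (fun i => G i (r i))| * ρ ^ (N * (N - 1) / 2) ≤
        N.factorial * ∏ i, c i (r i) := by
    intro r
    by_cases hcol : ∃ i j, i ≠ j ∧ r i = r j ∧ (r i : ℕ) < N
    · obtain ⟨i, j, hij, hr, hlt⟩ := hcol
      have : Matrix.det (fun i => G i (r i)) = 0 := by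
        by_cases ha : a i (r i) = 0
        · refine Matrix.det_eq_zero_of_row_eq_zero i (fun k => ?_)
          simp [G, hlt, ha]
        · have h1 := Matrix.det_updateRow_add_smul_self (fun i => G i (r i)) hij.symm
            (-(a j (r j) / a i (r i)))
          rw [← h1]
          refine Matrix.det_eq_zero_of_row_eq_zero j (fun k => ?_)
          rw [congrFun (Matrix.updateRow_self (M := fun i => G i (r i))) k]
          simp only [Pi.add_apply, Pi.smul_apply, smul_eq_mul, G, ← hr, hlt, if_true]
          field_simp
          ring
      rw [this]
      simp only [abs_zero, zero_mul]
      exact mul_nonneg (by positivity) (Finset.prod_nonneg fun i _ => hc0 _ _)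
    · push Not at hcol
      have hs := sum_range_card_le_sum (fun i => (r i : ℕ))
        (fun i j hij h => hcol i j hij (Fin.ext h))
      have h1 := abs_det_le_factorial_mul_prod (fun i => G i (r i))
        (fun i => c i (r i) / ρ ^ (r i : ℕ)) (fun i j => by
          rw [le_div_iff₀ (by positivity)]; exact hG i (r i) j)
      rw [Finset.prod_div_distrib, Finset.prod_pow_eq_pow_sum] at h1
      calc _ ≤ |Matrix.det (fun i => G i (r i))| * ρ ^ (∑ i, (r i : ℕ)) := by
            gcongr
        _ ≤ _ := by
            rw [← mul_div_assoc, le_div_iff₀ (by positivity)] at h1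
            exact h1
  have hdet : M.det = ∑ r : ι → Fin (N + 1), Matrix.det (fun i => G i (r i)) := by
    rw [hMG]
    exact (Matrix.detRowAlternating (R := ℝ) (n := ι)).toMultilinearMap.map_sum G
  calc _ ≤ ∑ r : ι → Fin (N + 1), |Matrix.det (fun i => G i (r i))| * ρ ^ (N * (N - 1) / 2) := by
        rw [hdet, ← Finset.sum_mul]
        gcongr
        exact Finset.abs_sum_le_sum_abs _ _
    _ ≤ ∑ r : ι → Fin (N + 1), (N.factorial : ℝ) * ∏ i, c i (r i) :=
        Finset.sum_le_sum fun r _ => hterm r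
    _ = N.factorial * ∏ i, ∑ m, c i m := by
        rw [← Finset.mul_sum, Finset.prod_univ_sum, Fintype.piFinset_univ]
    _ ≤ _ := by
        gcongr with i
        · exact fun i _ => Finset.sum_nonneg fun m _ => hc0 _ _
        · exact hcw i

lemma exists_det_ne_zero {ι J : Type*} [Fintype ι] [DecidableEq ι] [Fintype J]
    (M : Matrix ι J ℝ) (h : LinearIndependent ℝ M.row) :
    ∃ c : ι → J, (Matrix.of fun i j => M i (c j)).det ≠ 0 := by
  have hrank := h.rank_matrix
  rw [Matrix.rank_eq_finrank_span_cols] at hrank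
  have htop : Submodule.span ℝ (Set.range M.col) = ⊤ := by
    apply Submodule.eq_top_of_finrank_eq
    rw [hrank, Module.finrank_fintype_fun_eq_card]
  obtain ⟨κ, a, ha, hspan, hli⟩ := exists_linearIndependent' ℝ M.col
  have : Finite κ := Finite.of_injective a ha
  cases nonempty_fintype κ
  have hcard : Fintype.card κ = Fintype.card ι := by
    rw [linearIndependent_iff_card_eq_finrank_span.mp hli, Set.finrank, hspan, htop, finrank_top,
      Module.finrank_fintype_fun_eq_card]
  let e : ι ≃ κ := (Fintype.equivOfCardEq hcard).symm
  refine ⟨a ∘ e, ?_⟩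
  have h2 : LinearIndependent ℝ (Matrix.of fun i j => M i ((a ∘ e) j)).col :=
    hli.comp e e.injective
  rw [Matrix.linearIndependent_cols_iff_isUnit, Matrix.isUnit_iff_isUnit_det] at h2
  exact h2.ne_zero

lemma eq_zero_of_add_mul_eq_zero {R m K : ℕ} (hK : K ≤ m * R)
    (A B : ℝ[X]) (hA : A.degree < K) (hB : B.degree < K) (v : ℝ) (hv : v ≠ 1)
    (x T : Fin R → ℕ → ℝ)
    (hx1 : ∀ r s, x r (s + 1) = x r s + 1) (hT1 : ∀ r s, T r (s + 1) = T r s * v)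
    (hT0 : ∀ r s, T r s ≠ 0)
    (hinj : Function.Injective fun p : Fin R × Fin (2 * m) => x p.1 p.2)
    (h : ∀ r, ∀ s ≤ 2 * m, A.eval (x r s) + B.eval (x r s) * T r s = 0) :
    A = 0 ∧ B = 0 := by
  have key : ∀ C : ℝ[X], C.degree < ((2 * K : ℕ) : WithBot ℕ) →
      (∀ (r : Fin R) (s : Fin (2 * m)), C.eval (x r s) = 0) → C = 0 := by
    intro C hC hC0
    by_contra hne
    refine hne (Polynomial.eq_zero_of_natDegree_lt_card_of_eval_eq_zero C hinj
      (fun p => hC0 p.1 p.2) ?_)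
    rw [Polynomial.degree_eq_natDegree hne] at hC
    have : C.natDegree < 2 * K := by exact_mod_cast hC
    simp only [Fintype.card_prod, Fintype.card_fin]
    nlinarith
  have hK2 : ((K : ℕ) : WithBot ℕ) ≤ ((2 * K : ℕ) : WithBot ℕ) := by
    exact_mod_cast (by omega : K ≤ 2 * K)
  have hA0 : B = 0 → A = 0 := by
    rintro rfl
    refine key A (hA.trans_le hK2) fun r s => ?_
    simpa using h r s s.2.le
  have hB0 : A = 0 → B = 0 := by
    rintro rfl
    refine key B (hB.trans_le hK2) fun r s => ?_
    simpa [hT0] using h r s s.2.le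
  by_contra hcon
  have hAne : A ≠ 0 := fun h => hcon ⟨h, hB0 h⟩
  have hBne : B ≠ 0 := fun h => hcon ⟨hA0 h, h⟩
  set G := C v * (A * taylor 1 B) - taylor 1 A * B with hG
  have hnA : A.natDegree < K := by rwa [← Polynomial.natDegree_lt_iff_degree_lt hAne] at hA
  have hnB : B.natDegree < K := by rwa [← Polynomial.natDegree_lt_iff_degree_lt hBne] at hB
  have hcoeff : ∀ P Q : ℝ[X], (P * Q).coeff (P.natDegree + Q.natDegree) =
      P.leadingCoeff * Q.leadingCoeff := Polynomial.coeff_mul_degree_add_degree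
  have hGne : G.coeff (A.natDegree + B.natDegree) ≠ 0 := by
    have h1 := hcoeff A (taylor 1 B)
    have h2 := hcoeff (taylor 1 A) B
    rw [Polynomial.natDegree_taylor, Polynomial.leadingCoeff_taylor] at h1 h2
    rw [hG, Polynomial.coeff_sub, Polynomial.coeff_C_mul, h1, h2]
    have : v * (A.leadingCoeff * B.leadingCoeff) - A.leadingCoeff * B.leadingCoeff =
      (v - 1) * (A.leadingCoeff * B.leadingCoeff) := by ring
    rw [this]
    exact mul_ne_zero (sub_ne_zero.mpr hv) (mul_ne_zero (by simpa) (by simpa))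
  apply hGne
  suffices G = 0 by simp [this]
  apply key
  · have hd : G.natDegree ≤ A.natDegree + B.natDegree := by
      refine (Polynomial.natDegree_sub_le _ _).trans (max_le ?_ ?_)
      · refine (Polynomial.natDegree_C_mul_le _ _).trans ((Polynomial.natDegree_mul_le).trans ?_)
        rw [Polynomial.natDegree_taylor]
      · refine (Polynomial.natDegree_mul_le).trans ?_
        rw [Polynomial.natDegree_taylor]
    refine (Polynomial.degree_le_natDegree).trans_lt ?_
    exact_mod_cast (by omega : G.natDegree < 2 * K)
  · intro r s
    have h1 := h r s s.2.le
    have h2 := h r (s + 1) s.2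
    rw [hx1, hT1] at h2
    simp only [hG, Polynomial.eval_sub, Polynomial.eval_mul, Polynomial.eval_C,
      Polynomial.taylor_eval]
    apply mul_right_cancel₀ (hT0 r s)
    linear_combination (v * T r s * eval (x r ↑s + 1) B) * h1 -
      (eval (x r ↑s) B * T r s) * h2

lemma abs_coeff_mul_le {p q P Q : ℝ[X]} (hp : ∀ u, |p.coeff u| ≤ P.coeff u)
    (hq : ∀ u, |q.coeff u| ≤ Q.coeff u) (u : ℕ) : |(p * q).coeff u| ≤ (P * Q).coeff u := by
  rw [Polynomial.coeff_mul, Polynomial.coeff_mul]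
  refine (Finset.abs_sum_le_sum_abs _ _).trans (Finset.sum_le_sum fun a _ => ?_)
  rw [abs_mul]
  exact mul_le_mul (hp _) (hq _) (abs_nonneg _) ((abs_nonneg _).trans (hp _))

lemma abs_coeff_descPochhammer_le (k u : ℕ) :
    |(descPochhammer ℝ k).coeff u| ≤ ((X + C (k : ℝ)) ^ k).coeff u := by
  have key : ∀ n ≤ k, ∀ u,
      |(descPochhammer ℝ n).coeff u| ≤ ((X + C (k : ℝ)) ^ n).coeff u := by
    intro n
    induction n with
    | zero => intro _ u; simp [Polynomial.coeff_one]; split_ifs <;> simp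
    | succ n ih =>
      intro hn u
      rw [descPochhammer_succ_right, pow_succ]
      refine abs_coeff_mul_le (ih (by omega)) (fun u => ?_) u
      have hnk : (n : ℝ) ≤ k := by exact_mod_cast (by omega : n ≤ k)
      rw [← Polynomial.C_eq_natCast]
      rcases u with _ | _ | u
      · simpa using hnk
      · simp
      · simp [Polynomial.coeff_X]
  exact key k le_rfl u

lemma sum_abs_coeff_mul_pow_le {p P : ℝ[X]} (hp : ∀ u, |p.coeff u| ≤ P.coeff u) {Y : ℝ}
    (hY : 0 ≤ Y) (s : Finset ℕ) : ∑ u ∈ s, |p.coeff u| * Y ^ u ≤ P.eval Y := by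
  have h0 : ∀ u, 0 ≤ P.coeff u := fun u => (abs_nonneg _).trans (hp u)
  have h : P.eval Y = ∑ u ∈ s ∪ P.support, P.coeff u * Y ^ u := by
    rw [Polynomial.eval_eq_sum, Polynomial.sum_def]
    refine Finset.sum_subset Finset.subset_union_right fun u _ hu => ?_
    simp [Polynomial.notMem_support_iff.mp hu]
  rw [h]
  calc _ ≤ ∑ u ∈ s, P.coeff u * Y ^ u :=
        Finset.sum_le_sum fun u _ => mul_le_mul_of_nonneg_right (hp u) (by positivity)
    _ ≤ _ := Finset.sum_le_sum_of_subset_of_nonneg Finset.subset_union_left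
        fun u _ _ => mul_nonneg (h0 u) (by positivity)

lemma exists_taylor_truncation (p P : ℝ[X]) (hp : ∀ u, |p.coeff u| ≤ P.coeff u) (β X ρ : ℝ)
    (hβ : 0 ≤ β) (hX : 0 ≤ X) (hρ : 1 ≤ ρ) (N : ℕ) :
    ∃ (a : ℕ → ℝ) (ε : ℝ),
      ∑ m ∈ range N, |a m| * (ρ * X) ^ m + ε ≤ P.eval (ρ * X) * Real.exp (β * (ρ * X)) ∧
      ∀ x, |x| ≤ X →
        |p.eval x * Real.exp (β * x) - ∑ m ∈ range N, a m * x ^ m| * ρ ^ N ≤ ε := by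
  set Y := ρ * X with hYdef
  have hY : 0 ≤ Y := by positivity
  let a : ℕ → ℝ := fun m => ∑ q ∈ antidiagonal m, p.coeff q.1 * (β ^ q.2 / q.2.factorial)
  have hpsum : ∀ x : ℝ, HasSum (fun u => p.coeff u * x ^ u) (p.eval x) := by
    intro x
    rw [Polynomial.eval_eq_sum, Polynomial.sum_def]
    refine hasSum_sum_of_ne_finset_zero fun u hu => ?_
    simp [Polynomial.notMem_support_iff.mp hu]
  have hpabs : ∀ x : ℝ, Summable (fun u => ‖p.coeff u * x ^ u‖) := fun x =>
    (hpsum x).summable.norm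
  have hesum : ∀ x : ℝ, HasSum (fun t : ℕ => β ^ t / t.factorial * x ^ t) (Real.exp (β * x)) := by
    intro x
    have := NormedSpace.expSeries_div_hasSum_exp (𝔸 := ℝ) (β * x)
    rw [← Real.exp_eq_exp_ℝ] at this
    simpa only [mul_pow, div_mul_eq_mul_div] using this
  have heabs : ∀ x : ℝ, Summable (fun t : ℕ => ‖β ^ t / t.factorial * x ^ t‖) := fun x =>
    (hesum x).summable.norm
  have hprod : ∀ x : ℝ, HasSum (fun m => a m * x ^ m) (p.eval x * Real.exp (β * x)) := by
    intro x
    have h1 := tsum_mul_tsum_eq_tsum_sum_antidiagonal_of_summable_norm (hpabs x) (heabs x)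
    have h2 := (summable_norm_sum_mul_antidiagonal_of_summable_norm (hpabs x) (heabs x)).of_norm
    rw [(hpsum x).tsum_eq, (hesum x).tsum_eq] at h1
    have h3 := h2.hasSum
    rw [← h1] at h3
    have h4 : (fun m => a m * x ^ m) = fun m => ∑ q ∈ antidiagonal m,
        p.coeff q.1 * x ^ q.1 * (β ^ q.2 / q.2.factorial * x ^ q.2) := by
      funext m
      simp only [a]
      rw [Finset.sum_mul]
      refine Finset.sum_congr rfl fun q hq => ?_
      rw [← Finset.HasAntidiagonal.mem_antidiagonal.mp hq, pow_add]
      ring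
    rw [h4]
    exact h3
  have hbound : Summable (fun m => |a m| * Y ^ m) ∧
      ∑' m, |a m| * Y ^ m ≤ P.eval Y * Real.exp (β * Y) := by
    have h1 := tsum_mul_tsum_eq_tsum_sum_antidiagonal_of_summable_norm
      (f := fun u => ‖p.coeff u * Y ^ u‖) (g := fun t : ℕ => ‖β ^ t / t.factorial * Y ^ t‖)
      (by simpa using hpabs Y) (by simpa using heabs Y)
    have h2 := (summable_norm_sum_mul_antidiagonal_of_summable_norm
      (f := fun u => ‖p.coeff u * Y ^ u‖) (g := fun t : ℕ => ‖β ^ t / t.factorial * Y ^ t‖)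
      (by simpa using hpabs Y) (by simpa using heabs Y)).of_norm
    have h3 : ∀ m, |a m| * Y ^ m ≤
        ∑ q ∈ antidiagonal m, ‖p.coeff q.1 * Y ^ q.1‖ * ‖β ^ q.2 / q.2.factorial * Y ^ q.2‖ := by
      intro m
      calc |a m| * Y ^ m ≤ (∑ q ∈ antidiagonal m, |p.coeff q.1 * (β ^ q.2 / q.2.factorial)|)
            * Y ^ m := by gcongr; exact Finset.abs_sum_le_sum_abs _ _
        _ = _ := by
          rw [Finset.sum_mul]
          refine Finset.sum_congr rfl fun q hq => ?_
          rw [← Finset.HasAntidiagonal.mem_antidiagonal.mp hq, pow_add]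
          simp only [Real.norm_eq_abs, abs_mul, abs_pow, abs_of_nonneg hY]
          ring
    have h4 : Summable (fun m => |a m| * Y ^ m) :=
      Summable.of_nonneg_of_le (fun m => by positivity) h3 h2
    refine ⟨h4, (h4.tsum_le_tsum h3 h2).trans ?_⟩
    rw [← h1]
    have h5 : ∑' t : ℕ, ‖β ^ t / t.factorial * Y ^ t‖ = Real.exp (β * Y) := by
      rw [← (hesum Y).tsum_eq]
      refine tsum_congr fun t => ?_
      rw [Real.norm_of_nonneg (by positivity)]
    rw [h5]
    gcongr
    refine (hpabs Y).tsum_le_of_sum_le fun s => ?_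
    have := sum_abs_coeff_mul_pow_le hp hY s
    simpa [abs_mul, abs_of_nonneg hY] using this
  refine ⟨a, ∑' m, |a (m + N)| * Y ^ (m + N), ?_, ?_⟩
  · rw [hbound.1.sum_add_tsum_nat_add N]
    exact hbound.2
  · intro x hx
    have h1 := (hprod x).summable.sum_add_tsum_nat_add N
    rw [(hprod x).tsum_eq] at h1
    rw [← h1, add_sub_cancel_left]
    have h2 : ∀ m, ‖a (m + N) * x ^ (m + N)‖ ≤ |a (m + N)| * Y ^ (m + N) / ρ ^ N := by
      intro m
      rw [le_div_iff₀ (by positivity), Real.norm_eq_abs, abs_mul, abs_pow, hYdef, mul_pow]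
      have : |x| ^ (m + N) * ρ ^ N ≤ ρ ^ (m + N) * X ^ (m + N) := by
        rw [mul_comm]
        gcongr
        omega
      nlinarith [abs_nonneg (a (m + N))]
    have h3 : Summable (fun m => |a (m + N)| * Y ^ (m + N)) :=
      (summable_nat_add_iff N).mpr hbound.1
    have h4 := tsum_of_norm_bounded (h3.div_const (ρ ^ N)).hasSum h2
    rw [tsum_div_const, le_div_iff₀ (by positivity)] at h4
    exact h4

/-- The binomial polynomial `x ↦ x.choose k`. -/
noncomputable def binomialPoly (k : ℕ) : ℝ[X] := C (1 / (k.factorial : ℝ)) * descPochhammer ℝ k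

lemma binomialPoly_eval_intCast (k : ℕ) (n : ℤ) :
    (binomialPoly k).eval (n : ℝ) = ((Ring.choose n k : ℤ) : ℝ) := by
  have h := Ring.descPochhammer_eq_factorial_smul_choose n k
  rw [← Polynomial.eval_eq_smeval, nsmul_eq_mul] at h
  have h2 : (descPochhammer ℝ k).eval (n : ℝ) = ((descPochhammer ℤ k).eval n : ℤ) :=
    by rw [← descPochhammer_map (Int.castRingHom ℝ), Polynomial.eval_intCast_map]; simp
  rw [binomialPoly, Polynomial.eval_mul, Polynomial.eval_C, h2, h]
  push_cast
  field_simp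

lemma degree_binomialPoly (k : ℕ) : (binomialPoly k).degree = k := by
  have h : (1 / (k.factorial : ℝ)) ≠ 0 := by positivity
  rw [binomialPoly, Polynomial.degree_C_mul h,
    Polynomial.degree_eq_natDegree (monic_descPochhammer ℝ k).ne_zero, descPochhammer_natDegree]

lemma abs_coeff_binomialPoly_le (k u : ℕ) :
    |(binomialPoly k).coeff u| ≤ (C (1 / (k.factorial : ℝ)) * (X + C (k : ℝ)) ^ k).coeff u := by
  rw [binomialPoly, Polynomial.coeff_C_mul, Polynomial.coeff_C_mul, abs_mul,
    abs_of_nonneg (by positivity)]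
  gcongr
  exact abs_coeff_descPochhammer_le k u

lemma linearIndependent_interpolation_rows {ϱ m K ℓ : ℕ} (hK : K ≤ m * (2 * ϱ + 1))
    (hmℓ : 2 * m < ℓ) (α v : ℝ) (hα : α ≠ 0) (hv0 : v ≠ 0) (hv : v ≠ 1) :
    LinearIndependent ℝ (Matrix.of fun (i : Fin K ⊕ Fin K)
      (j : Fin (2 * ϱ + 1) × Fin (2 * m + 1)) =>
        Sum.elim (fun k : Fin K => (binomialPoly k).eval ((((j.1 : ℤ) - ϱ) * ℓ + j.2 : ℤ) : ℝ))
          (fun k : Fin K => (binomialPoly k).eval ((((j.1 : ℤ) - ϱ) * ℓ + j.2 : ℤ) : ℝ) *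
            (α ^ ((j.1 : ℤ) - ϱ) * v ^ (j.2 : ℕ))) i).row := by
  have hli : LinearIndependent ℝ (fun k : Fin K => binomialPoly k) := by
    let S : Polynomial.Sequence ℝ := ⟨binomialPoly, degree_binomialPoly⟩
    have : LinearIndependent ℝ (fun k : ℕ => binomialPoly k) :=
      S.linearIndependent
    exact this.comp _ Fin.val_injective
  rw [Fintype.linearIndependent_iff]
  intro g hg
  have hdeg : ∀ c : Fin K → ℝ, (∑ k, c k • binomialPoly k).degree < K := by
    intro c
    refine (Polynomial.degree_sum_le _ _).trans_lt ?_
    refine (Finset.sup_lt_iff (WithBot.bot_lt_coe K)).mpr ?_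
    intro k _
    refine (Polynomial.degree_smul_le _ _).trans_lt ?_
    rw [degree_binomialPoly]
    exact Nat.cast_lt.mpr k.2
  obtain ⟨hA, hB⟩ := eq_zero_of_add_mul_eq_zero (R := 2 * ϱ + 1) (m := m) hK
    (∑ k, g (Sum.inl k) • binomialPoly k) (∑ k, g (Sum.inr k) • binomialPoly k)
    (hdeg _) (hdeg _) v hv (fun r s => (((r : ℤ) - ϱ) * ℓ + s : ℤ))
    (fun r s => α ^ ((r : ℤ) - ϱ) * v ^ s) (by intro r s; push_cast; ring)
    (by intro r s; ring) (fun r s => by positivity)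
    (by
      rintro ⟨r, s⟩ ⟨r', s'⟩ h
      have h1 : ((r : ℤ) - ϱ) * ℓ + s = ((r' : ℤ) - ϱ) * ℓ + s' := Int.cast_injective (α := ℝ) h
      have hs := s.2
      have hs' := s'.2
      have h2 : (r : ℤ) = r' := by
        by_contra hne
        rcases lt_or_gt_of_ne hne with hlt | hlt
        · have : ((r : ℤ) + 1) * ℓ ≤ r' * ℓ := by gcongr; omega
          have h3 : ((s : ℕ) : ℤ) < ℓ := by omega
          have h4 : (0 : ℤ) ≤ ((s' : ℕ) : ℤ) := by positivity
          linarith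
        · have : ((r' : ℤ) + 1) * ℓ ≤ r * ℓ := by gcongr; omega
          have h3 : ((s' : ℕ) : ℤ) < ℓ := by omega
          have h4 : (0 : ℤ) ≤ ((s : ℕ) : ℤ) := by positivity
          linarith
      rw [h2] at h1
      ext
      · exact_mod_cast h2
      · have : ((s : ℕ) : ℤ) = s' := by linarith
        exact_mod_cast this)
    (by
      intro r s hs
      have h := congrFun hg (r, ⟨s, by omega⟩)
      rw [Finset.sum_apply, Fintype.sum_sum_type] at h
      simp only [Polynomial.eval_finsetSum, Polynomial.eval_smul, smul_eq_mul, Finset.sum_mul]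
      simpa [Matrix.row, mul_assoc] using h)
  rw [Fintype.linearIndependent_iff] at hli
  rintro (k | k)
  · exact hli _ hA k
  · exact hli _ hB k

lemma one_le_of_interpolation_determinant {ϱ m ℓ P Q a b : ℕ} (hmℓ : 4 * m ≤ ℓ)
    (hm : 0 < m) (hQ : 0 < Q) (hPQ : Q < P) (ha : 0 < a) (hb : 0 < b) (ρ X : ℝ) (hρ : 1 ≤ ρ)
    (hX : X = (2 * ϱ + 1) * ℓ / 2) (K : ℕ) (hK : K = m * (2 * ϱ + 1))
    (hclose : ∀ r : ℤ, |r| ≤ ϱ →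
      |((a / b : ℝ) / (P / Q : ℝ) ^ ℓ) ^ r - 1| * ρ ^ (2 * K) ≤ 1) :
    (ρ ^ (K * (2 * K - 1)) : ℝ) ≤ ((a * b : ℝ) ^ ϱ * Q ^ (2 * m)) ^ K * ((2 * K).factorial *
      ∏ k : Fin K, ((1 / (k : ℕ).factorial * (ρ * X + k) ^ (k : ℕ)) *
        (2 * (1 / (k : ℕ).factorial * (ρ * X + k) ^ (k : ℕ) *
          Real.exp (Real.log (P / Q) * (ρ * X)))))) := by
  set α : ℝ := a / b with hα
  set v : ℝ := P / Q with hv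
  have hQ' : (0 : ℝ) < Q := by exact_mod_cast hQ
  have hP' : (0 : ℝ) < P := by exact_mod_cast hQ.trans hPQ
  have ha' : (0 : ℝ) < a := by exact_mod_cast ha
  have hb' : (0 : ℝ) < b := by exact_mod_cast hb
  have hα0 : 0 < α := by positivity
  have hv1 : 1 < v := by
    rw [hv, one_lt_div hQ']; exact_mod_cast hPQ
  have hv0 : 0 < v := by linarith
  set β := Real.log v with hβ
  have hβ0 : 0 ≤ β := Real.log_nonneg hv1.le
  have hX0 : 0 ≤ X := by rw [hX]; positivity
  have hρ0 : 0 < ρ := by linarith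
  obtain ⟨c, hc⟩ := exists_det_ne_zero _ (linearIndependent_interpolation_rows (ϱ := ϱ) (m := m)
    (K := K) (ℓ := ℓ) hK.le (by omega) α v hα0.ne' hv0.ne' hv1.ne')
  set y : Fin K ⊕ Fin K → ℤ := fun j => (((c j).1 : ℤ) - ϱ) * ℓ + (c j).2 with hy
  set M := Matrix.of fun (i j : Fin K ⊕ Fin K) =>
    Sum.elim (fun k : Fin K => (binomialPoly k).eval (y j : ℝ))
      (fun k : Fin K => (binomialPoly k).eval (y j : ℝ) *
        (α ^ (((c j).1 : ℤ) - ϱ) * v ^ ((c j).2 : ℕ))) i with hM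
  have hdet0 : M.det ≠ 0 := hc
  -- the arithmetic lower bound
  set D : ℝ := (a * b : ℝ) ^ ϱ * Q ^ (2 * m) with hD
  have hD0 : 0 < D := by positivity
  have hlow : 1 ≤ D ^ K * |M.det| := by
    let B : Matrix (Fin K ⊕ Fin K) (Fin K ⊕ Fin K) ℤ := fun i j =>
      Sum.elim (fun k : Fin K => Ring.choose (y j) (k : ℕ))
        (fun k : Fin K => Ring.choose (y j) (k : ℕ) * ((a : ℤ) ^ ((c j).1 : ℕ) *
          (b : ℤ) ^ (2 * ϱ - (c j).1 : ℕ) * (P : ℤ) ^ ((c j).2 : ℕ) *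
            (Q : ℤ) ^ (2 * m - (c j).2 : ℕ))) i
    let d : Fin K ⊕ Fin K → ℝ := Sum.elim (fun _ => 1) (fun _ => D)
    have hB : ((Int.castRingHom ℝ).mapMatrix B) = Matrix.of fun i j => d i * M i j := by
      ext i j
      rcases i with k | k
      · change ((B (Sum.inl k) j : ℤ) : ℝ) = d (Sum.inl k) * M (Sum.inl k) j
        simp [B, d, hM, binomialPoly_eval_intCast]
      · have hr := (c j).1.2
        have hs := (c j).2.2
        have e1 : (a * b : ℝ) ^ ϱ * α ^ (((c j).1 : ℤ) - ϱ) =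
            (a : ℝ) ^ ((c j).1 : ℕ) * (b : ℝ) ^ (2 * ϱ - (c j).1 : ℕ) := by
          rw [hα, zpow_sub₀ (by positivity), zpow_natCast, zpow_natCast, mul_pow, div_pow, div_pow]
          have : (b : ℝ) ^ (2 * ϱ - (c j).1 : ℕ) * (b : ℝ) ^ ((c j).1 : ℕ) =
              (b : ℝ) ^ ϱ * (b : ℝ) ^ ϱ := by
            rw [← pow_add, ← pow_add]; congr 1; omega
          field_simp
          linear_combination -this
        have e2 : (Q : ℝ) ^ (2 * m) * v ^ ((c j).2 : ℕ) =
            (P : ℝ) ^ ((c j).2 : ℕ) * (Q : ℝ) ^ (2 * m - (c j).2 : ℕ) := by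
          have : (Q : ℝ) ^ (2 * m) = (Q : ℝ) ^ (2 * m - (c j).2 : ℕ) * (Q : ℝ) ^ ((c j).2 : ℕ) := by
            rw [← pow_add]; congr 1; omega
          rw [hv, div_pow, this]
          field_simp
        have : ∀ z : ℝ, D * (z * (α ^ (((c j).1 : ℤ) - ϱ) * v ^ ((c j).2 : ℕ))) =
            z * (((a * b : ℝ) ^ ϱ * α ^ (((c j).1 : ℤ) - ϱ)) *
              ((Q : ℝ) ^ (2 * m) * v ^ ((c j).2 : ℕ))) := by
          intro z; rw [hD]; ring
        change ((B (Sum.inr k) j : ℤ) : ℝ) = d (Sum.inr k) * M (Sum.inr k) j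
        simp only [B, d, hM, Sum.elim_inr,
          Matrix.of_apply, this, e1, e2, binomialPoly_eval_intCast]
        simp [mul_assoc]
    have hdetB : ((B.det : ℤ) : ℝ) = D ^ K * M.det := by
      have h1 := RingHom.map_det (Int.castRingHom ℝ) B
      rw [hB, Matrix.det_mul_column] at h1
      simpa [d] using h1
    have hB0 : B.det ≠ 0 := by
      intro h
      rw [h, Int.cast_zero] at hdetB
      exact (mul_ne_zero (by positivity) hdet0) hdetB.symm
    have h2 : (1 : ℝ) ≤ |((B.det : ℤ) : ℝ)| := by exact_mod_cast Int.one_le_abs hB0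
    rwa [hdetB, abs_mul, abs_of_pos (by positivity)] at h2
  -- the analytic upper bound
  have hy' : ∀ j, |(y j : ℝ)| ≤ X := by
    intro j
    have hr := (c j).1.2
    have hs := (c j).2.2
    have h1 : ((c j).1 : ℝ) ≤ 2 * ϱ := by exact_mod_cast (by omega : ((c j).1 : ℕ) ≤ 2 * ϱ)
    have h2 : 4 * ((c j).2 : ℝ) ≤ 2 * ℓ := by
      exact_mod_cast (by omega : 4 * ((c j).2 : ℕ) ≤ 2 * ℓ)
    have h3 : (0 : ℝ) ≤ ((c j).1 : ℕ) := by positivity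
    have h4 : (0 : ℝ) ≤ ((c j).2 : ℕ) := by positivity
    have h5 : (0 : ℝ) ≤ ℓ := by positivity
    rw [hX, abs_le]
    simp only [hy]
    push_cast
    constructor <;> nlinarith
  have htrunc0 := fun k : Fin K => exists_taylor_truncation (binomialPoly k) _
    (abs_coeff_binomialPoly_le k) 0 X ρ le_rfl hX0 hρ (2 * K)
  have htrunc1 := fun k : Fin K => exists_taylor_truncation (binomialPoly k) _
    (abs_coeff_binomialPoly_le k) β X ρ hβ0 hX0 hρ (2 * K)
  choose a0 ε0 h0w h0e using htrunc0
  choose a1 ε1 h1w h1e using htrunc1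
  simp only [Polynomial.eval_mul, Polynomial.eval_C, Polynomial.eval_pow, Polynomial.eval_add,
    Polynomial.eval_X, zero_mul, Real.exp_zero, mul_one] at h0w h0e h1w
  set W : Fin K → ℝ := fun k => 1 / (k : ℕ).factorial * (ρ * X + k) ^ (k : ℕ) with hW
  set E := Real.exp (β * (ρ * X)) with hE
  have hcard : Fintype.card (Fin K ⊕ Fin K) = 2 * K := by simp; ring
  have hup := abs_det_mul_pow_le M (Sum.elim a0 a1)
    (fun i j => M i j - ∑ m ∈ range (2 * K), Sum.elim a0 a1 i m * (y j : ℝ) ^ m)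
    (fun j => (y j : ℝ)) X ρ hX0 hρ (Sum.elim ε0 (fun k => ε1 k + W k * E))
    (Sum.elim W (fun k => 2 * (W k * E))) (by intro i j; rw [hcard]; ring) hy'
    (by
      rw [hcard]
      rintro (k | k) j
      · exact h0e k (y j) (hy' j)
      · have hsplit : α ^ (((c j).1 : ℤ) - ϱ) * v ^ ((c j).2 : ℕ) =
            Real.exp (β * y j) * (α / v ^ ℓ) ^ (((c j).1 : ℤ) - ϱ) := by
          have h : Real.exp (β * y j) = v ^ (y j) := by
            rw [hβ, Real.exp_mul, Real.exp_log hv0, Real.rpow_intCast]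
          rw [h, div_zpow α, ← zpow_natCast v ℓ, ← zpow_mul, mul_comm (ℓ : ℤ), hy]
          simp only []
          rw [zpow_add₀ hv0.ne', zpow_natCast]
          have := zpow_pos hv0 ((((c j).1 : ℤ) - ϱ) * ℓ)
          field_simp
        set r : ℤ := ((c j).1 : ℤ) - ϱ with hr
        have hrle : |r| ≤ ϱ := by
          have := (c j).1.2
          rw [abs_le]; omega
        have hfE : |(binomialPoly k).eval (y j : ℝ) * Real.exp (β * y j)| ≤ W k * E := by
          rw [abs_mul, Real.abs_exp]
          have hyρ : |(y j : ℝ)| ≤ ρ * X := (hy' j).trans (le_mul_of_one_le_left hX0 hρ)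
          refine mul_le_mul ?_ (Real.exp_le_exp.mpr ?_) (Real.exp_pos _).le (by positivity)
          · have h := sum_abs_coeff_mul_pow_le (abs_coeff_binomialPoly_le k)
              (by positivity : 0 ≤ ρ * X) (binomialPoly k).support
            simp only [Polynomial.eval_mul, Polynomial.eval_C, Polynomial.eval_pow,
              Polynomial.eval_add, Polynomial.eval_X] at h
            refine le_trans ?_ h
            rw [Polynomial.eval_eq_sum, Polynomial.sum_def]
            refine (Finset.abs_sum_le_sum_abs _ _).trans (Finset.sum_le_sum fun u _ => ?_)
            rw [abs_mul, abs_pow]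
            gcongr
          · exact mul_le_mul_of_nonneg_left ((le_abs_self _).trans hyρ) hβ0
        have hdecomp : M (Sum.inr k) j - ∑ m ∈ range (2 * K), Sum.elim a0 a1 (Sum.inr k) m *
            (y j : ℝ) ^ m = ((binomialPoly k).eval (y j : ℝ) * Real.exp (β * y j) -
              ∑ m ∈ range (2 * K), a1 k m * (y j : ℝ) ^ m) +
            (binomialPoly k).eval (y j : ℝ) * Real.exp (β * y j) * ((α / v ^ ℓ) ^ r - 1) := by
          have hMk : M (Sum.inr k) j = (binomialPoly k).eval (y j : ℝ) *
              (α ^ r * v ^ ((c j).2 : ℕ)) := rfl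
          rw [hMk, hsplit]
          simp only [Sum.elim_inr]
          ring
        rw [hdecomp]
        have hpow : 0 < ρ ^ (2 * K) := by positivity
        calc _ ≤ (|(binomialPoly k).eval (y j : ℝ) * Real.exp (β * y j) -
              ∑ m ∈ range (2 * K), a1 k m * (y j : ℝ) ^ m| +
              |(binomialPoly k).eval (y j : ℝ) * Real.exp (β * y j)| * |(α / v ^ ℓ) ^ r - 1|) *
                ρ ^ (2 * K) := by
              gcongr
              rw [← abs_mul]
              exact abs_add_le _ _
          _ = |(binomialPoly k).eval (y j : ℝ) * Real.exp (β * y j) -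
              ∑ m ∈ range (2 * K), a1 k m * (y j : ℝ) ^ m| * ρ ^ (2 * K) +
              |(binomialPoly k).eval (y j : ℝ) * Real.exp (β * y j)| *
                (|(α / v ^ ℓ) ^ r - 1| * ρ ^ (2 * K)) := by ring
          _ ≤ ε1 k + W k * E * 1 := by
              gcongr
              · exact h1e k (y j) (hy' j)
              · exact hclose r hrle
          _ = _ := by simp)
    (by
      rw [hcard]
      rintro (k | k)
      · exact h0w k
      · have := h1w k
        simp only [Sum.elim_inr]
        linarith)
  rw [hcard, Fintype.prod_sum_type, ← Finset.prod_mul_distrib] at hup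
  simp only [Sum.elim_inl, Sum.elim_inr] at hup
  have hexp : 2 * K * (2 * K - 1) / 2 = K * (2 * K - 1) := by
    rw [mul_assoc, Nat.mul_div_cancel_left _ (by norm_num)]
  rw [hexp] at hup
  calc ρ ^ (K * (2 * K - 1)) ≤ (D ^ K * |M.det|) * ρ ^ (K * (2 * K - 1)) :=
        le_mul_of_one_le_left (by positivity) hlow
    _ = D ^ K * (|M.det| * ρ ^ (K * (2 * K - 1))) := by ring
    _ ≤ _ := by gcongr

lemma factorial_pow_le_two_pow_mul_prod (n : ℕ) :
    n.factorial ^ (n + 1) ≤ (2 ^ n) ^ (n + 1) * ∏ k ∈ range (n + 1), k.factorial ^ 2 := by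
  have h1 : ∏ k ∈ range (n + 1), k.factorial ^ 2 =
      ∏ k ∈ range (n + 1), (k.factorial * (n - k).factorial) := by
    simp_rw [pow_two]
    rw [Finset.prod_mul_distrib, Finset.prod_mul_distrib]
    congr 1
    simpa using (Finset.prod_range_reflect Nat.factorial (n + 1)).symm
  have h2 : (2 ^ n) ^ (n + 1) * ∏ k ∈ range (n + 1), k.factorial ^ 2 =
      ∏ k ∈ range (n + 1), (2 ^ n * (k.factorial * (n - k).factorial)) := by
    simp only [h1, Finset.prod_mul_distrib, Finset.prod_const, Finset.card_range]
  have h3 : n.factorial ^ (n + 1) = ∏ _k ∈ range (n + 1), n.factorial := by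
    rw [Finset.prod_const, Finset.card_range]
  rw [h2, h3]
  refine Finset.prod_le_prod' fun k hk => ?_
  rw [← Nat.choose_mul_factorial_mul_factorial (Nat.lt_succ_iff.mp (mem_range.mp hk)), mul_assoc]
  exact Nat.mul_le_mul_right _ (Nat.choose_le_two_pow n k)

lemma pow_le_of_interpolation_determinant {n : ℕ} {ρ D X Y : ℝ} (hρ : 0 ≤ ρ) (hD : 0 ≤ D)
    (hX : 0 ≤ X) (hY : 0 ≤ Y) (hnX : n ≤ X)
    (h : ρ ^ ((n + 1) * (2 * (n + 1) - 1)) ≤ D ^ (n + 1) * ((2 * (n + 1)).factorial *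
      ∏ k : Fin (n + 1), ((1 / (k : ℕ).factorial * (ρ * X + k) ^ (k : ℕ)) *
        (2 * (1 / (k : ℕ).factorial * (ρ * X + k) ^ (k : ℕ) * Y))))) :
    ρ ^ (2 * n + 1) * n ^ n ≤
      D * (2 * (n + 1)) ^ 2 * (2 * Y) * (2 * Real.exp 1 * ((ρ + 1) * X)) ^ n := by
  set Z := (ρ + 1) * X with hZ
  have hZ0 : 0 ≤ Z := by positivity
  have hfac : ((n : ℝ)) ^ n ≤ n.factorial * Real.exp 1 ^ n := by
    have := Real.pow_div_factorial_le_exp (n : ℝ) (by positivity) n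
    rw [div_le_iff₀ (by positivity)] at this
    rw [← Real.exp_nat_mul, mul_one, mul_comm]
    exact this
  have hkey : ρ ^ (2 * n + 1) * n.factorial ≤
      D * (2 * (n + 1)) ^ 2 * (2 * Y) * (Z ^ n * 2 ^ n) := by
    refine le_of_pow_le_pow_left₀ (Nat.succ_ne_zero n) (by positivity) ?_
    have e1 : ∏ k : Fin (n + 1), ((1 / (k : ℕ).factorial * (ρ * X + k) ^ (k : ℕ)) *
        (2 * (1 / (k : ℕ).factorial * (ρ * X + k) ^ (k : ℕ) * Y))) ≤
        ∏ k : Fin (n + 1), ((2 * Y) * Z ^ (2 * (k : ℕ)) * (((k : ℕ).factorial : ℝ) ^ 2)⁻¹) := by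
      refine Finset.prod_le_prod (fun k _ => by positivity) fun k _ => ?_
      have hk : ((k : ℕ) : ℝ) ≤ n := by exact_mod_cast Nat.lt_succ_iff.mp k.2
      have h1 : (ρ * X + k) ^ (k : ℕ) ≤ Z ^ (k : ℕ) := by
        gcongr
        rw [hZ]; linarith
      calc _ = (2 * Y) * ((ρ * X + k) ^ (k : ℕ)) ^ 2 * (((k : ℕ).factorial : ℝ) ^ 2)⁻¹ := by
            field_simp
        _ ≤ (2 * Y) * (Z ^ (k : ℕ)) ^ 2 * (((k : ℕ).factorial : ℝ) ^ 2)⁻¹ := by gcongr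
        _ = _ := by rw [← pow_mul, mul_comm (k : ℕ) 2]
    have e2 : ∏ k : Fin (n + 1), ((2 * Y) * Z ^ (2 * (k : ℕ)) *
        (((k : ℕ).factorial : ℝ) ^ 2)⁻¹) =
        (2 * Y) ^ (n + 1) * (Z ^ n) ^ (n + 1) *
          (∏ k ∈ range (n + 1), (k.factorial : ℝ) ^ 2)⁻¹ := by
      rw [Finset.prod_mul_distrib, Finset.prod_mul_distrib, Finset.prod_pow_eq_pow_sum,
        Finset.prod_inv_distrib, Finset.prod_const, Finset.card_univ, Fintype.card_fin,
        Fin.prod_univ_eq_prod_range (fun k => (k.factorial : ℝ) ^ 2),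
        Fin.sum_univ_eq_sum_range (fun k => 2 * k), ← Finset.mul_sum,
        mul_comm 2 (∑ k ∈ range (n + 1), k),
        Finset.sum_range_id_mul_two, ← pow_mul]
      simp [mul_comm]
    have e3 : (((2 * (n + 1)).factorial : ℕ) : ℝ) ≤ ((2 * (n + 1) : ℝ) ^ 2) ^ (n + 1) := by
      rw [← pow_mul]
      exact_mod_cast Nat.factorial_le_pow (2 * (n + 1))
    have e4 : (n.factorial : ℝ) ^ (n + 1) ≤
        (2 ^ n) ^ (n + 1) * ∏ k ∈ range (n + 1), (k.factorial : ℝ) ^ 2 := by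
      exact_mod_cast factorial_pow_le_two_pow_mul_prod n
    set F := ∏ k ∈ range (n + 1), (k.factorial : ℝ) ^ 2 with hF
    have hF0 : 0 < F := Finset.prod_pos fun k _ => by positivity
    have e5 : ρ ^ ((n + 1) * (2 * (n + 1) - 1)) = (ρ ^ (2 * n + 1)) ^ (n + 1) := by
      rw [← pow_mul]; congr 1; rw [mul_comm]; congr 1
    rw [e5] at h
    calc (ρ ^ (2 * n + 1) * n.factorial) ^ (n + 1)
        = (ρ ^ (2 * n + 1)) ^ (n + 1) * (n.factorial : ℝ) ^ (n + 1) := mul_pow _ _ _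
      _ ≤ (D ^ (n + 1) * (((2 * (n + 1) : ℝ) ^ 2) ^ (n + 1) *
            ((2 * Y) ^ (n + 1) * (Z ^ n) ^ (n + 1) * F⁻¹))) * ((2 ^ n) ^ (n + 1) * F) := by
          refine mul_le_mul (h.trans ?_) e4 (by positivity) (by positivity)
          gcongr
          exact e1.trans_eq e2
      _ = (D * (2 * (n + 1)) ^ 2 * (2 * Y) * (Z ^ n * 2 ^ n)) ^ (n + 1) := by
          simp only [mul_pow]
          field_simp
  calc ρ ^ (2 * n + 1) * n ^ n ≤ ρ ^ (2 * n + 1) * (n.factorial * Real.exp 1 ^ n) := by gcongr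
    _ = ρ ^ (2 * n + 1) * n.factorial * Real.exp 1 ^ n := by ring
    _ ≤ D * (2 * (n + 1)) ^ 2 * (2 * Y) * (Z ^ n * 2 ^ n) * Real.exp 1 ^ n := by gcongr
    _ = _ := by simp only [mul_pow]; ring

lemma abs_zpow_sub_one_le {θ δ : ℝ} (hδ : δ ≤ 1 / 2) (h : |θ - 1| ≤ δ) {ϱ : ℕ}
    (hϱ : 2 * ϱ * δ ≤ 1) {r : ℤ} (hr : |r| ≤ ϱ) : |θ ^ r - 1| ≤ 4 * ϱ * δ := by
  have h' := abs_le.mp h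
  have hθ : 1 / 2 ≤ θ := by linarith
  have hθ0 : 0 < θ := by linarith
  have hδ0 : 0 ≤ δ := (abs_nonneg _).trans h
  have hlog : |Real.log θ| ≤ 2 * δ := by
    have h1 := Real.log_le_sub_one_of_pos hθ0
    have h2 := Real.one_sub_inv_le_log_of_pos hθ0
    have h3 : θ⁻¹ ≤ 1 + 2 * δ := by
      rw [inv_le_iff_one_le_mul₀ hθ0]
      nlinarith
    rw [abs_le]
    constructor <;> linarith
  have hexp : θ ^ r = Real.exp (Real.log θ * r) := by
    rw [Real.exp_mul, Real.exp_log hθ0, Real.rpow_intCast]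
  have hr' : |(r : ℝ)| ≤ ϱ := by exact_mod_cast hr
  have ht : |Real.log θ * r| ≤ 2 * δ * ϱ := by
    rw [abs_mul]; gcongr
  rw [hexp]
  refine (Real.abs_exp_sub_one_le (ht.trans (by linarith))).trans ?_
  linarith

set_option maxHeartbeats 1000000 in
/-- A two-term linear form in logarithms `log (a / b) - ℓ * log (P / Q)` cannot be as small as
`b * P ^ ℓ - a * Q ^ ℓ` being bounded would force. -/
theorem not_abs_sub_le_of_large {ℓ P Q a b : ℕ} (hℓ : 12000 ≤ ℓ) (hQ : 2 ≤ Q)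
    (hab : a = 3 ∧ b = 1 ∨ a = 8 ∧ b = 3)
    (h : |(b : ℝ) * P ^ ℓ - a * Q ^ ℓ| ≤ 24) : False := by
  have ha : 0 < a := by omega
  have hb : 0 < b := by omega
  have hab24 : (a * b : ℝ) ≤ 24 := by
    rcases hab with ⟨rfl, rfl⟩ | ⟨rfl, rfl⟩ <;> norm_num
  have hab3 : (a : ℝ) ≤ 3 * b := by
    rcases hab with ⟨rfl, rfl⟩ | ⟨rfl, rfl⟩ <;> norm_num
  have hab2 : (b : ℝ) + 2 ≤ a := by
    rcases hab with ⟨rfl, rfl⟩ | ⟨rfl, rfl⟩ <;> norm_num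
  have hb1 : (1 : ℝ) ≤ b := by exact_mod_cast hb
  have hQ' : (2 : ℝ) ≤ Q := by exact_mod_cast hQ
  have hQ0 : (0 : ℝ) < Q := by linarith
  have hQℓ : (1000 : ℝ) ≤ (Q : ℝ) ^ ℓ := by
    calc (1000 : ℝ) ≤ 2 ^ 10 := by norm_num
      _ ≤ 2 ^ ℓ := pow_le_pow_right₀ (by norm_num) (by omega)
      _ ≤ (Q : ℝ) ^ ℓ := by gcongr
  have h' := abs_le.mp h
  have hPQ : Q < P := by
    by_contra hcon
    have : (P : ℝ) ^ ℓ ≤ (Q : ℝ) ^ ℓ := by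
      gcongr; exact_mod_cast not_lt.mp hcon
    nlinarith
  have hPQ' : (Q : ℝ) + 1 ≤ P := by exact_mod_cast hPQ
  have hP0 : (0 : ℝ) < P := by linarith
  have hPℓ : (Q : ℝ) ^ ℓ ≤ (P : ℝ) ^ ℓ := by gcongr
  set v : ℝ := P / Q with hv
  have hv0 : 0 < v := by positivity
  set β := Real.log v with hβ
  have hℓ' : (12000 : ℝ) ≤ ℓ := by exact_mod_cast hℓ
  -- size of `β`
  have hβℓ : β * ℓ ≤ 6 / 5 := by
    have h1 : v ^ ℓ ≤ 3.1 := by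
      rw [hv, div_pow, div_le_iff₀ (by positivity)]
      have : (b : ℝ) * P ^ ℓ ≤ b * (3.1 * Q ^ ℓ) := by nlinarith
      exact le_of_mul_le_mul_left this (by linarith)
    have h2 : (3.1 : ℝ) ≤ Real.exp (6 / 5) := by
      have := Real.sum_le_exp_of_nonneg (x := 6 / 5) (by norm_num) 5
      norm_num [Finset.sum_range_succ, Nat.factorial] at this
      linarith
    have h3 := Real.log_le_log (by positivity) (h1.trans h2)
    rw [Real.log_pow, Real.log_exp] at h3
    linarith
  have hβQ : 1 ≤ β * (Q + 1) := by
    have h1 := Real.one_sub_inv_le_log_of_pos hv0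
    have h2 : v⁻¹ ≤ 1 - 1 / (Q + 1) := by
      rw [hv, inv_div, div_le_iff₀ hP0]
      have : (Q : ℝ) = (1 - 1 / (Q + 1)) * (Q + 1) := by field_simp; ring
      calc (Q : ℝ) = (1 - 1 / (Q + 1)) * (Q + 1) := this
        _ ≤ _ := by
          gcongr
          rw [sub_nonneg, div_le_one (by linarith)]; linarith
    have h3 : 1 / ((Q : ℝ) + 1) ≤ β := by linarith
    rwa [div_le_iff₀ (by linarith)] at h3
  have hβ0 : 0 < β := by
    by_contra hcon
    nlinarith
  have hQbig : (9999 : ℝ) ≤ Q := by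
    by_contra! hcon
    nlinarith
  set H := Real.log Q with hH
  have he1 := Real.exp_one_lt_d9
  have he2 := Real.exp_one_gt_d9
  have hH9 : 9 ≤ H := by
    rw [hH, Real.le_log_iff_exp_le hQ0]
    calc Real.exp 9 = Real.exp 1 ^ 9 := by rw [← Real.exp_nat_mul]; norm_num
      _ ≤ 2.7183 ^ 9 := by gcongr; linarith
      _ ≤ 9999 := by norm_num
      _ ≤ _ := hQbig
  have hexpH : Real.exp H = Q := Real.exp_log hQ0
  -- parameters
  obtain ⟨m, hm⟩ : ∃ m, m = ℓ / 20 := ⟨_, rfl⟩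
  obtain ⟨ϱ, hϱ⟩ : ∃ ϱ, ϱ = ⌊(1.42 * H - 1) / 2⌋₊ := ⟨_, rfl⟩
  have hm600 : 600 ≤ m := by omega
  have hm600' : (600 : ℝ) ≤ m := by exact_mod_cast hm600
  have hmℓ : 20 * (m : ℝ) ≤ ℓ := by exact_mod_cast (by omega : 20 * m ≤ ℓ)
  have hmℓ' : (ℓ : ℝ) ≤ 20 * m + 20 := by exact_mod_cast (by omega : ℓ ≤ 20 * m + 20)
  have hϱ1 : 2 * (ϱ : ℝ) + 1 ≤ 1.42 * H := by
    have := Nat.floor_le (a := (1.42 * H - 1) / 2) (by linarith)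
    rw [← hϱ] at this
    linarith
  have hϱ2 : 1.42 * H ≤ 2 * (ϱ : ℝ) + 3 := by
    have := Nat.lt_floor_add_one ((1.42 * H - 1) / 2)
    rw [← hϱ] at this
    linarith
  set ρ := Real.exp 7 with hρ
  have hρ1 : 1 ≤ ρ := Real.one_le_exp (by norm_num)
  have hρle : ρ ≤ 1097 := by
    calc Real.exp 7 = Real.exp 1 ^ 7 := by rw [← Real.exp_nat_mul]; norm_num
      _ ≤ 2.7183 ^ 7 := by gcongr; linarith
      _ ≤ 1097 := by norm_num
  have hρge : 1096 ≤ ρ := by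
    calc (1096 : ℝ) ≤ 2.7182 ^ 7 := by norm_num
      _ ≤ Real.exp 1 ^ 7 := by gcongr; linarith
      _ = Real.exp 7 := by rw [← Real.exp_nat_mul]; norm_num
  obtain ⟨n, hn⟩ : ∃ n, n + 1 = m * (2 * ϱ + 1) :=
    ⟨m * (2 * ϱ + 1) - 1, Nat.sub_add_cancel (Nat.mul_pos (by omega) (by omega))⟩
  have hnR : (n : ℝ) + 1 = m * (2 * ϱ + 1) := by exact_mod_cast hn
  set R : ℝ := 2 * ϱ + 1 with hR
  have hRge : 10.78 ≤ R := by linarith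
  set X : ℝ := R * ℓ / 2 with hX
  -- closeness
  have hclose : ∀ r : ℤ, |r| ≤ ϱ →
      |((a / b : ℝ) / (P / Q : ℝ) ^ ℓ) ^ r - 1| * ρ ^ (2 * (n + 1)) ≤ 1 := by
    intro r hr
    set δ : ℝ := 24 / Q ^ ℓ with hδ
    have hQexp : (Q : ℝ) ^ ℓ = Real.exp (ℓ * H) := by rw [Real.exp_nat_mul, hexpH]
    have hρexp : ρ ^ (2 * (n + 1)) = Real.exp (14 * (n + 1)) := by
      rw [hρ, ← Real.exp_nat_mul]; push_cast; ring_nf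
    have hbig : 96 * ϱ * ρ ^ (2 * (n + 1)) ≤ (Q : ℝ) ^ ℓ := by
      rw [hQexp, hρexp]
      have h1 : 96 * (ϱ : ℝ) ≤ Real.exp (72 * H) :=
        le_trans (by linarith) (Real.add_one_le_exp (72 * H))
      have h2 : 72 * H + 14 * (n + 1) ≤ ℓ * H := by
        rw [hnR]
        have h3 : (m : ℝ) * R ≤ ℓ / 20 * (1.42 * H) := by
          gcongr
          linarith
        have h4 : 12000 * H ≤ ℓ * H := by gcongr
        linarith
      calc 96 * (ϱ : ℝ) * Real.exp (14 * (n + 1))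
          ≤ Real.exp (72 * H) * Real.exp (14 * (n + 1)) := by gcongr
        _ = Real.exp (72 * H + 14 * (n + 1)) := (Real.exp_add _ _).symm
        _ ≤ _ := Real.exp_le_exp.mpr h2
    have hρpow : 1 ≤ ρ ^ (2 * (n + 1)) := one_le_pow₀ hρ1
    have hϱQ : 96 * (ϱ : ℝ) ≤ (Q : ℝ) ^ ℓ :=
      le_trans (le_mul_of_one_le_right (by positivity) hρpow) hbig
    have hθ : |(a / b : ℝ) / (P / Q : ℝ) ^ ℓ - 1| ≤ δ := by
      have h1 : (a / b : ℝ) / (P / Q : ℝ) ^ ℓ - 1 = -(b * P ^ ℓ - a * Q ^ ℓ) / (b * P ^ ℓ) := by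
        rw [div_pow]; field_simp; ring
      rw [h1, abs_div, abs_neg, abs_of_pos (by positivity : (0 : ℝ) < b * P ^ ℓ), hδ]
      refine div_le_div₀ (by norm_num) h (by positivity) ?_
      nlinarith
    have h1 := abs_zpow_sub_one_le (ϱ := ϱ) (δ := δ) (by
      rw [hδ, div_le_iff₀ (by positivity)]; linarith) hθ (by
      rw [hδ, mul_div_assoc', div_le_one (by positivity)]; linarith) hr
    calc _ ≤ 4 * ϱ * δ * ρ ^ (2 * (n + 1)) := by gcongr
      _ = 96 * ϱ * ρ ^ (2 * (n + 1)) / Q ^ ℓ := by rw [hδ]; ring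
      _ ≤ 1 := (div_le_one (by positivity)).mpr hbig
  have hdet := one_le_of_interpolation_determinant (ϱ := ϱ) (m := m) (ℓ := ℓ) (P := P) (Q := Q)
    (a := a) (b := b) (by omega) (by omega) (by omega) hPQ ha hb ρ X hρ1 hX (n + 1) hn hclose
  have hnX : (n : ℝ) ≤ X := by
    have h1 : R * (20 * m) ≤ R * ℓ := by gcongr
    rw [hX]; linarith
  have hX0 : 0 < X := by positivity
  have hn0 : (6000 : ℝ) ≤ n := by
    have h1 : 600 * 10.78 ≤ m * R := by gcongr
    linarith
  have hmain := pow_le_of_interpolation_determinant (by linarith) (by positivity) hX0.le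
    (Real.exp_pos _).le hnX hdet
  have hbase : 2 * Real.exp 1 * ((ρ + 1) * X) ≤ Real.exp 11 * n := by
    have h1 : Real.exp 11 = Real.exp 1 ^ 3 * (ρ * Real.exp 1) := by
      rw [hρ, ← Real.exp_nat_mul, ← Real.exp_add, ← Real.exp_add]; norm_num
    have h2 : (20.084 : ℝ) ≤ Real.exp 1 ^ 3 := by
      calc (20.084 : ℝ) ≤ 2.71828 ^ 3 := by norm_num
        _ ≤ _ := by gcongr; linarith
    have h3 : X ≤ 10.019 * n := by
      have h4 : R * ℓ ≤ R * (20 * m + 20) := by gcongr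
      have h5 : 600 * R ≤ m * R := by gcongr
      rw [hX]; linarith
    have h4 : ρ + 1 ≤ 1.001 * ρ := by linarith
    calc 2 * Real.exp 1 * ((ρ + 1) * X) ≤ 2 * Real.exp 1 * (1.001 * ρ * (10.019 * n)) := by gcongr
      _ = 2 * 1.001 * 10.019 * (ρ * Real.exp 1) * n := by ring
      _ ≤ 20.084 * (ρ * Real.exp 1) * n := by gcongr; norm_num
      _ ≤ _ := by rw [h1]; gcongr
  have hmain2 : Real.exp (7 * (2 * n + 1)) ≤
      Real.exp (3.2 * ϱ + 2 * m * H + (0.004 * (n + 1) + 14) + (1 + 0.6 * 1097 * R) + 11 * n) := by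
    have hnn : (0 : ℝ) < (n : ℝ) ^ n := by positivity
    have h24 : (a * b : ℝ) ^ ϱ ≤ Real.exp (3.2 * ϱ) := by
      have : (24 : ℝ) ≤ Real.exp 3.2 := by
        have := Real.sum_le_exp_of_nonneg (x := 3.2) (by norm_num) 10
        norm_num [Finset.sum_range_succ, Nat.factorial] at this
        norm_num
        linarith
      rw [mul_comm (3.2 : ℝ), Real.exp_nat_mul]
      gcongr
      exact hab24.trans this
    have hQm : (Q : ℝ) ^ (2 * m) = Real.exp (2 * m * H) := by
      rw [← hexpH, ← Real.exp_nat_mul]; push_cast; ring_nf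
    have h2K : (2 * ((n : ℝ) + 1)) ^ 2 ≤ Real.exp (0.004 * (n + 1) + 14) := by
      have h1 : 2 * ((n : ℝ) + 1) ≤ Real.exp (0.002 * (n + 1) + 7) := by
        rw [Real.exp_add]
        have h1 := Real.add_one_le_exp (0.002 * ((n : ℝ) + 1))
        have h2 : (0 : ℝ) < 0.002 * (n + 1) := by positivity
        change _ ≤ _ * ρ
        nlinarith
      calc _ ≤ Real.exp (0.002 * (n + 1) + 7) ^ 2 := by gcongr
        _ = _ := by rw [← Real.exp_nat_mul]; push_cast; ring_nf
    have hY : 2 * Real.exp (β * (ρ * X)) ≤ Real.exp (1 + 0.6 * 1097 * R) := by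
      rw [Real.exp_add]
      refine mul_le_mul (by linarith) (Real.exp_le_exp.mpr ?_) (Real.exp_pos _).le
        (Real.exp_pos _).le
      calc β * (ρ * X) = (β * ℓ) * ρ * R / 2 := by rw [hX]; ring
        _ ≤ 6 / 5 * 1097 * R / 2 := by gcongr
        _ = _ := by ring
    have hρn : ρ ^ (2 * n + 1) = Real.exp (7 * (2 * n + 1)) := by
      rw [hρ, ← Real.exp_nat_mul]; push_cast; ring_nf
    rw [hρn, hQm] at hmain
    refine le_of_mul_le_mul_right (hmain.trans ?_) hnn
    rw [Real.exp_add, Real.exp_add, Real.exp_add, Real.exp_add]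
    have h11 : (2 * Real.exp 1 * ((ρ + 1) * X)) ^ n ≤ Real.exp (11 * n) * (n : ℝ) ^ n := by
      rw [mul_comm (11 : ℝ), Real.exp_nat_mul, ← mul_pow]
      gcongr
    rw [mul_assoc _ (Real.exp (11 * n))]
    gcongr
  have hfin := Real.exp_le_exp.mp hmain2
  have hmR : (n : ℝ) + 1 = m * R := hnR
  have hϱR : (ϱ : ℝ) ≤ R / 2 := by rw [hR]; linarith
  have hHR : H ≤ (R + 2) * (50 / 71) := by linarith
  have hmH : m * H ≤ (m * R + 2 * m) * (50 / 71) := by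
    calc m * H ≤ m * ((R + 2) * (50 / 71)) := by gcongr
      _ = _ := by ring
  have h1 : 10.78 * (m : ℝ) ≤ m * R := by rw [mul_comm]; gcongr
  have h2 : 600 * R ≤ m * R := by gcongr
  linarith only [hfin, hmR, hϱR, hmH, h1, h2, hn0]

/-! ### Small exponents -/

/-- Evaluate `f n` after matching on `n`, so that kernel reduction computes `n` first. -/
def evalFirst (n : ℕ) (f : ℕ → Bool) : Bool :=
  match n with
  | 0 => f 0
  | m + 1 => f (m + 1)

lemma evalFirst_eq (n : ℕ) (f : ℕ → Bool) : evalFirst n f = f n := by cases n <;> rfl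

/-- Neither `3 * t + 6` nor `(3 * t + 24) / 8` is zero or a `k`-th root of unity modulo `q`. -/
def residueOK (q k t : ℕ) : Bool :=
  !(Nat.beq ((3 * t + 6) % q) 0) && !(Nat.beq ((3 * t + 6) ^ k % q) 1) &&
    !(Nat.beq ((3 * t + 24) % q) 0) && !(Nat.beq ((3 * t + 24) ^ k % q) (8 ^ k % q))

/-- Run through `t, t * h, …, t * h ^ (i - 1)` modulo `q`; none may be `1` or violate `residueOK`,
and `t * h ^ i` must be `1`. -/
def rootsOK (q k h : ℕ) : ℕ → ℕ → Bool
  | 0, t => Nat.beq t 1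
  | i + 1, t => !(Nat.beq t 1) && residueOK q k t &&
      evalFirst (t * h % q) (fun u => rootsOK q k h i u)

/-- Pocklington's criterion for `k * ℓ + 1` with base `a`. -/
def pocklingtonOK (ℓ k a : ℕ) : Bool :=
  Nat.beq ((a ^ ℓ % (k * ℓ + 1)) ^ k % (k * ℓ + 1)) 1 &&
    Nat.beq (Nat.gcd (a ^ k - 1) (k * ℓ + 1)) 1

/-- `2 * (n + 1) * ℓ + 1` is a prime modulus obstructing both equations of exponent `ℓ`. -/
def modulusOK (ℓ n : ℕ) : Bool :=
  Nat.ble (n + 2) (2 * ℓ) && [2, 3, 5, 7].any (pocklingtonOK ℓ (2 * (n + 1))) &&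
  residueOK (2 * (n + 1) * ℓ + 1) (2 * (n + 1)) 0 &&
  residueOK (2 * (n + 1) * ℓ + 1) (2 * (n + 1)) 1 &&
  [2, 3, 4, 5, 6, 7, 8, 9, 10, 11].any fun g =>
    evalFirst (g ^ (2 * ℓ) % (2 * (n + 1) * ℓ + 1)) fun h =>
      rootsOK (2 * (n + 1) * ℓ + 1) (2 * (n + 1)) h n h

/-- Search for an obstructing modulus `2 * n * ℓ + 1` with `i < n ≤ 40`. -/
def findModulus (ℓ : ℕ) : ℕ → Bool
  | 0 => false
  | i + 1 => modulusOK ℓ (39 - i) || findModulus ℓ i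

/-- Either `ℓ` has a small proper divisor or it has an obstructing modulus. -/
def exponentOK (ℓ : ℕ) : Bool :=
  (Nat.ble 110 ℓ && [2, 3, 5, 7, 11, 13, 17, 19, 23, 29, 31, 37, 41, 43, 47, 53, 59, 61, 67, 71,
    73, 79, 83, 89, 97, 101, 103, 107, 109].any fun d => Nat.beq (ℓ % d) 0) || findModulus ℓ 40

/-- `exponentOK (2 * n + 5)` for `j ≤ n < j + i`. -/
def exponentsOK (j : ℕ) : ℕ → Bool
  | 0 => true
  | i + 1 => exponentOK (2 * (j + i) + 5) && exponentsOK j i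

lemma exponentOK_of_exponentsOK {j i n : ℕ} (h : exponentsOK j i = true) (hj : j ≤ n)
    (hn : n < j + i) : exponentOK (2 * n + 5) = true := by
  induction i with
  | zero => omega
  | succ i ih =>
    rw [exponentsOK, Bool.and_eq_true] at h
    rcases Nat.lt_or_ge n (j + i) with hlt | hge
    · exact ih h.2 hlt
    · obtain rfl : n = j + i := by omega
      exact h.1

lemma exponentsOK_zero : exponentsOK 0 6000 = true := by decide +kernel

lemma exists_modulusOK {ℓ i : ℕ} (h : findModulus ℓ i = true) :
    ∃ n, modulusOK ℓ n = true := by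
  induction i with
  | zero => simp [findModulus] at h
  | succ i ih =>
    rw [findModulus, Bool.or_eq_true] at h
    rcases h with h | h
    · exact ⟨39 - i, h⟩
    · exact ih h

lemma prime_of_pocklingtonOK {ℓ k a : ℕ} (hℓ : ℓ.Prime) (hℓ2 : ℓ ≠ 2) (hk : Even k) (hk0 : 0 < k)
    (hkℓ : k < 4 * ℓ) (ha : 0 < a) (h : pocklingtonOK ℓ k a = true) : (k * ℓ + 1).Prime := by
  simp only [pocklingtonOK, Bool.and_eq_true, Nat.beq_eq] at h
  obtain ⟨h1, h2⟩ := h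
  have hq : 1 < k * ℓ + 1 := by
    have := Nat.mul_pos hk0 hℓ.pos
    omega
  have hfac : ∀ p, p.Prime → p ∣ k * ℓ + 1 → 2 * ℓ + 1 ≤ p := by
    intro p hp hpq
    have := Fact.mk hp
    have hpow : (a : ZMod p) ^ (ℓ * k) = 1 := by
      have : ((a ^ ℓ % (k * ℓ + 1)) ^ k) ≡ 1 [MOD k * ℓ + 1] := by
        rw [Nat.ModEq, h1, Nat.mod_eq_of_lt hq]
      have h3 : (a ^ ℓ) ^ k ≡ 1 [MOD k * ℓ + 1] :=
        ((Nat.mod_modEq (a ^ ℓ) (k * ℓ + 1)).pow k).symm.trans this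
      have h4 := (ZMod.natCast_eq_natCast_iff _ _ p).mpr (h3.of_dvd hpq)
      rw [pow_mul]
      exact_mod_cast h4
    have hne : (a : ZMod p) ^ k ≠ 1 := by
      intro hcon
      have h3 : ((a ^ k - 1 : ℕ) : ZMod p) = 0 := by
        rw [Nat.cast_sub (Nat.one_le_pow _ _ ha)]
        push_cast
        rw [hcon, sub_self]
      have h4 := Nat.dvd_gcd ((ZMod.natCast_eq_zero_iff _ _).mp h3) hpq
      rw [h2] at h4
      exact hp.one_lt.ne' (Nat.dvd_one.mp h4)
    have ha0 : (a : ZMod p) ≠ 0 := by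
      intro hcon
      rw [hcon, zero_pow (Nat.mul_pos hℓ.pos hk0).ne'] at hpow
      exact zero_ne_one hpow
    have hord : ℓ ∣ p - 1 := by
      have hb : ((a : ZMod p) ^ k) ^ ℓ = 1 := by rw [← pow_mul, mul_comm, hpow]
      have := Fact.mk hℓ
      rw [← orderOf_eq_prime hb hne]
      apply orderOf_dvd_of_pow_eq_one
      rw [← pow_mul, mul_comm, pow_mul, ZMod.pow_card_sub_one_eq_one ha0, one_pow]
    have hp2 : Odd p := by
      refine Odd.of_dvd_nat ?_ hpq
      exact (hk.mul_right ℓ).add_one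
    obtain ⟨c, hc⟩ := hord
    have hp1 := hp.two_le
    rcases Nat.lt_or_ge c 2 with hc2 | hc2
    · interval_cases c
      · omega
      · obtain ⟨d, hd⟩ := hp2
        exact absurd (hℓ.even_iff.mp ⟨d, by omega⟩) hℓ2
    · have := Nat.mul_le_mul_left ℓ hc2
      omega
  by_contra hnp
  have h3 := Nat.minFac_sq_le_self (by omega) hnp
  have h4 := hfac _ (Nat.minFac_prime hq.ne') (Nat.minFac_dvd _)
  nlinarith

lemma residueOK_cast {q k t : ℕ} (hq : 1 < q) (h : residueOK q k t = true) :
    (3 * t + 6 : ZMod q) ≠ 0 ∧ (3 * t + 6 : ZMod q) ^ k ≠ 1 ∧ (3 * t + 24 : ZMod q) ≠ 0 ∧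
      (3 * t + 24 : ZMod q) ^ k ≠ 8 ^ k := by
  simp only [residueOK, Bool.and_eq_true, Bool.not_eq_true', ← Bool.not_eq_true,
    Nat.beq_eq] at h
  obtain ⟨⟨⟨h1, h2⟩, h3⟩, h4⟩ := h
  refine ⟨fun hc => h1 ?_, fun hc => h2 ?_, fun hc => h3 ?_, fun hc => h4 ?_⟩
  · have := (ZMod.natCast_eq_natCast_iff' (3 * t + 6) 0 q).mp (by exact_mod_cast hc)
    simpa using this
  · have := (ZMod.natCast_eq_natCast_iff' ((3 * t + 6) ^ k) 1 q).mp (by exact_mod_cast hc)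
    rwa [Nat.mod_eq_of_lt hq] at this
  · have := (ZMod.natCast_eq_natCast_iff' (3 * t + 24) 0 q).mp (by exact_mod_cast hc)
    simpa using this
  · exact (ZMod.natCast_eq_natCast_iff' ((3 * t + 24) ^ k) (8 ^ k) q).mp (by exact_mod_cast hc)

lemma rootsOK_spec {q k h i t : ℕ} (hq : 1 < q) (hroots : rootsOK q k h i t = true) :
    (∀ s < i, (t : ZMod q) * h ^ s ≠ 1 ∧
      ∃ t' : ℕ, (t' : ZMod q) = t * h ^ s ∧ residueOK q k t' = true) ∧
      (t : ZMod q) * h ^ i = 1 ∨ t ≥ q := by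
  induction i generalizing t with
  | zero =>
    simp only [rootsOK, Nat.beq_eq] at hroots
    simp [hroots]
  | succ i ih =>
    simp only [rootsOK, evalFirst_eq, Bool.and_eq_true, Bool.not_eq_true', ← Bool.not_eq_true,
      Nat.beq_eq] at hroots
    obtain ⟨⟨h1, h2⟩, h3⟩ := hroots
    rcases Nat.lt_or_ge t q with htq | htq
    swap
    · exact Or.inr htq
    rcases ih h3 with ⟨h4, h5⟩ | h4
    swap
    · exact absurd (Nat.mod_lt (t * h) (by omega : 0 < q)) (by omega)
    refine Or.inl ⟨fun s hs => ?_, ?_⟩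
    · cases s with
      | zero =>
        refine ⟨fun hc => h1 ?_, t, by simp, h2⟩
        have := (ZMod.natCast_eq_natCast_iff' t 1 q).mp (by simpa using hc)
        rwa [Nat.mod_eq_of_lt htq, Nat.mod_eq_of_lt hq] at this
      | succ s =>
        have := h4 s (by omega)
        rwa [ZMod.natCast_mod, Nat.cast_mul, mul_assoc, ← pow_succ'] at this
    · rwa [ZMod.natCast_mod, Nat.cast_mul, mul_assoc, ← pow_succ'] at h5

lemma no_solution_of_modulusOK {ℓ n : ℕ} (hℓ : ℓ.Prime) (hℓ2 : ℓ ≠ 2)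
    (h : modulusOK ℓ n = true) (U W : ℕ) :
    W ^ ℓ ≠ 3 * (U ^ 2) ^ ℓ + 6 ∧ 8 * W ^ ℓ ≠ 3 * (U ^ 2) ^ ℓ + 24 := by
  simp only [modulusOK, Bool.and_eq_true, List.any_eq_true, evalFirst_eq, Nat.ble_eq] at h
  obtain ⟨⟨⟨⟨hnℓ, a, ha, hpock⟩, hr0⟩, hr1⟩, g, -, hroots⟩ := h
  have ha0 : 0 < a := by
    simp only [List.mem_cons, List.not_mem_nil, or_false] at ha
    omega
  set k := 2 * (n + 1) with hk
  have hqp := prime_of_pocklingtonOK hℓ hℓ2 (even_two_mul _) (by omega) (by omega) ha0 hpock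
  set q := k * ℓ + 1 with hq
  have := Fact.mk hqp
  have hroots' := (rootsOK_spec hqp.one_lt hroots).resolve_right
    (not_le.mpr (Nat.mod_lt _ hqp.pos))
  set η : ZMod q := ((g ^ (2 * ℓ) % q : ℕ) : ZMod q) with hη
  obtain ⟨hne, hone⟩ := hroots'
  have hprim : IsPrimitiveRoot η (n + 1) := by
    refine IsPrimitiveRoot.mk_of_lt η (by omega) (by rw [pow_succ']; exact hone) ?_
    intro l hl0 hl
    obtain ⟨s, rfl⟩ : ∃ s, l = s + 1 := ⟨l - 1, by omega⟩
    rw [pow_succ']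
    exact (hne s (by omega)).1
  have hres : ∀ u : ZMod q, u = 0 ∨ u ^ (n + 1) = 1 →
      ∃ t : ℕ, (t : ZMod q) = u ∧ residueOK q k t = true := by
    rintro u (rfl | hu)
    · exact ⟨0, by simp, hr0⟩
    · obtain ⟨i, hi, rfl⟩ := hprim.eq_pow_of_pow_eq_one hu
      cases i with
      | zero => exact ⟨1, by simp, hr1⟩
      | succ s =>
        rw [pow_succ']
        exact (hne s (by omega)).2
  have hpow : ∀ x : ZMod q, x = 0 ∨ x ^ (k * ℓ) = 1 := by
    intro x
    by_cases hx : x = 0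
    · exact Or.inl hx
    · exact Or.inr (ZMod.pow_card_sub_one_eq_one hx)
  obtain ⟨t, htu, ht⟩ := hres (((U : ZMod q) ^ 2) ^ ℓ) (by
    rcases hpow (U : ZMod q) with h0 | h0
    · left
      rw [h0, zero_pow two_ne_zero, zero_pow hℓ.ne_zero]
    · right
      rw [← pow_mul, ← pow_mul, ← h0, hk]
      congr 1
      ring)
  obtain ⟨h1, h2, h3, h4⟩ := residueOK_cast hqp.one_lt ht
  rw [htu] at h1 h2 h3 h4
  have hW : (W : ZMod q) ^ ℓ ≠ 0 → ((W : ZMod q) ^ ℓ) ^ k = 1 := by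
    intro hW0
    rw [← pow_mul, mul_comm]
    refine (hpow _).resolve_left ?_
    rintro h0
    rw [h0, zero_pow hℓ.ne_zero] at hW0
    exact hW0 rfl
  constructor
  · intro heq
    have heq' : (W : ZMod q) ^ ℓ = 3 * ((U : ZMod q) ^ 2) ^ ℓ + 6 := by
      exact_mod_cast congrArg _ heq
    rw [← heq'] at h1 h2
    exact h2 (hW h1)
  · intro heq
    have heq' : 8 * (W : ZMod q) ^ ℓ = 3 * ((U : ZMod q) ^ 2) ^ ℓ + 24 := by
      exact_mod_cast congrArg _ heq
    rw [← heq'] at h3 h4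
    refine h4 ?_
    rw [mul_pow, hW (right_ne_zero_of_mul h3), mul_one]

theorem no_solution_of_small {ℓ : ℕ} (hℓ : ℓ.Prime) (h5 : 5 ≤ ℓ) (hlt : ℓ < 12000) (U W : ℕ) :
    W ^ ℓ ≠ 3 * (U ^ 2) ^ ℓ + 6 ∧ 8 * W ^ ℓ ≠ 3 * (U ^ 2) ^ ℓ + 24 := by
  obtain ⟨m, hm⟩ := hℓ.odd_of_ne_two (by omega)
  have hOK := exponentOK_of_exponentsOK exponentsOK_zero (n := m - 2) (by omega) (by omega)
  rw [(by omega : 2 * (m - 2) + 5 = ℓ), exponentOK, Bool.or_eq_true, Bool.and_eq_true,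
    List.any_eq_true] at hOK
  rcases hOK with ⟨h110, d, hd, hdvd⟩ | hfind
  · rw [Nat.ble_eq] at h110
    have hd' : d ≠ 1 ∧ d < 110 := by
      simp only [List.mem_cons, List.not_mem_nil, or_false] at hd
      omega
    have := (Nat.dvd_prime hℓ).mp (Nat.dvd_of_mod_eq_zero (Nat.beq_eq.mp hdvd))
    omega
  · obtain ⟨n, hn⟩ := exists_modulusOK hfind
    exact no_solution_of_modulusOK hℓ (by omega) hn U W

/-! ### The ring of integers of `ℚ(√-2)` -/

theorem Int.exists_two_mul_abs_sub_le (p : ℤ) {N : ℤ} (hN : 0 < N) :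
    ∃ m : ℤ, 2 * |p - m * N| ≤ N := by
  refine ⟨(2 * p + N) / (2 * N), ?_⟩
  have h1 := Int.mul_ediv_add_emod (2 * p + N) (2 * N)
  have h2 := Int.emod_nonneg (2 * p + N) (show 2 * N ≠ 0 by omega)
  have h3 := Int.emod_lt_of_pos (2 * p + N) (show 0 < 2 * N by omega)
  rcases abs_cases (p - (2 * p + N) / (2 * N) * N) with ⟨h, -⟩ | ⟨h, -⟩ <;> rw [h] <;> linarith

theorem Zsqrtd.exists_norm_sub_mul_lt (x : ℤ√(-2)) {y : ℤ√(-2)} (hy : y ≠ 0) :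
    ∃ t : ℤ√(-2), (x - y * t).norm < y.norm := by
  have hN : 0 < y.norm := lt_of_le_of_ne (Zsqrtd.norm_nonneg (by norm_num) y)
    fun h => hy ((Zsqrtd.norm_eq_zero_iff (by norm_num) y).1 h.symm)
  obtain ⟨m, hm⟩ := Int.exists_two_mul_abs_sub_le (x * star y).re hN
  obtain ⟨n, hn⟩ := Int.exists_two_mul_abs_sub_le (x * star y).im hN
  refine ⟨⟨m, n⟩, lt_of_mul_lt_mul_right ?_ hN.le⟩
  have key : (x - y * ⟨m, n⟩).norm * y.norm =
      ((x * star y).re - m * y.norm) ^ 2 + 2 * ((x * star y).im - n * y.norm) ^ 2 := by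
    simp only [Zsqrtd.norm_def, Zsqrtd.re_sub, Zsqrtd.im_sub, Zsqrtd.re_mul, Zsqrtd.im_mul,
      Zsqrtd.re_star, Zsqrtd.im_star]
    ring
  rw [key, ← sq_abs, ← sq_abs ((x * star y).im - _)]
  nlinarith [abs_nonneg ((x * star y).re - m * y.norm), abs_nonneg ((x * star y).im - n * y.norm)]

open Classical in
/-- `ℤ√(-2)` is norm-Euclidean. -/
noncomputable instance Zsqrtd.euclideanDomainNegTwo : EuclideanDomain (ℤ√(-2)) :=
  { (inferInstance : CommRing (ℤ√(-2))), (inferInstance : Nontrivial (ℤ√(-2))) with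
    quotient := fun x y => if hy : y = 0 then 0 else (Zsqrtd.exists_norm_sub_mul_lt x hy).choose
    remainder := fun x y =>
      x - y * if hy : y = 0 then 0 else (Zsqrtd.exists_norm_sub_mul_lt x hy).choose
    quotient_zero := fun x => by simp
    quotient_mul_add_remainder_eq := fun x y => by ring
    r := _
    r_wellFounded := (measure (Int.natAbs ∘ Zsqrtd.norm)).wf
    remainder_lt := fun x y hy => by
      have h := (Zsqrtd.exists_norm_sub_mul_lt x hy).choose_spec
      have h0 := Zsqrtd.norm_nonneg (d := -2) (by norm_num)
        (x - y * (Zsqrtd.exists_norm_sub_mul_lt x hy).choose)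
      simp only [hy, dif_neg, not_false_eq_true, WellFoundedRelation.rel,
        InvImage, Function.comp]
      change (Zsqrtd.norm _).natAbs < (Zsqrtd.norm _).natAbs
      omega
    mul_left_not_lt := fun x y hy => by
      have hN : 0 < y.norm := lt_of_le_of_ne (Zsqrtd.norm_nonneg (by norm_num) y)
        fun h => hy ((Zsqrtd.norm_eq_zero_iff (by norm_num) y).1 h.symm)
      have h0 := Zsqrtd.norm_nonneg (d := -2) (by norm_num) x
      change ¬ (Zsqrtd.norm (x * y)).natAbs < (Zsqrtd.norm x).natAbs
      have h1 : x.norm ≤ (x * y).norm := by rw [Zsqrtd.norm_mul]; nlinarith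
      omega }

theorem Zsqrtd.eq_pow_of_mul_star_eq_pow {a c : ℤ√(-2)} {k : ℕ} (hk : Odd k)
    (hab : IsCoprime a (star a)) (h : a * star a = c ^ k) : ∃ d, a = d ^ k := by
  obtain ⟨d, u, hu⟩ := exists_associated_pow_of_mul_eq_pow' hab h
  have hn := (Zsqrtd.norm_eq_one_iff' (by norm_num) (u : ℤ√(-2))).2 u.isUnit
  rw [Zsqrtd.norm_def] at hn
  have him : (u : ℤ√(-2)).im = 0 := by
    by_contra h0
    nlinarith [mul_self_pos.2 h0, mul_self_nonneg (u : ℤ√(-2)).re]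
  have hre : (u : ℤ√(-2)).re = 1 ∨ (u : ℤ√(-2)).re = -1 := by
    rw [him] at hn
    exact mul_self_eq_one_iff.1 (by linarith)
  rcases hre with hre | hre
  · refine ⟨d, ?_⟩
    have : (u : ℤ√(-2)) = 1 := by ext <;> simp [him, hre]
    rw [← hu, this, mul_one]
  · refine ⟨-d, ?_⟩
    have : (u : ℤ√(-2)) = -1 := by ext <;> simp [him, hre]
    rw [← hu, this, hk.neg_pow]
    ring

theorem Zsqrtd.exists_one_pow_eq (v : ℤ) (n : ℕ) : ∃ p q : ℤ, (⟨1, v⟩ : ℤ√(-2)) ^ n =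
    ⟨1 - 2 * v ^ 2 * n.choose 2 + 4 * v ^ 3 * p, v * (n - 2 * v ^ 2 * q)⟩ := by
  induction n with
  | zero => exact ⟨0, 0, by ext <;> simp⟩
  | succ n ih =>
    obtain ⟨p, q, h⟩ := ih
    refine ⟨p + v * q, q + n.choose 2 - 2 * v * p, ?_⟩
    rw [pow_succ, h, Nat.choose_succ_succ' n 1, Nat.choose_one_right]
    ext <;> simp <;> ring

theorem Zsqrtd.exists_pow_eq_of_sq_eq_one (u : ℤ) {v : ℤ} (hv : v ^ 2 = 1) (j : ℕ) :
    ∃ p q : ℤ, (⟨u, v⟩ : ℤ√(-2)) ^ (2 * j + 1) =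
      ⟨u * ((2 * j + 1) * (-2) ^ j + u * p), v * (-2) ^ j + u ^ 2 * q⟩ := by
  induction j with
  | zero => exact ⟨0, 0, by ext <;> simp⟩
  | succ j ih =>
    obtain ⟨p, q, h⟩ := ih
    refine ⟨(2 * j + 1) * (-2) ^ j * u + p * (u ^ 2 - 2) - 4 * u * v * q,
      2 * v * ((2 * j + 1) * (-2) ^ j + u * p) + v * (-2) ^ j + q * (u ^ 2 - 2), ?_⟩
    have hsq : (⟨u, v⟩ : ℤ√(-2)) ^ 2 = ⟨u ^ 2 - 2, 2 * u * v⟩ := by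
      rw [pow_two]
      ext <;> simp
      · linear_combination (-2) * hv
      · ring
    rw [show 2 * (j + 1) + 1 = 2 * j + 1 + 2 by ring, pow_add, h, hsq]
    ext <;> simp
    · linear_combination (-4 * u * (-2) ^ j) * hv
    · ring

theorem Nat.choose_two_lt_two_pow {n : ℕ} (hn : 3 ≤ n) : n.choose 2 < 2 ^ (n - 1) := by
  induction n, hn using Nat.le_induction with
  | base => decide
  | succ n hn ih =>
    obtain ⟨m, rfl⟩ : ∃ m, n = m + 1 := ⟨n - 1, by omega⟩
    have h1 : m + 1 ≤ 2 ^ m := Nat.lt_two_pow_self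
    have h2 : 2 ^ (m + 1) = 2 ^ m * 2 := pow_succ 2 m
    rw [Nat.choose_succ_succ' (m + 1) 1, Nat.choose_one_right]
    simp only [Nat.add_sub_cancel] at ih ⊢
    rw [h2]
    norm_num only at ih ⊢
    omega

theorem two_mul_sq_add_one_ne_pow {ℓ : ℕ} (hodd : Odd ℓ) (h3 : 3 ≤ ℓ) {w : ℤ} (hw : w ≠ 0)
    (hdvd : (2 : ℤ) ^ (ℓ - 2) ∣ w) (b : ℤ) : 2 * w ^ 2 + 1 ≠ b ^ ℓ := by
  intro h
  have hprod : (⟨1, w⟩ : ℤ√(-2)) * star ⟨1, w⟩ = ((2 * w ^ 2 + 1 : ℤ) : ℤ√(-2)) := by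
    ext <;> simp [-Int.cast_pow, -Int.cast_mul, -Int.cast_add, -Int.cast_neg]; ring
  obtain ⟨⟨u, v⟩, hd⟩ := Zsqrtd.eq_pow_of_mul_star_eq_pow (a := ⟨1, w⟩) (c := (b : ℤ√(-2))) hodd
    ⟨star ⟨1, w⟩ - ⟨w ^ 2, 0⟩, -⟨w ^ 2, 0⟩, by
      ext <;> simp [-Int.cast_pow, -Int.cast_mul, -Int.cast_add, -Int.cast_neg] <;> ring⟩
    (by rw [hprod, h]; push_cast; rfl)
  have hu : u ∣ 1 := by
    have h1 := sub_dvd_pow_sub_pow (⟨u, v⟩ : ℤ√(-2)) ⟨0, v⟩ ℓ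
    rw [← hd, show (⟨u, v⟩ : ℤ√(-2)) - ⟨0, v⟩ = (u : ℤ√(-2)) by ext <;> simp,
      Zsqrtd.intCast_dvd] at h1
    obtain ⟨j, hj⟩ := hodd
    have h2 : (⟨0, v⟩ : ℤ√(-2)) ^ ℓ = (((-2 * v ^ 2) ^ j : ℤ) : ℤ√(-2)) * ⟨0, v⟩ := by
      rw [hj, pow_succ, pow_mul]
      rw [Int.cast_pow]
      congr 2
      rw [pow_two]
      ext <;> simp [-Int.cast_pow, -Int.cast_mul, -Int.cast_add, -Int.cast_neg]
      ring
    have h3 := h1.1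
    rw [h2] at h3
    generalize (-2 * v ^ 2) ^ j = n at h3
    simpa using h3
  have main : ∀ v w : ℤ, (2 : ℤ) ^ (ℓ - 2) ∣ w → ∀ p q : ℤ, w = v * (ℓ - 2 * v ^ 2 * q) →
      (2 : ℤ) ^ (ℓ - 2) ∣ v := by
    intro v w hw p q he
    refine IsCoprime.dvd_of_dvd_mul_right (IsCoprime.pow_left ?_) (he ▸ hw)
    obtain ⟨j, hj⟩ := hodd
    exact ⟨v ^ 2 * q - j, 1, by rw [hj]; push_cast; ring⟩
  rcases Int.isUnit_iff.1 (isUnit_of_dvd_one hu) with rfl | rfl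
  · obtain ⟨p, q, hpq⟩ := Zsqrtd.exists_one_pow_eq v ℓ
    rw [hpq, Zsqrtd.ext_iff] at hd
    obtain ⟨hre, him⟩ := hd
    simp only at hre him
    obtain ⟨c, hc⟩ := main v w hdvd p q him
    have hv : v ≠ 0 := by rintro rfl; simp at him; exact hw him
    have hch : (ℓ.choose 2 : ℤ) = 2 * v * p := by
      have : 2 * v ^ 2 * ((ℓ.choose 2 : ℤ) - 2 * v * p) = 0 := by linear_combination hre
      have h0 : 2 * v ^ 2 ≠ 0 := by positivity
      linarith [(mul_eq_zero.1 this).resolve_left h0]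
    have hdv : 2 ^ (ℓ - 1) ∣ ℓ.choose 2 := by
      have : (2 : ℤ) ^ (ℓ - 1) ∣ (ℓ.choose 2 : ℤ) := by
        refine ⟨c * p, ?_⟩
        rw [hch, hc, show ℓ - 1 = ℓ - 2 + 1 by omega, pow_succ]
        ring
      exact_mod_cast this
    exact absurd (Nat.le_of_dvd (Nat.choose_pos (by omega)) hdv)
      (not_le.2 (Nat.choose_two_lt_two_pow h3))
  · obtain ⟨p, q, hpq⟩ := Zsqrtd.exists_one_pow_eq (-v) ℓ
    have hneg : (⟨1, -v⟩ : ℤ√(-2)) = -⟨-1, v⟩ := by ext <;> simp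
    rw [hneg, hodd.neg_pow, ← hd, Zsqrtd.ext_iff] at hpq
    obtain ⟨hre, him⟩ := hpq
    simp only [Zsqrtd.re_neg, Zsqrtd.im_neg] at hre him
    obtain ⟨c, hc⟩ := main (-v) (-w) (by simpa using hdvd) p q him
    rw [show ℓ - 2 = ℓ - 3 + 1 by omega, pow_succ] at hc
    have : v ^ 2 * (ℓ.choose 2 + 2 * v * p) = 1 := by
      have : 2 * (v ^ 2 * (ℓ.choose 2 + 2 * v * p)) = 2 := by linear_combination hre
      linarith
    have h4 : v = 2 * (-(2 ^ (ℓ - 3) * c)) := by linear_combination -hc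
    have h5 : (2 : ℤ) ∣ 1 := by
      rw [← this]
      exact dvd_mul_of_dvd_left (dvd_pow ⟨_, h4⟩ two_ne_zero) _
    norm_num at h5

theorem sq_add_two_ne_pow {ℓ : ℕ} (hodd : Odd ℓ) (h3 : 3 ≤ ℓ) (h3ℓ : ¬ 3 ∣ ℓ) {z : ℤ}
    (hz : z ≠ 0) (hzodd : Odd z) (hdvd : (3 : ℤ) ^ (ℓ - 1) ∣ z) (b : ℤ) : z ^ 2 + 2 ≠ b ^ ℓ := by
  intro h
  have hprod : (⟨z, 1⟩ : ℤ√(-2)) * star ⟨z, 1⟩ = ((z ^ 2 + 2 : ℤ) : ℤ√(-2)) := by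
    ext <;> simp [-Int.cast_pow, -Int.cast_mul, -Int.cast_add, -Int.cast_neg]; ring
  obtain ⟨α, β, hαβ⟩ : ∃ α β : ℤ, (z ^ 2 + 2) * α + 4 * β = 1 := by
    have : IsCoprime (z ^ 2 + 2) (2 ^ 2) := by
      refine IsCoprime.pow_right ?_
      obtain ⟨t, ht⟩ := hzodd
      exact ⟨1, -(2 * t ^ 2 + 2 * t + 1), by rw [ht]; ring⟩
    obtain ⟨α, β, h⟩ := this
    exact ⟨α, β, by linarith⟩
  obtain ⟨⟨u, v⟩, hd⟩ := Zsqrtd.eq_pow_of_mul_star_eq_pow (a := ⟨z, 1⟩) (c := (b : ℤ√(-2))) hodd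
    ⟨star ⟨z, 1⟩ * (α : ℤ√(-2)) + ⟨0, -β⟩, ⟨0, β⟩, by
      ext <;> simp
      · linear_combination hαβ
      · ring⟩
    (by rw [hprod, h]; push_cast; rfl)
  have hv : v ∣ 1 := by
    have h1 := sub_dvd_pow_sub_pow (⟨u, v⟩ : ℤ√(-2)) (u : ℤ√(-2)) ℓ
    rw [← hd, ← Int.cast_pow] at h1
    generalize u ^ ℓ = n at h1
    have h2 := ((Zsqrtd.intCast_dvd v _).1 (dvd_trans (Dvd.intro (⟨0, 1⟩ : ℤ√(-2)) (by
      ext <;> simp)) h1)).2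
    simpa using h2
  have hv2 : v ^ 2 = 1 := by
    rcases Int.isUnit_iff.1 (isUnit_of_dvd_one hv) with rfl | rfl <;> norm_num
  obtain ⟨j, hj⟩ := hodd
  obtain ⟨p, q, hpq⟩ := Zsqrtd.exists_pow_eq_of_sq_eq_one u hv2 j
  rw [← hj, ← hd, Zsqrtd.ext_iff] at hpq
  obtain ⟨hre, him⟩ := hpq
  simp only at hre him
  have h3z : (3 : ℤ) ∣ z := dvd_trans (dvd_pow_self 3 (by omega)) hdvd
  have h3u : (3 : ℤ) ∣ u := by
    by_contra hu
    have hnorm : z ^ 2 + 2 = (u ^ 2 + 2) ^ ℓ := by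
      have h1 : (⟨z, 1⟩ : ℤ√(-2)).norm = (⟨u, v⟩ : ℤ√(-2)).norm ^ ℓ := by
        rw [hd]
        exact map_pow (Zsqrtd.normMonoidHom) _ _
      simp only [Zsqrtd.norm_def] at h1
      rw [show u ^ 2 + 2 = u * u - -2 * v * v by linear_combination -2 * hv2, ← h1]
      ring
    have hu3 : (3 : ℤ) ∣ u ^ 2 + 2 := by
      have : u % 3 = 1 ∨ u % 3 = 2 := by omega
      rcases this with h | h <;>
        exact Int.dvd_of_emod_eq_zero (by simp [pow_two, Int.add_emod, Int.mul_emod, h])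
    have h6 : (3 : ℤ) ∣ z ^ 2 + 2 := hnorm ▸ dvd_pow hu3 (by omega)
    have h7 : (3 : ℤ) ∣ z ^ 2 := dvd_pow h3z (by norm_num)
    omega
  have hcop : IsCoprime (3 : ℤ) (((2 * j + 1) * (-2) ^ j + u * p)) := by
    obtain ⟨t, rfl⟩ := h3u
    have h1 : IsCoprime (3 : ℤ) ((2 * j + 1) * (-2) ^ j) := by
      refine IsCoprime.mul_right ?_ (IsCoprime.pow_right ⟨1, 1, by norm_num⟩)
      have : IsCoprime ((3 : ℕ) : ℤ) (ℓ : ℤ) :=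
        Nat.isCoprime_iff_coprime.2 ((Nat.Prime.coprime_iff_not_dvd Nat.prime_three).2 h3ℓ)
      rw [hj] at this
      exact_mod_cast this
    have := IsCoprime.add_mul_left_right h1 (t * p)
    rwa [← mul_assoc] at this
  have hdu : (3 : ℤ) ^ (ℓ - 1) ∣ u := by
    refine IsCoprime.dvd_of_dvd_mul_right (IsCoprime.pow_left hcop) ?_
    rw [← hre]
    exact hdvd
  have hu0 : u ≠ 0 := by rintro rfl; simp at hre; exact hz hre
  have h9 : (3 : ℤ) ^ (ℓ - 1) ≤ |u| := Int.le_of_dvd (abs_pos.2 hu0) ((dvd_abs _ _).2 hdu)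
  have hj1 : 1 ≤ j := by omega
  have hdv : u ^ 2 ∣ 1 - v * (-2) ^ j := ⟨q, by linarith⟩
  have hne : 1 - v * (-2) ^ j ≠ 0 := by
    intro h0
    obtain ⟨i, rfl⟩ : ∃ i, j = i + 1 := ⟨j - 1, by omega⟩
    rw [pow_succ] at h0
    have : 2 * (-(v * (-2) ^ i)) = 1 := by linarith
    omega
  have hle := Int.le_of_dvd (abs_pos.2 hne) ((dvd_abs _ _).2 hdv)
  have habs : |1 - v * (-2 : ℤ) ^ j| ≤ 1 + 2 ^ j := by
    refine (abs_sub _ _).trans ?_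
    have hv1 : |v| = 1 := by
      rcases Int.isUnit_iff.1 (isUnit_of_dvd_one hv) with rfl | rfl <;> norm_num
    rw [abs_mul, hv1, abs_pow]
    norm_num
  have h10 : (3 : ℤ) ^ (ℓ - 1) ≤ u ^ 2 := by
    rw [← sq_abs]
    have : (1 : ℤ) ≤ 3 ^ (ℓ - 1) := one_le_pow₀ (by norm_num)
    nlinarith
  have h11 : (1 : ℤ) + 2 ^ j < 3 ^ (ℓ - 1) := by
    have e : ℓ - 1 = j * 2 := by omega
    rw [e, pow_mul]
    have h12 : (2 : ℤ) ^ j ≤ 3 ^ j := pow_le_pow_left₀ (by norm_num) (by norm_num) j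
    have h13 : (3 : ℤ) ^ 1 ≤ 3 ^ j := pow_le_pow_right₀ (by norm_num) hj1
    nlinarith
  linarith

/-! ### Odd exponents -/

theorem Int.pow_dvd_of_prime_dvd_pow {p : ℤ} (hp : Prime p) {n d : ℤ} {ℓ : ℕ} (h : n = d ^ ℓ)
    (hpn : p ∣ n) : p ^ ℓ ∣ n := by
  rw [h] at hpn ⊢
  exact pow_dvd_pow_of_dvd (hp.dvd_of_dvd_pow hpn) ℓ

theorem cube_add_one_eq_nine_mul_cube {x b : ℤ} (hx : 0 ≤ x) (h : x ^ 3 + 1 = 9 * b ^ 3) :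
    x = 2 := by
  obtain ⟨m, hm⟩ : (3 : ℤ) ∣ x + 1 := by
    have h3 : (3 : ℤ) ∣ (x + 1) ^ 3 := ⟨3 * b ^ 3 + x ^ 2 + x, by linear_combination h⟩
    exact Int.prime_three.dvd_of_dvd_pow h3
  obtain rfl : x = 3 * m - 1 := by linarith
  have hprod : (3 * m ^ 2 - 3 * m + 1) * m = b ^ 3 := by linarith
  have hcop : IsCoprime (3 * m ^ 2 - 3 * m + 1) m := ⟨1, 3 - 3 * m, by ring⟩
  obtain ⟨e, he⟩ := Int.eq_pow_of_mul_eq_pow_odd_left hcop (by decide) hprod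
  by_contra hne
  have hm2 : 2 ≤ m := by omega
  refine (fermatLastTheoremFor_iff_int.1 fermatLastTheoremThree) e (m - 1) m ?_ (by omega)
    (by omega) (by linear_combination -he)
  rintro rfl
  nlinarith

theorem eq_of_odd_prime_pow {ℓ : ℕ} (hℓ : ℓ.Prime) (h3 : 3 ≤ ℓ) {z y : ℤ} (hz : 3 ≤ z)
    (h : 3 * z * (z ^ 2 + 2) = y ^ ℓ) : z = 4 ∧ y = 6 ∧ ℓ = 3 := by
  have hodd : Odd ℓ := hℓ.odd_of_ne_two (by omega)
  have h5 : ℓ = 3 ∨ 5 ≤ ℓ := by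
    rcases h3.eq_or_lt with h | h
    · exact Or.inl h.symm
    · obtain ⟨j, hj⟩ := hodd
      omega
  have hpos : ∀ {n d : ℤ}, 0 < n → n = d ^ ℓ → 0 < d := fun hn he => by
    rw [he] at hn
    exact hodd.pow_pos_iff.1 hn
  rcases Int.even_or_odd' z with ⟨w, rfl | hw⟩
  · by_cases h3w : (3 : ℤ) ∣ w
    · obtain ⟨t, ht⟩ := h3w
      have hcop : IsCoprime (12 * w) (2 * w ^ 2 + 1) := by
        rw [show 12 * w = 2 ^ 2 * 3 * w by ring]
        refine ((IsCoprime.pow_left ⟨-w ^ 2, 1, by ring⟩).mul_left ?_).mul_left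
          ⟨-2 * w, 1, by ring⟩
        exact ⟨-6 * t ^ 2, 1, by rw [ht]; ring⟩
      have hmul : 12 * w * (2 * w ^ 2 + 1) = y ^ ℓ := by rw [← h]; ring
      obtain ⟨d, hd⟩ := Int.eq_pow_of_mul_eq_pow_odd_left hcop hodd hmul
      obtain ⟨b, hb⟩ := Int.eq_pow_of_mul_eq_pow_odd_right hcop hodd hmul
      have hdv := Int.pow_dvd_of_prime_dvd_pow Int.prime_two hd ⟨6 * w, by ring⟩
      refine absurd hb (two_mul_sq_add_one_ne_pow hodd h3 (by omega) ?_ b)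
      rw [show ℓ = ℓ - 2 + 2 by omega, pow_add, show 12 * w = 3 * w * 2 ^ 2 by ring] at hdv
      refine IsCoprime.dvd_of_dvd_mul_left (IsCoprime.pow_left ⟨-1, 1, by norm_num⟩)
        (Int.dvd_of_mul_dvd_mul_right (by norm_num) hdv)
    · have h3c : IsCoprime w 3 :=
        (Int.prime_three.coprime_iff_not_dvd.2 h3w).symm
      have hcop : IsCoprime (4 * w) (3 * (2 * w ^ 2 + 1)) := by
        rw [show 4 * w = 2 ^ 2 * w by ring]
        exact ((IsCoprime.pow_left ⟨-1, 1, by norm_num⟩).mul_left h3c).mul_right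
          ((IsCoprime.pow_left ⟨-w ^ 2, 1, by ring⟩).mul_left ⟨-2 * w, 1, by ring⟩)
      have hmul : 4 * w * (3 * (2 * w ^ 2 + 1)) = y ^ ℓ := by rw [← h]; ring
      obtain ⟨d, hd⟩ := Int.eq_pow_of_mul_eq_pow_odd_left hcop hodd hmul
      obtain ⟨W, hW⟩ := Int.eq_pow_of_mul_eq_pow_odd_right hcop hodd hmul
      have hd0 := hpos (by omega) hd
      have hW0 := hpos (by positivity) hW
      have hrel : 8 * W ^ ℓ = 3 * (d ^ 2) ^ ℓ + 24 := by
        rw [← hW, pow_right_comm, ← hd]; ring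
      rcases h5 with rfl | h5
      · obtain ⟨a, rfl⟩ : (2 : ℤ) ∣ d :=
          Int.prime_two.dvd_of_dvd_pow (n := 3) ⟨2 * w, by rw [← hd]; ring⟩
        obtain ⟨b, rfl⟩ : (3 : ℤ) ∣ W :=
          Int.prime_three.dvd_of_dvd_pow (n := 3) ⟨_, hW.symm⟩
        have h2 := cube_add_one_eq_nine_mul_cube (x := 2 * a ^ 2) (b := b) (by positivity)
          (by linarith)
        have ha : a = 1 := by nlinarith
        subst ha
        have hw : w = 2 := by linarith
        subst hw
        refine ⟨rfl, ?_, rfl⟩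
        exact hodd.pow_injective (h.symm.trans (by norm_num))
      · exfalso
        lift d to ℕ using hd0.le
        lift W to ℕ using hW0.le
        rcases lt_or_ge ℓ 12000 with hlt | hge
        · exact (no_solution_of_small hℓ h5 hlt d W).2 (by exact_mod_cast hrel)
        · refine not_abs_sub_le_of_large (P := d ^ 2) (Q := W) hge ?_ (Or.inr ⟨rfl, rfl⟩) ?_
          · by_contra hlt
            have : W = 1 := by omega
            subst this
            simp at hW
            nlinarith
          · have : (8 : ℝ) * W ^ ℓ = 3 * (d ^ 2) ^ ℓ + 24 := by exact_mod_cast hrel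
            push_cast
            rw [this]
            norm_num
  · have hzc : IsCoprime z (z ^ 2 + 2) := ⟨1 + w * z, -w, by rw [hw]; ring⟩
    by_cases h3z : (3 : ℤ) ∣ z
    · obtain ⟨t, ht⟩ := h3z
      have hcop : IsCoprime (3 * z) (z ^ 2 + 2) :=
        IsCoprime.mul_left ⟨1 + 3 * t ^ 2, -1, by rw [ht]; ring⟩ hzc
      obtain ⟨d, hd⟩ := Int.eq_pow_of_mul_eq_pow_odd_left hcop hodd h
      obtain ⟨b, hb⟩ := Int.eq_pow_of_mul_eq_pow_odd_right hcop hodd h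
      have hdv := Int.pow_dvd_of_prime_dvd_pow Int.prime_three hd ⟨z, by ring⟩
      rw [show ℓ = ℓ - 1 + 1 by omega, pow_succ, mul_comm 3 z] at hdv
      have hdz := Int.dvd_of_mul_dvd_mul_right (by norm_num) hdv
      rcases h5 with rfl | h5
      · exfalso
        obtain ⟨r, hr⟩ := hdz
        have h9 : b ^ 3 % 9 = 2 := by
          rw [← hb, hr, show (3 ^ (3 - 1) * r) ^ 2 + 2 = 2 + 9 * (9 * r ^ 2) by ring]
          omega
        have hb9 : b % 9 = 0 ∨ b % 9 = 1 ∨ b % 9 = 2 ∨ b % 9 = 3 ∨ b % 9 = 4 ∨ b % 9 = 5 ∨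
          b % 9 = 6 ∨ b % 9 = 7 ∨ b % 9 = 8 := by omega
        rw [pow_succ, pow_two] at h9
        rcases hb9 with h | h | h | h | h | h | h | h | h <;> simp [Int.mul_emod, h] at h9
      · refine absurd hb (sq_add_two_ne_pow hodd h3 ?_ (by omega) ⟨w, hw⟩ hdz b)
        intro h3ℓ
        have := (Nat.prime_dvd_prime_iff_eq Nat.prime_three hℓ).1 h3ℓ
        omega
    · have h3c : IsCoprime z 3 :=
        (Int.prime_three.coprime_iff_not_dvd.2 h3z).symm
      have hcop : IsCoprime z (3 * (z ^ 2 + 2)) := h3c.mul_right hzc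
      have hmul : z * (3 * (z ^ 2 + 2)) = y ^ ℓ := by rw [← h]; ring
      obtain ⟨a, ha⟩ := Int.eq_pow_of_mul_eq_pow_odd_left hcop hodd hmul
      obtain ⟨W, hW⟩ := Int.eq_pow_of_mul_eq_pow_odd_right hcop hodd hmul
      have ha0 := hpos (by omega) ha
      have hW0 := hpos (by positivity) hW
      have hrel : W ^ ℓ = 3 * (a ^ 2) ^ ℓ + 6 := by
        rw [← hW, pow_right_comm, ← ha]; ring
      exfalso
      rcases h5 with rfl | h5
      · obtain ⟨b, rfl⟩ : (3 : ℤ) ∣ W :=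
          Int.prime_three.dvd_of_dvd_pow (n := 3) ⟨_, hW.symm⟩
        have h9 : z ^ 2 + 2 = 9 * b ^ 3 := by linarith
        have ha9 : z % 9 = 0 ∨ z % 9 = 1 ∨ z % 9 = 8 := by
          have hb9 : a % 9 = 0 ∨ a % 9 = 1 ∨ a % 9 = 2 ∨ a % 9 = 3 ∨ a % 9 = 4 ∨ a % 9 = 5 ∨
            a % 9 = 6 ∨ a % 9 = 7 ∨ a % 9 = 8 := by omega
          rw [ha, pow_succ, pow_two]
          rcases hb9 with h | h | h | h | h | h | h | h | h <;> simp [Int.mul_emod, h]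
        have h2 : (z ^ 2 + 2) % 9 = 0 := by omega
        rw [pow_two] at h2
        rcases ha9 with h | h | h <;> simp [Int.add_emod, Int.mul_emod, h] at h2
      · lift a to ℕ using ha0.le
        lift W to ℕ using hW0.le
        rcases lt_or_ge ℓ 12000 with hlt | hge
        · exact (no_solution_of_small hℓ h5 hlt a W).1 (by exact_mod_cast hrel)
        · refine not_abs_sub_le_of_large (P := W) (Q := a ^ 2) hge ?_ (Or.inl ⟨rfl, rfl⟩) ?_
          · have : a ≠ 1 := by
              rintro rfl
              simp at ha
              omega
            have : 2 ≤ a := by omega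
            nlinarith
          · have : (W : ℝ) ^ ℓ = 3 * (a ^ 2) ^ ℓ + 6 := by exact_mod_cast hrel
            push_cast
            rw [this]
            norm_num

/-! ### The equation `18 k⁴ + 1 = t²` -/

theorem Int.exists_eq_pow_of_isCoprime {a b c : ℤ} {k : ℕ} (ha : 0 ≤ a) (hb : 0 ≤ b)
    (hab : IsCoprime a b) (h : a * b = c ^ k) :
    ∃ d e : ℤ, 0 ≤ d ∧ 0 ≤ e ∧ a = d ^ k ∧ b = e ^ k := by
  lift a to ℕ using ha
  lift b to ℕ using hb
  have hn : a * b = c.natAbs ^ k := by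
    rw [← Int.natAbs_pow, ← h, Int.natAbs_mul, Int.natAbs_natCast, Int.natAbs_natCast]
  have hc : IsUnit (gcd a b) := Nat.isUnit_iff.2 (Nat.isCoprime_iff_coprime.1 hab)
  obtain ⟨d, hd⟩ := exists_eq_pow_of_mul_eq_pow hc hn
  obtain ⟨e, he⟩ := exists_eq_pow_of_mul_eq_pow (gcd_comm a b ▸ hc) (mul_comm a b ▸ hn)
  exact ⟨d, e, by positivity, by positivity, by simpa using congrArg (Nat.cast : ℕ → ℤ) hd,
    by simpa using congrArg (Nat.cast : ℕ → ℤ) he⟩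

theorem Int.prime_pow_dvd_or_of_isCoprime {p a b : ℤ} (hp : Prime p) (hab : IsCoprime a b) {n : ℕ}
    (h : p ^ n ∣ a * b) : p ^ n ∣ a ∨ p ^ n ∣ b := by
  by_cases ha : p ∣ a
  · refine Or.inl (IsCoprime.dvd_of_dvd_mul_right (IsCoprime.pow_left ?_) h)
    refine hp.coprime_iff_not_dvd.2 fun hb => hp.not_isUnit ?_
    exact hab.isUnit_of_dvd' ha hb
  · exact Or.inr (IsCoprime.dvd_of_dvd_mul_left
      (IsCoprime.pow_left (hp.coprime_iff_not_dvd.2 ha)) h)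

/-- In a primitive solution of `x⁴ = y⁴ + z²` with `z` odd, `y` vanishes. -/
theorem eq_zero_of_pow_four_eq_pow_four_add_sq {x y z : ℤ} (hcop : IsCoprime z y)
    (hz : z % 2 = 1) (h : x ^ 4 = y ^ 4 + z ^ 2) : y = 0 := by
  induction hN : x.natAbs using Nat.strong_induction_on generalizing x y z with
  | _ N ih =>
    subst hN
    by_contra hy
    have hx : x ≠ 0 := by
      rintro rfl
      have : 0 < y ^ 4 := by positivity
      nlinarith
    have htrip : PythagoreanTriple z (y ^ 2) (x ^ 2) := by
      unfold PythagoreanTriple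
      linear_combination -h
    obtain ⟨m, n, hzm, hym, hxm, hmn, hpar, hm⟩ := htrip.coprime_classification'
      (Int.isCoprime_iff_gcd_eq_one.1 hcop.pow_right) hz (by positivity)
    have hy2 : 0 < y ^ 2 := by positivity
    have hm0 : 0 < m := lt_of_le_of_ne hm (by rintro rfl; simp at hym; exact hy hym)
    have hn0 : 0 < n := by
      by_contra hn
      nlinarith
    replace hmn := Int.isCoprime_iff_gcd_eq_one.2 hmn
    -- the even one of `m`, `n` is twice a square and the odd one is a square
    have key : ∀ m n : ℤ, 0 < m → 0 < n → IsCoprime m n → m % 2 = 1 → n % 2 = 0 →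
        y ^ 2 = 2 * m * n → x ^ 2 = m ^ 2 + n ^ 2 → False := by
      intro m n hm hn hmn hmodd hneven hym hxm
      obtain ⟨n', rfl⟩ : (2 : ℤ) ∣ n := Int.dvd_of_emod_eq_zero hneven
      obtain ⟨y', rfl⟩ : (2 : ℤ) ∣ y :=
        Int.prime_two.dvd_of_dvd_pow (n := 2) ⟨m * (2 * n'), by rw [hym]; ring⟩
      obtain ⟨a, b, -, -, rfl, rfl⟩ := Int.exists_eq_pow_of_isCoprime (k := 2) (c := y') hm.le
        (by omega) hmn.of_mul_right_right (by linarith)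
      have hcab : IsCoprime (a ^ 2) (2 * b ^ 2) := hmn
      have htrip' : PythagoreanTriple (a ^ 2) (2 * b ^ 2) |x| := by
        unfold PythagoreanTriple
        rw [abs_mul_abs_self]
        linear_combination -hxm
      obtain ⟨p, q, hap, hbp, hxp, hpq, -, hp⟩ := htrip'.coprime_classification'
        (Int.isCoprime_iff_gcd_eq_one.1 hcab) hmodd (abs_pos.2 hx)
      have hb0 : b ≠ 0 := by rintro rfl; simp at hn
      have hb2 : 0 < b ^ 2 := by positivity
      have hp0 : 0 < p := lt_of_le_of_ne hp (by rintro rfl; simp at hbp; exact hb0 hbp)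
      have hq0 : 0 < q := by
        by_contra hq
        nlinarith
      obtain ⟨g, e, hg, he, rfl, rfl⟩ := Int.exists_eq_pow_of_isCoprime (k := 2) (c := b) hp hq0.le
        (Int.isCoprime_iff_gcd_eq_one.2 hpq) (by linarith)
      have hge : IsCoprime g e := by
        have := Int.isCoprime_iff_gcd_eq_one.2 hpq
        exact (IsCoprime.pow_iff two_pos two_pos).1 this
      have hodd : a % 2 = 1 := by
        rcases Int.emod_two_eq_zero_or_one a with h0 | h1
        · rw [pow_two, Int.mul_emod, h0] at hmodd
          simp at hmodd
        · exact h1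
      have hae : IsCoprime a e := by
        have h1 : IsCoprime (a ^ 2) e := by
          rw [hap, show (g ^ 2) ^ 2 - (e ^ 2) ^ 2 = g ^ 4 + e * (-e ^ 3) by ring]
          exact IsCoprime.add_mul_left_left hge.pow_left _
        exact (IsCoprime.pow_left_iff two_pos).1 h1
      have he0 : e = 0 := by
        refine ih g.natAbs ?_ hae hodd (by linear_combination -hap) rfl
        have hlt : |g| < |x| := by
          rw [abs_of_nonneg hg, hxp]
          have h1 : g ≤ g ^ 2 := by nlinarith
          nlinarith
        rw [Int.abs_eq_natAbs, Int.abs_eq_natAbs] at hlt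
        exact_mod_cast hlt
      subst he0
      simp at hq0
    rcases hpar with ⟨h1, h2⟩ | ⟨h1, h2⟩
    · exact key n m hn0 hm0 hmn.symm h2 h1 (by rw [hym]; ring) (by rw [hxm]; ring)
    · exact key m n hm0 hn0 hmn h1 h2 hym hxm

theorem eq_one_of_two_mul_pow_four_eq {C D : ℤ} (h : 2 * D ^ 4 = C ^ 4 + 1) : C ^ 2 = 1 := by
  have hC : C % 2 = 1 := by
    rcases Int.emod_two_eq_zero_or_one C with h0 | h1
    · obtain ⟨c, rfl⟩ := Int.dvd_of_emod_eq_zero h0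
      have : 2 * (D ^ 4 - 8 * c ^ 4) = 1 := by linear_combination h
      omega
    · exact h1
  have hC2 : C ^ 2 % 2 = 1 := by rw [pow_two, Int.mul_emod, hC]; rfl
  have htrip : PythagoreanTriple (C ^ 2) (D ^ 4 - 1) (D ^ 4) := by
    unfold PythagoreanTriple
    linear_combination -h
  have hcop : IsCoprime (C ^ 2) (D ^ 4 - 1) := ⟨C ^ 2, -2, by linear_combination -h⟩
  have hD : D ≠ 0 := by
    rintro rfl
    have : 0 ≤ C ^ 4 := by positivity
    simp at h
    omega
  obtain ⟨m, n, h1, h2, h3, hmn, -, -⟩ := htrip.coprime_classification'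
    (Int.isCoprime_iff_gcd_eq_one.1 hcop) hC2 (by positivity)
  replace hmn := Int.isCoprime_iff_gcd_eq_one.2 hmn
  have hCn : IsCoprime (C * D ^ 2) n := by
    have e1 : IsCoprime (C ^ 2) n := by
      rw [h1, show m ^ 2 - n ^ 2 = m ^ 2 + n * (-n) by ring]
      exact IsCoprime.add_mul_left_left hmn.pow_left _
    have e2 : IsCoprime (D ^ 4) n := by
      rw [h3, show m ^ 2 + n ^ 2 = m ^ 2 + n * n by ring]
      exact IsCoprime.add_mul_left_left hmn.pow_left _
    exact ((IsCoprime.pow_left_iff two_pos).1 e1).mul_left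
      (((IsCoprime.pow_left_iff (by norm_num)).1 e2).pow_left)
  have hDodd : D % 2 = 1 := by
    rcases Int.emod_two_eq_zero_or_one D with h0 | h0
    · obtain ⟨d, rfl⟩ := Int.dvd_of_emod_eq_zero h0
      obtain ⟨c, hc⟩ : ∃ c, C = 2 * c + 1 := ⟨C / 2, by omega⟩
      rw [hc] at h
      have : 4 * (8 * d ^ 4 - (4 * c ^ 4 + 8 * c ^ 3 + 6 * c ^ 2 + 2 * c)) = 2 := by
        linear_combination h
      omega
    · exact h0
  have hn : n = 0 := eq_zero_of_pow_four_eq_pow_four_add_sq (x := m) hCn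
    (by rw [pow_two]; simp [Int.mul_emod, hC, hDodd])
    (by linear_combination (-(D ^ 4)) * h1 - (m ^ 2 - n ^ 2) * h3)
  subst hn
  have hD1 : D ^ 4 = 1 := by linarith
  nlinarith [sq_nonneg (C ^ 2 - 1)]

theorem exists_eq_two_mul_add_one_of_odd_pow {b m : ℤ} {n : ℕ} (hn : n ≠ 0)
    (h : b ^ n = 2 * m + 1) : ∃ c, b = 2 * c + 1 := by
  rcases Int.even_or_odd b with hb | hb
  · obtain ⟨c, hc⟩ := (Int.even_pow.2 ⟨hb, hn⟩).two_dvd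
    omega
  · exact hb

theorem eq_two_of_eighteen_mul_pow_four {k t : ℤ} (hk : 0 < k) (h : 18 * k ^ 4 + 1 = t ^ 2) :
    k = 2 := by
  wlog ht : 0 ≤ t generalizing t
  · exact this (t := -t) (by rw [h]; ring) (by linarith)
  obtain ⟨r, rfl⟩ : ∃ r, t = 2 * r + 1 :=
    exists_eq_two_mul_add_one_of_odd_pow (m := 9 * k ^ 4) (n := 2) (by norm_num) (by linarith)
  have hr0 : 0 ≤ r := by omega
  obtain ⟨s, rfl⟩ : (2 : ℤ) ∣ k := by
    refine Int.prime_two.dvd_of_dvd_pow (n := 4) ?_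
    obtain ⟨q, hq⟩ := (Int.even_mul_succ_self r).two_dvd
    have : 9 * k ^ 4 = 2 * (2 * q) := by linarith
    omega
  have hs0 : 0 < s := by omega
  have hrs : r * (r + 1) = 72 * s ^ 4 := by linarith
  have hrc : IsCoprime r (r + 1) := ⟨-1, 1, by ring⟩
  have h8 := Int.prime_pow_dvd_or_of_isCoprime Int.prime_two hrc (n := 3)
    ⟨9 * s ^ 4, by rw [hrs]; ring⟩
  have h9 := Int.prime_pow_dvd_or_of_isCoprime Int.prime_three hrc (n := 2)
    ⟨8 * s ^ 4, by rw [hrs]; ring⟩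
  norm_num only at h8 h9
  have hfour : ∀ a b : ℤ, 0 ≤ a → 0 ≤ b → IsCoprime a b → a * b = s ^ 4 →
      ∃ A B : ℤ, 0 ≤ A ∧ 0 ≤ B ∧ a = A ^ 4 ∧ b = B ^ 4 :=
    fun a b ha hb hab h => Int.exists_eq_pow_of_isCoprime ha hb hab h
  have hmod : ∀ A : ℤ, A ^ 4 % 3 = 0 ∨ A ^ 4 % 3 = 1 := by
    intro A
    have : A % 3 = 0 ∨ A % 3 = 1 ∨ A % 3 = 2 := by omega
    rcases this with h | h | h <;> simp [pow_succ, Int.mul_emod, h]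
  rcases h8 with ⟨a, ha⟩ | ⟨a, ha⟩ <;> rcases h9 with ⟨b, hb⟩ | ⟨b, hb⟩
  · obtain ⟨c, rfl⟩ : (72 : ℤ) ∣ r := by omega
    obtain ⟨A, B, -, hB0, rfl, hB⟩ := hfour c (72 * c + 1) (by omega) (by omega) ⟨-72, 1, by ring⟩
      (by linarith)
    have hpos : 0 < A ^ 4 := by
      rcases hr0.eq_or_lt with h0 | h0
      · rw [← h0] at hrs
        have : 0 < s ^ 4 := by positivity
        linarith
      · linarith
    exfalso
    obtain ⟨β, rfl⟩ : ∃ β, B = 2 * β + 1 := exists_eq_two_mul_add_one_of_odd_pow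
      (m := 36 * A ^ 4) (n := 4) (by norm_num) (by linarith)
    have hβ : β * (β + 1) * (2 * β ^ 2 + 2 * β + 1) = 3 ^ 2 * A ^ 4 := by linarith
    have hE : IsCoprime (3 ^ 2) (2 * β ^ 2 + 2 * β + 1) := by
      refine IsCoprime.pow_left (Int.prime_three.coprime_iff_not_dvd.2 fun hd => ?_)
      have : β % 3 = 0 ∨ β % 3 = 1 ∨ β % 3 = 2 := by omega
      have hd0 := Int.emod_eq_zero_of_dvd hd
      rcases this with h | h | h <;> simp [pow_two, Int.add_emod, Int.mul_emod, h] at hd0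
    obtain ⟨F, hF⟩ := hE.dvd_of_dvd_mul_right (Dvd.intro _ hβ.symm)
    have hβ0 : 0 ≤ β := by omega
    obtain ⟨D, E, -, -, rfl, -⟩ := Int.exists_eq_pow_of_isCoprime (a := F)
      (b := 2 * β ^ 2 + 2 * β + 1) (c := A) (k := 4) (by nlinarith) (by positivity)
      ⟨-18, 1, by linear_combination 2 * hF⟩
      (by rw [hF] at hβ; linarith)
    have hm : β * (β + 1) = (3 * D ^ 2) ^ 2 := by rw [hF]; ring
    have hle : 3 * D ^ 2 ≤ β := by
      by_contra hlt
      nlinarith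
    have hD0 : 0 ≤ D ^ 2 := sq_nonneg D
    have hβz : β = 0 := by nlinarith
    rw [hβz] at hβ
    linarith
  · obtain ⟨c, rfl⟩ : (8 : ℤ) ∣ r := ⟨a, ha⟩
    obtain ⟨A, B, -, -, rfl, rfl⟩ := hfour c b (by omega) (by omega) ⟨-8, 9, by linarith⟩
      (by nlinarith)
    obtain ⟨β, rfl⟩ : ∃ β, B = 2 * β + 1 := exists_eq_two_mul_add_one_of_odd_pow
      (m := 4 * A ^ 4 - 4 * B ^ 4) (n := 4) (by norm_num) (by linarith)
    have hβ0 : 0 ≤ β * (β + 1) := by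
      rcases lt_or_ge β 0 with h0 | h0 <;> nlinarith
    obtain ⟨C, D, -, -, hC, hD⟩ := Int.exists_eq_pow_of_isCoprime (a := 6 * β ^ 2 + 6 * β + 1)
      (b := 3 * β ^ 2 + 3 * β + 1) (c := A) (k := 4) (by nlinarith) (by nlinarith)
      ⟨-1, 2, by ring⟩ (by linarith)
    have hC1 := eq_one_of_two_mul_pow_four_eq (C := C) (D := D) (by linarith)
    have hC4 : C ^ 4 = 1 := by rw [show C ^ 4 = (C ^ 2) ^ 2 by ring, hC1]; norm_num
    have hβ1 : β * (β + 1) = 0 := by linarith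
    have hB1 : (2 * β + 1) ^ 4 = 1 := by
      rw [show (2 * β + 1) ^ 4 = (4 * (β * (β + 1)) + 1) ^ 2 by ring, hβ1]; norm_num
    have hs1 : s ^ 4 = 1 ^ 4 := by
      rw [hB1] at hb
      have : A ^ 4 = 1 := by linarith
      rw [this] at hrs
      linarith
    rw [pow_left_inj₀ hs0.le (by norm_num) (by norm_num)] at hs1
    omega
  · exfalso
    obtain ⟨A, B, -, -, rfl, rfl⟩ := hfour a b (by omega) (by omega) ⟨8, -9, by linarith⟩
      (by nlinarith)
    have := hmod A
    omega
  · exfalso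
    obtain ⟨c, hc⟩ : (72 : ℤ) ∣ r + 1 := by omega
    obtain ⟨A, B, -, -, rfl, rfl⟩ := hfour c r (by omega) (by omega) ⟨72, -1, by linarith⟩
      (by nlinarith)
    have := hmod B
    omega

/-! ### The equation `2 s⁴ + 1 = 3 t²` -/

/-- Rational part of `(5 + 2√6) ^ n`. -/
def pellSixRe (n : ℕ) : ℤ := ((⟨5, 2⟩ : ℤ√6) ^ n).re

/-- Coefficient of `√6` in `(5 + 2√6) ^ n`. -/
def pellSixIm (n : ℕ) : ℤ := ((⟨5, 2⟩ : ℤ√6) ^ n).im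

/-- Coefficient of `√2` in `(√3 + √2) ^ (2 n + 1)`. -/
def rootTwoCoeff (n : ℕ) : ℤ := pellSixRe n + 3 * pellSixIm n

/-- Coefficient of `√3` in `(√3 + √2) ^ (2 n + 1)`. -/
def rootThreeCoeff (n : ℕ) : ℤ := pellSixRe n + 2 * pellSixIm n

@[simp] theorem pellSixRe_zero : pellSixRe 0 = 1 := by simp [pellSixRe]

@[simp] theorem pellSixIm_zero : pellSixIm 0 = 0 := by simp [pellSixIm]

@[simp] theorem pellSixRe_one : pellSixRe 1 = 5 := by simp [pellSixRe]

@[simp] theorem pellSixIm_one : pellSixIm 1 = 2 := by simp [pellSixIm]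

theorem pellSixRe_add (m n : ℕ) :
    pellSixRe (m + n) = pellSixRe m * pellSixRe n + 6 * pellSixIm m * pellSixIm n := by
  simp [pellSixRe, pellSixIm, pow_add]

theorem pellSixIm_add (m n : ℕ) :
    pellSixIm (m + n) = pellSixRe m * pellSixIm n + pellSixIm m * pellSixRe n := by
  simp [pellSixRe, pellSixIm, pow_add]

theorem pellSix_sq (n : ℕ) : pellSixRe n ^ 2 - 6 * pellSixIm n ^ 2 = 1 := by
  induction n with
  | zero => simp
  | succ n ih =>
    rw [pellSixRe_add, pellSixIm_add, pellSixRe_one, pellSixIm_one]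
    linear_combination ih

theorem pellSix_nonneg (n : ℕ) : 0 < pellSixRe n ∧ 0 ≤ pellSixIm n := by
  induction n with
  | zero => simp
  | succ n ih =>
    rw [pellSixRe_add, pellSixIm_add, pellSixRe_one, pellSixIm_one]
    omega

theorem rootTwoCoeff_pos (n : ℕ) : 0 < rootTwoCoeff n := by
  have := pellSix_nonneg n
  unfold rootTwoCoeff
  omega

theorem rootTwoCoeff_add (m n : ℕ) : rootTwoCoeff (m + n) =
    pellSixRe n * rootTwoCoeff m + 3 * pellSixIm n * rootThreeCoeff m := by
  rw [rootTwoCoeff, rootTwoCoeff, rootThreeCoeff, pellSixRe_add, pellSixIm_add]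
  ring

theorem rootThreeCoeff_add (m n : ℕ) : rootThreeCoeff (m + n) =
    pellSixRe n * rootThreeCoeff m + 2 * pellSixIm n * rootTwoCoeff m := by
  rw [rootThreeCoeff, rootTwoCoeff, rootThreeCoeff, pellSixRe_add, pellSixIm_add]
  ring

theorem rootCoeff_sq (n : ℕ) : 3 * rootThreeCoeff n ^ 2 = 2 * rootTwoCoeff n ^ 2 + 1 := by
  rw [rootThreeCoeff, rootTwoCoeff]
  linear_combination pellSix_sq n

theorem pellSixRe_two_mul_add_one (m : ℕ) : pellSixRe (2 * m + 1) = 1 + 4 * rootTwoCoeff m ^ 2 := by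
  rw [two_mul, pellSixRe_add, pellSixRe_add, pellSixIm_add, pellSixRe_one, pellSixIm_one,
    rootTwoCoeff]
  linear_combination pellSix_sq m

theorem pellSixIm_two_mul_add_one (m : ℕ) :
    pellSixIm (2 * m + 1) = 2 * rootThreeCoeff m * rootTwoCoeff m := by
  rw [two_mul, pellSixIm_add, pellSixRe_add, pellSixIm_add, pellSixRe_one, pellSixIm_one,
    rootTwoCoeff, rootThreeCoeff]
  ring

theorem rootTwoCoeff_add_two_mul (n k : ℕ) :
    rootTwoCoeff (n + 2 * k) = -rootTwoCoeff n + 2 * pellSixRe k * rootTwoCoeff (n + k) := by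
  rw [two_mul, ← add_assoc, rootTwoCoeff_add, rootTwoCoeff_add, rootThreeCoeff_add]
  linear_combination (-rootTwoCoeff n) * pellSix_sq k

theorem rootTwoCoeff_add_period (n m : ℕ) : rootTwoCoeff (n + (2 * m + 1)) =
    rootTwoCoeff n + 2 * pellSixRe (n + m + 1) * rootTwoCoeff m := by
  rw [rootTwoCoeff_add, pellSixRe_two_mul_add_one, pellSixIm_two_mul_add_one, pellSixRe_add,
    pellSixIm_add, pellSixRe_add, pellSixRe_one, pellSixIm_one]
  simp only [rootTwoCoeff, rootThreeCoeff]
  ring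

theorem rootTwoCoeff_mod_four (n : ℕ) : rootTwoCoeff n % 4 = (2 * n + 1) % 4 := by
  have h : pellSixRe n % 4 = 1 ∧ pellSixIm n % 4 = (2 * n) % 4 := by
    induction n with
    | zero => simp
    | succ n ih =>
      rw [pellSixRe_add, pellSixIm_add, pellSixRe_one, pellSixIm_one]
      omega
  rw [rootTwoCoeff]
  omega

/-- Every positive solution of `2 y² + 1 = 3 t²` comes from a power of `√3 + √2`. -/
theorem exists_eq_rootTwoCoeff {y t : ℤ} (hy : 0 < y) (ht : 0 < t)
    (h : 2 * y ^ 2 + 1 = 3 * t ^ 2) : ∃ n, y = rootTwoCoeff n ∧ t = rootThreeCoeff n := by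
  induction hN : y.toNat using Nat.strong_induction_on generalizing y t with
  | _ N ih =>
    subst hN
    rcases le_or_gt y 3 with hy3 | hy3
    · have ht3 : t ≤ 3 := by nlinarith
      interval_cases y <;> interval_cases t <;> first | omega | skip
      exact ⟨0, by simp [rootTwoCoeff], by simp [rootThreeCoeff]⟩
    · obtain ⟨n, h1, h2⟩ := ih (5 * y - 6 * t).toNat (by
          have : 4 * y < 6 * t := by nlinarith
          omega) (y := 5 * y - 6 * t) (t := 5 * t - 4 * y) (by nlinarith) (by nlinarith)
          (by linear_combination h) rfl
      refine ⟨n + 1, ?_, ?_⟩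
      · rw [rootTwoCoeff_add, pellSixRe_one, pellSixIm_one, ← h1, ← h2]; ring
      · rw [rootThreeCoeff_add, pellSixRe_one, pellSixIm_one, ← h1, ← h2]; ring

theorem rootTwoCoeff_mul {m : ℕ} (j : ℕ) : ∃ a : ℤ, rootTwoCoeff (m + (2 * m + 1) * j) =
    rootTwoCoeff m * (2 * j + 1 + rootTwoCoeff m * a) := by
  suffices h : ∃ a b : ℤ, rootTwoCoeff (m + (2 * m + 1) * j) =
      rootTwoCoeff m * (2 * j + 1 + rootTwoCoeff m ^ 2 * a) ∧
      rootThreeCoeff (m + (2 * m + 1) * j) = rootThreeCoeff m * (1 + rootTwoCoeff m ^ 2 * b) by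
    obtain ⟨a, b, h, -⟩ := h
    exact ⟨rootTwoCoeff m * a, by rw [h]; ring⟩
  induction j with
  | zero => exact ⟨0, 0, by simp, by simp⟩
  | succ j ih =>
    obtain ⟨a, b, h1, h2⟩ := ih
    rw [mul_add, mul_one, ← add_assoc, rootTwoCoeff_add (m + _),
      rootThreeCoeff_add (m + _),
      pellSixRe_two_mul_add_one, pellSixIm_two_mul_add_one, h1, h2]
    refine ⟨a + 4 * (2 * j + 1 + rootTwoCoeff m ^ 2 * a) + 4 + 2 * b + 4 * rootTwoCoeff m ^ 2 * b,
      b + 4 * (1 + rootTwoCoeff m ^ 2 * b) + 4 * (2 * j + 1 + rootTwoCoeff m ^ 2 * a), ?_, ?_⟩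
    · push_cast
      linear_combination (2 * rootTwoCoeff m * (1 + rootTwoCoeff m ^ 2 * b)) * rootCoeff_sq m
    · ring

theorem dvd_pellSixIm_of_dvd_add {p : ℤ} (hp : Prime p) {a b : ℕ} (ha : p ∣ pellSixIm a)
    (hab : p ∣ pellSixIm (a + b)) : p ∣ pellSixIm b := by
  rw [pellSixIm_add] at hab
  have h1 : p ∣ pellSixRe a * pellSixIm b := (dvd_add_left (dvd_mul_of_dvd_left ha _)).1 hab
  refine (hp.dvd_or_dvd h1).resolve_left fun h => hp.not_isUnit (isUnit_of_dvd_one ?_)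
  rw [← pellSix_sq a]
  exact dvd_sub (dvd_pow h two_ne_zero) (dvd_mul_of_dvd_right (dvd_pow ha two_ne_zero) _)

theorem dvd_pellSixIm_mul {p : ℤ} {a : ℕ} (ha : p ∣ pellSixIm a) (k : ℕ) :
    p ∣ pellSixIm (a * k) := by
  induction k with
  | zero => simp
  | succ k ih =>
    rw [mul_add, mul_one, pellSixIm_add]
    exact dvd_add (dvd_mul_of_dvd_right ha _) (dvd_mul_of_dvd_left ih _)

theorem dvd_pellSixIm_gcd {p : ℤ} (hp : Prime p) {a b : ℕ} (ha : p ∣ pellSixIm a)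
    (hb : p ∣ pellSixIm b) : p ∣ pellSixIm (a.gcd b) := by
  induction a, b using Nat.gcd.induction with
  | H0 n => simpa using hb
  | H1 m n _ ih =>
    rw [Nat.gcd_rec]
    refine ih (dvd_pellSixIm_of_dvd_add hp (dvd_pellSixIm_mul ha (n / m)) ?_) ha
    rwa [Nat.div_add_mod]

theorem dvd_pellSixIm_pred_or_succ {p : ℕ} (hp : p.Prime) (hp3 : 3 < p) :
    (p : ℤ) ∣ pellSixIm (p - 1) ∨ (p : ℤ) ∣ pellSixIm (p + 1) := by
  have := Fact.mk hp
  obtain ⟨r, hr⟩ := exists_add_pow_prime_eq hp (5 : ℤ√6) (⟨0, 2⟩ : ℤ√6)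
  obtain ⟨j, hj⟩ := hp.odd_of_ne_two (by omega)
  have h5 : (5 : ℤ√6) ^ p = ⟨5 ^ p, 0⟩ := by
    rw [← Zsqrtd.intCast_val]; push_cast; rfl
  have h2 : (⟨0, 2⟩ : ℤ√6) ^ p = ⟨0, 2 ^ p * 6 ^ j⟩ := by
    have hsq : (⟨0, 2⟩ : ℤ√6) ^ 2 = ((24 : ℤ) : ℤ√6) := by rw [pow_two]; ext <;> simp
    rw [hj, pow_succ, pow_mul, hsq, ← Int.cast_pow, Zsqrtd.smul_val, mul_zero, pow_succ, pow_mul,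
      mul_right_comm, ← mul_pow]
    norm_num
  rw [show (5 : ℤ√6) + ⟨0, 2⟩ = ⟨5, 2⟩ by ext <;> simp, h5, h2] at hr
  have hre : (pellSixRe p : ZMod p) = 5 := by
    rw [pellSixRe, hr]
    simp
  have him : (pellSixIm p : ZMod p) = 2 * 6 ^ j := by
    rw [pellSixIm, hr]
    simp
  have h6 : (6 : ZMod p) ≠ 0 := by
    intro h
    have : (p : ℕ) ∣ 2 * 3 := (ZMod.natCast_eq_zero_iff 6 p).1 (by exact_mod_cast h)
    rcases (hp.dvd_mul).1 this with h | h <;> have := Nat.le_of_dvd (by norm_num) h <;> omega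
  have hpj : p / 2 = j := by omega
  have hp1 : p - 1 + 1 = p := by omega
  rcases ZMod.pow_div_two_eq_neg_one_or_one p h6 with h | h <;> rw [hpj] at h <;> rw [h] at him
  · left
    rw [← ZMod.intCast_zmod_eq_zero_iff_dvd]
    have e1 := pellSixRe_add (p - 1) 1
    have e2 := pellSixIm_add (p - 1) 1
    rw [hp1, pellSixRe_one, pellSixIm_one] at e1 e2
    have : pellSixIm (p - 1) = 5 * pellSixIm p - 2 * pellSixRe p := by rw [e1, e2]; ring
    rw [this]
    push_cast
    rw [hre, him]
    ring
  · right
    rw [← ZMod.intCast_zmod_eq_zero_iff_dvd, pellSixIm_add, pellSixRe_one, pellSixIm_one]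
    push_cast
    rw [hre, him]
    ring

theorem not_dvd_rootTwoCoeff {p m : ℕ} (hp : p.Prime) (hp2 : p ≠ 2)
    (hm : ∀ q : ℕ, q.Prime → q ∣ 2 * m + 1 → p ≤ q) : ¬ (p : ℤ) ∣ rootTwoCoeff m := by
  intro h
  have hpp := Nat.prime_iff_prime_int.1 hp
  have hp2' := hp.two_le
  rcases (show p = 3 ∨ 3 < p by omega) with rfl | hp3
  · have h1 : (3 : ℤ) ∣ pellSixRe m := by
      have h0 : ((3 : ℕ) : ℤ) ∣ pellSixRe m + 3 * pellSixIm m := h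
      push_cast at h0
      omega
    obtain ⟨c, hc⟩ := h1
    have := pellSix_sq m
    rw [hc] at this
    have : 3 * (3 * c ^ 2 - 2 * pellSixIm m ^ 2) = 1 := by linear_combination this
    omega
  · have hU : (p : ℤ) ∣ pellSixIm (2 * m + 1) := by
      rw [pellSixIm_two_mul_add_one]
      exact dvd_mul_of_dvd_right h _
    have hcop : ∀ k, p ≠ k → k ≤ p + 1 → (k ≠ 0) → (Even k) → (2 * m + 1).gcd k = 1 := by
      intro k hpk hk hk0 hke
      by_contra hne
      obtain ⟨q, hq, hqd⟩ := Nat.exists_prime_and_dvd hne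
      have hle := hm q hq (hqd.trans (Nat.gcd_dvd_left _ _))
      have hqk := hqd.trans (Nat.gcd_dvd_right _ _)
      obtain ⟨c, hc⟩ := hqk
      have hqodd : q % 2 = 1 := by
        rcases hq.eq_two_or_odd with h | h
        · omega
        · exact h
      have hc2 : 2 ≤ c := by
        by_contra hlt
        have : c = 0 ∨ c = 1 := by omega
        obtain ⟨e, he⟩ := hke
        rcases this with rfl | rfl <;> omega
      nlinarith
    have hpodd := hp.eq_two_or_odd
    have key : ∀ k, (p : ℤ) ∣ pellSixIm k → (2 * m + 1).gcd k = 1 → False := by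
      intro k hk hg
      have := dvd_pellSixIm_gcd hpp hU hk
      rw [hg, pellSixIm_one] at this
      have h2 := Int.le_of_dvd (by norm_num) this
      omega
    rcases dvd_pellSixIm_pred_or_succ hp hp3 with hk | hk
    · exact key _ hk (hcop _ (by omega) (by omega) (by omega) (Nat.even_iff.2 (by omega)))
    · exact key _ hk (hcop _ (by omega) (by omega) (by omega) (Nat.even_iff.2 (by omega)))

theorem one_lt_rootTwoCoeff {n : ℕ} (hn : n ≠ 0) : 1 < rootTwoCoeff n := by
  obtain ⟨k, rfl⟩ := Nat.exists_eq_succ_of_ne_zero hn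
  have := pellSix_nonneg k
  rw [Nat.succ_eq_add_one, rootTwoCoeff_add, pellSixRe_one, pellSixIm_one, rootTwoCoeff,
    rootThreeCoeff]
  omega

/-- Jacobi symbols of odd numbers are swapped the same way if the numbers agree modulo `4`. -/
theorem jacobiSym_eq_of_swap {a b c d : ℕ} (ha : a % 2 = 1) (hb : b % 2 = 1)
    (hac : a % 4 = c % 4) (hbd : b % 4 = d % 4) (h : jacobiSym b a = jacobiSym d c) :
    jacobiSym a b = jacobiSym c d := by
  rw [← jacobiSym.quadratic_reciprocity_if ha hb,
    ← jacobiSym.quadratic_reciprocity_if (a := c) (b := d) (by omega) (by omega), h, hac, hbd]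

theorem jacobiSym_rootTwoCoeff (n m : ℕ) :
    jacobiSym (rootTwoCoeff n) (rootTwoCoeff m).toNat = jacobiSym (2 * n + 1 : ℕ) (2 * m + 1) := by
  induction m using Nat.strong_induction_on generalizing n with
  | _ m ihm =>
  induction n using Nat.strong_induction_on with
  | _ n ihn =>
  have hm0 := rootTwoCoeff_pos m
  have hn0 := rootTwoCoeff_pos n
  have hm4 := rootTwoCoeff_mod_four m
  have hn4 := rootTwoCoeff_mod_four n
  have hcast : (((rootTwoCoeff m).toNat : ℕ) : ℤ) = rootTwoCoeff m := Int.toNat_of_nonneg hm0.le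
  rcases lt_trichotomy n m with hlt | rfl | hgt
  · have := ihm n hlt m
    rw [← Int.toNat_of_nonneg hn0.le]
    refine jacobiSym_eq_of_swap (by omega) (by omega) (by omega) (by omega) ?_
    rw [hcast, this]
  · rcases Nat.eq_zero_or_pos n with rfl | hn
    · simp [rootTwoCoeff]
    · have h1 := one_lt_rootTwoCoeff hn.ne'
      rw [jacobiSym.mod_left, hcast, Int.emod_self, jacobiSym.zero_left (by omega),
        jacobiSym.mod_left, Int.emod_self, jacobiSym.zero_left (by omega)]
  · rcases le_or_gt (2 * m + 1) n with hle | hlt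
    · obtain ⟨k, rfl⟩ := Nat.exists_eq_add_of_le' hle
      rw [jacobiSym.mod_left' (a₂ := rootTwoCoeff k), ihn k (by omega),
        jacobiSym.mod_left' (a₁ := ((2 * (k + (2 * m + 1)) + 1 : ℕ) : ℤ))
          (a₂ := ((2 * k + 1 : ℕ) : ℤ))]
      · push_cast
        rw [show (2 * (k + (2 * m + 1)) + 1 : ℤ) = 2 * k + 1 + (2 * m + 1) * 2 by ring,
          Int.add_mul_emod_self_left]
      · rw [hcast, rootTwoCoeff_add_period, Int.add_mul_emod_self_right]
    · obtain ⟨k, rfl⟩ := Nat.exists_eq_add_of_lt hgt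
      obtain ⟨i, rfl⟩ : ∃ i, m = i + (k + 1) := ⟨m - (k + 1), by omega⟩
      have e : i + (k + 1) + k + 1 = i + 2 * (k + 1) := by ring
      rw [e] at *
      rw [jacobiSym.mod_left' (a₂ := -rootTwoCoeff i),
        jacobiSym.neg _ (Nat.odd_iff.2 (by omega)), ihn i (by omega),
        jacobiSym.mod_left' (a₁ := ((2 * (i + 2 * (k + 1)) + 1 : ℕ) : ℤ))
          (a₂ := -((2 * i + 1 : ℕ) : ℤ)),
        jacobiSym.neg _ (Nat.odd_iff.2 (by omega))]
      · congr 1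
        rw [ZMod.χ₄_nat_mod_four, ZMod.χ₄_nat_mod_four (2 * _ + 1)]
        congr 2
        omega
      · push_cast
        rw [show (2 * (i + 2 * (k + 1)) + 1 : ℤ) =
          -(2 * i + 1) + (2 * (i + (k + 1)) + 1) * 2 by ring, Int.add_mul_emod_self_left]
      · rw [hcast, rootTwoCoeff_add_two_mul, Int.add_mul_emod_self_right]

theorem exists_jacobiSym_eq_neg_one {p : ℕ} (hp : p.Prime) (hp2 : p ≠ 2) :
    ∃ m : ℕ, jacobiSym p (2 * m + 1) = -1 := by
  have := Fact.mk hp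
  obtain ⟨a, ha⟩ := FiniteField.exists_nonsquare (F := ZMod p) (by rwa [ZMod.ringChar_zmod_n])
  have hc : Nat.Coprime p 4 := by
    rw [show 4 = 2 ^ 2 by norm_num]
    exact ((Nat.coprime_primes hp Nat.prime_two).2 hp2).pow_right 2
  obtain ⟨M, h1, h2⟩ := Nat.chineseRemainder hc a.val 1
  have h4 : M % 4 = 1 := h2
  refine ⟨M / 2, ?_⟩
  rw [show 2 * (M / 2) + 1 = M by omega,
    ← jacobiSym.quadratic_reciprocity_one_mod_four h4 (hp.odd_of_ne_two hp2),
    ← jacobiSym.legendreSym.to_jacobiSym, legendreSym.eq_neg_one_iff]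
  have : ((M : ℤ) : ZMod p) = a := by
    rw [Int.cast_natCast, (ZMod.natCast_eq_natCast_iff _ _ _).2 h1, ZMod.natCast_zmod_val]
  rwa [this]

theorem eq_zero_of_rootTwoCoeff_eq_sq {n : ℕ} {s : ℤ} (h : rootTwoCoeff n = s ^ 2) : n = 0 := by
  induction n using Nat.strong_induction_on generalizing s with
  | _ n ih =>
  by_contra hn
  have hp := Nat.minFac_prime (n := 2 * n + 1) (by omega)
  set p := (2 * n + 1).minFac with hpdef
  obtain ⟨c, hc⟩ := Nat.minFac_dvd (2 * n + 1)
  rw [← hpdef] at hc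
  have hodd : Odd (p * c) := ⟨n, hc.symm⟩
  obtain ⟨⟨j, hj⟩, ⟨m, hm⟩⟩ := Nat.odd_mul.1 hodd
  have hp2 : p ≠ 2 := by omega
  have hnm : n = m + (2 * m + 1) * j := by
    rw [hj, hm] at hc
    nlinarith
  have hmn : m < n := by
    have : j ≠ 0 := by
      rintro rfl
      exact hp.one_lt.ne' (by omega)
    have : 1 ≤ (2 * m + 1) * j := by
      apply Nat.one_le_iff_ne_zero.2
      positivity
    omega
  obtain ⟨a, ha⟩ := rootTwoCoeff_mul (m := m) j
  rw [← hnm, h] at ha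
  have hndvd := not_dvd_rootTwoCoeff (m := m) hp hp2 fun q hq hqm =>
    Nat.minFac_le_of_dvd hq.two_le (hc ▸ hm ▸ dvd_mul_of_dvd_right hqm p)
  have hcop : IsCoprime (rootTwoCoeff m) (2 * j + 1 + rootTwoCoeff m * a) := by
    rw [IsCoprime.add_mul_left_right_iff]
    have := ((Nat.prime_iff_prime_int.1 hp).coprime_iff_not_dvd.2 hndvd).symm
    rw [hj] at this
    exact_mod_cast this
  have hpos := rootTwoCoeff_pos m
  obtain ⟨d, -, -, -, hd, -⟩ := Int.exists_eq_pow_of_isCoprime hpos.le (by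
    by_contra hneg
    have := mul_neg_of_pos_of_neg hpos (not_le.1 hneg)
    nlinarith [sq_nonneg s]) hcop ha.symm
  have hm0 := ih m hmn hd
  subst hm0
  obtain ⟨M, hM⟩ := exists_jacobiSym_eq_neg_one hp hp2
  have hJ := jacobiSym_rootTwoCoeff n M
  rw [hc, hm, mul_zero, zero_add, mul_one, hM, h, jacobiSym.pow_left] at hJ
  nlinarith [sq_nonneg (jacobiSym s (rootTwoCoeff M).toNat)]

theorem sq_eq_one_of_two_mul_pow_four {s t : ℤ} (h : 2 * s ^ 4 + 1 = 3 * t ^ 2) : s ^ 2 = 1 := by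
  have hs : s ≠ 0 := by rintro rfl; omega
  have ht : t ≠ 0 := by rintro rfl; nlinarith [sq_nonneg (s ^ 2)]
  obtain ⟨n, hn, -⟩ := exists_eq_rootTwoCoeff (y := s ^ 2) (t := |t|) (by positivity)
    (by positivity) (by rw [sq_abs, ← h]; ring)
  have := eq_zero_of_rootTwoCoeff_eq_sq hn.symm
  subst this
  simpa [rootTwoCoeff] using hn

/-! ### The equation `s⁴ + 2 = 3 t²` -/

/-- Rational part of `(2 + √3) ^ n`. -/
def pellThreeRe (n : ℕ) : ℤ := ((⟨2, 1⟩ : ℤ√3) ^ n).re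

/-- Coefficient of `√3` in `(2 + √3) ^ n`. -/
def pellThreeIm (n : ℕ) : ℤ := ((⟨2, 1⟩ : ℤ√3) ^ n).im

/-- Rational part of `(1 + √3) * (2 + √3) ^ n`. -/
def oneAddRootThreeRe (n : ℕ) : ℤ := pellThreeRe n + 3 * pellThreeIm n

@[simp] theorem pellThreeRe_zero : pellThreeRe 0 = 1 := by simp [pellThreeRe]

@[simp] theorem pellThreeIm_zero : pellThreeIm 0 = 0 := by simp [pellThreeIm]

@[simp] theorem pellThreeRe_one : pellThreeRe 1 = 2 := by simp [pellThreeRe]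

@[simp] theorem pellThreeIm_one : pellThreeIm 1 = 1 := by simp [pellThreeIm]

theorem pellThreeRe_add (m n : ℕ) :
    pellThreeRe (m + n) = pellThreeRe m * pellThreeRe n + 3 * pellThreeIm m * pellThreeIm n := by
  simp [pellThreeRe, pellThreeIm, pow_add]

theorem pellThreeIm_add (m n : ℕ) :
    pellThreeIm (m + n) = pellThreeRe m * pellThreeIm n + pellThreeIm m * pellThreeRe n := by
  simp [pellThreeRe, pellThreeIm, pow_add]

theorem pellThree_sq (n : ℕ) : pellThreeRe n ^ 2 - 3 * pellThreeIm n ^ 2 = 1 := by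
  induction n with
  | zero => simp
  | succ n ih =>
    rw [pellThreeRe_add, pellThreeIm_add, pellThreeRe_one, pellThreeIm_one]
    linear_combination ih

theorem pellThree_nonneg (n : ℕ) : 0 < pellThreeRe n ∧ 0 ≤ pellThreeIm n := by
  induction n with
  | zero => simp
  | succ n ih =>
    rw [pellThreeRe_add, pellThreeIm_add, pellThreeRe_one, pellThreeIm_one]
    omega

/-- Every positive solution of `x² + 2 = 3 t²` comes from a power of `2 + √3`. -/
theorem exists_eq_oneAddRootThreeRe {x t : ℤ} (hx : 0 < x) (ht : 0 < t)
    (h : x ^ 2 + 2 = 3 * t ^ 2) :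
    ∃ n, x = oneAddRootThreeRe n ∧ t = pellThreeRe n + pellThreeIm n := by
  induction hN : x.toNat using Nat.strong_induction_on generalizing x t with
  | _ N ih =>
    subst hN
    rcases le_or_gt x 3 with hx3 | hx3
    · have ht3 : t ≤ 3 := by nlinarith
      interval_cases x <;> interval_cases t <;> first | omega | skip
      exact ⟨0, by simp [oneAddRootThreeRe], by simp⟩
    · obtain ⟨n, h1, h2⟩ := ih (2 * x - 3 * t).toNat (by
          have : x < 3 * t := by nlinarith
          omega) (x := 2 * x - 3 * t) (t := 2 * t - x) (by nlinarith) (by nlinarith)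
          (by linear_combination h) rfl
      rw [oneAddRootThreeRe] at h1
      refine ⟨n + 1, ?_, ?_⟩
      · rw [oneAddRootThreeRe, pellThreeRe_add, pellThreeIm_add, pellThreeRe_one, pellThreeIm_one]
        linear_combination 2 * h1 + 3 * h2
      · rw [pellThreeRe_add, pellThreeIm_add, pellThreeRe_one, pellThreeIm_one]
        linear_combination 2 * h2 + h1

/-- If `(2 + √3) ^ T` is congruent to `c` modulo `m`, then moving the index by a multiple of `T`
multiplies `oneAddRootThreeRe` by a power of `c`. -/
theorem dvd_oneAddRootThreeRe_sub {m c : ℤ} {T : ℕ} (hr : m ∣ pellThreeRe T - c)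
    (hi : m ∣ pellThreeIm T) (r q : ℕ) :
    m ∣ oneAddRootThreeRe (r + T * q) - c ^ q * oneAddRootThreeRe r := by
  induction q with
  | zero => simp
  | succ q ih =>
    obtain ⟨a, ha⟩ := hr
    obtain ⟨b, hb⟩ := hi
    obtain ⟨d, hd⟩ := ih
    rw [mul_add, mul_one, ← add_assoc]
    rw [oneAddRootThreeRe] at hd
    refine ⟨a * (c ^ q * oneAddRootThreeRe r + m * d) + c * d +
      b * 3 * (pellThreeRe (r + T * q) + pellThreeIm (r + T * q)), ?_⟩
    rw [oneAddRootThreeRe, pellThreeRe_add (r + _), pellThreeIm_add (r + _)]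
    linear_combination pellThreeRe T * hd + (c ^ q * oneAddRootThreeRe r + m * d) * ha +
      3 * (pellThreeRe (r + T * q) + pellThreeIm (r + T * q)) * hb

theorem isSquare_intCast_of_dvd_sq_sub {m : ℕ} {s a : ℤ} (h : (m : ℤ) ∣ s ^ 2 - a) :
    IsSquare (a : ZMod m) := by
  refine ⟨(s : ZMod m), ?_⟩
  rw [← ZMod.intCast_zmod_eq_zero_iff_dvd] at h
  push_cast at h
  linear_combination -h

theorem four_dvd_of_oneAddRootThreeRe_eq_sq {n : ℕ} {s : ℤ} (h : oneAddRootThreeRe n = s ^ 2) :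
    4 ∣ n := by
  have hr : pellThreeRe 16 = 708158977 := by decide +kernel
  have hi : pellThreeIm 16 = 408855776 := by decide +kernel
  have key := dvd_oneAddRootThreeRe_sub (m := 679) (c := 1) (T := 16) (by rw [hr]; norm_num)
    (by rw [hi]; norm_num) (n % 16) (n / 16)
  rw [Nat.mod_add_div, one_pow, one_mul, h] at key
  have s7 := isSquare_intCast_of_dvd_sq_sub (m := 7) (dvd_trans (by norm_num) key)
  have s97 := isSquare_intCast_of_dvd_sq_sub (m := 97) (dvd_trans (by norm_num) key)
  have hlt := Nat.mod_lt n (show 16 > 0 by norm_num)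
  have all : ∀ r < 16, IsSquare ((oneAddRootThreeRe r : ℤ) : ZMod 7) →
    IsSquare ((oneAddRootThreeRe r : ℤ) : ZMod 97) → 4 ∣ r := by decide +kernel
  have := all _ hlt s7 s97
  omega

theorem three_dvd_of_oneAddRootThreeRe_eq_sq {n : ℕ} {s : ℤ} (h : oneAddRootThreeRe n = s ^ 2) :
    3 ∣ n := by
  have h4 := four_dvd_of_oneAddRootThreeRe_eq_sq h
  have hr : pellThreeRe 12 = 3650401 := by decide +kernel
  have hi : pellThreeIm 12 = 2107560 := by decide +kernel
  have key := dvd_oneAddRootThreeRe_sub (m := 13) (c := 1) (T := 12) (by rw [hr]; norm_num)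
    (by rw [hi]; norm_num) (n % 12) (n / 12)
  rw [Nat.mod_add_div, one_pow, one_mul, h] at key
  have s13 := isSquare_intCast_of_dvd_sq_sub (m := 13) key
  have hlt := Nat.mod_lt n (show 12 > 0 by norm_num)
  have all : ∀ r < 12, IsSquare ((oneAddRootThreeRe r : ℤ) : ZMod 13) → 4 ∣ r → 3 ∣ r := by
    decide +kernel
  have := all _ hlt s13 (by omega)
  omega

theorem jacobiSym_eq_one_of_dvd_sub_sq {a W : ℕ} {v : ℤ} (ha : a ≠ 0) (hW : W % 8 = 1)
    (hdvd : (a : ℤ) ∣ W - v ^ 2) (hcop : IsCoprime v a) : jacobiSym a W = 1 := by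
  obtain ⟨e, m, hm, rfl⟩ := Nat.exists_eq_two_pow_mul_odd ha
  have hWodd : Odd W := Nat.odd_iff.2 (by omega)
  have h2 : jacobiSym 2 W = 1 := by
    rw [jacobiSym.at_two hWodd, ZMod.χ₈_nat_mod_eight, hW]; rfl
  push_cast at hdvd hcop ⊢
  rw [jacobiSym.mul_left, jacobiSym.pow_left, h2, one_pow, one_mul,
    jacobiSym.quadratic_reciprocity_one_mod_four' hm (by omega),
    jacobiSym.mod_left' (a₂ := v ^ 2), jacobiSym.sq_one']
  · exact Int.isCoprime_iff_gcd_eq_one.1 hcop.of_mul_right_right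
  · exact Int.emod_eq_emod_iff_emod_sub_eq_zero.2
      (Int.emod_eq_zero_of_dvd (dvd_of_mul_left_dvd hdvd))

theorem pellThree_three_mul (k : ℕ) :
    pellThreeRe (3 * k) = pellThreeRe k * (4 * pellThreeRe k ^ 2 - 3) ∧
      pellThreeIm (3 * k) = pellThreeIm k * (4 * pellThreeRe k ^ 2 - 1) := by
  have h := pellThree_sq k
  rw [show 3 * k = k + k + k by ring]
  simp only [pellThreeRe_add, pellThreeIm_add]
  constructor
  · linear_combination (-3 * pellThreeRe k) * h
  · linear_combination (-pellThreeIm k) * h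

theorem pellThree_two_mul (k : ℕ) :
    pellThreeRe (2 * k) = pellThreeRe k ^ 2 + 3 * pellThreeIm k ^ 2 ∧
      pellThreeIm (2 * k) = 2 * pellThreeRe k * pellThreeIm k := by
  rw [two_mul, pellThreeRe_add, pellThreeIm_add]
  constructor <;> ring

theorem pellThree_mod_forty (f : ℕ) :
    pellThreeRe (6 * 3 ^ f) % 40 = 31 ∧ pellThreeIm (6 * 3 ^ f) % 40 = 20 := by
  induction f with
  | zero => decide +kernel
  | succ f ih =>
    obtain ⟨h1, h2⟩ := pellThree_three_mul (6 * 3 ^ f)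
    rw [show 6 * 3 ^ (f + 1) = 3 * (6 * 3 ^ f) by ring, h1, h2]
    constructor
    · simp [pow_succ, Int.mul_emod, Int.sub_emod, ih.1]
    · simp [pow_succ, Int.mul_emod, Int.sub_emod, ih.1, ih.2]

theorem jacobiSym_ten_of_mod_forty {b : ℕ} (hb : b % 40 = 11) : jacobiSym 10 b = -1 := by
  rw [jacobiSym.mod_right _ (Nat.odd_iff.2 (by omega)), show b % (4 * Int.natAbs 10) = 11 from hb]
  decide +kernel

/-- Both choices `d = v - u` and `d = v + u` are covered by the sign of `u`. -/
theorem jacobiSym_sub_eq_neg_one {u v d : ℤ} {W : ℕ} (hW : (W : ℤ) = v ^ 2 + 9 * u ^ 2)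
    (hW8 : W % 8 = 1) (huv : v ^ 2 - 3 * u ^ 2 = 1) (hd : d = v - u) (hd0 : 0 < d)
    (hd40 : d % 40 = 11) : jacobiSym d W = -1 := by
  lift d to ℕ using hd0.le
  rw [jacobiSym.quadratic_reciprocity_one_mod_four' (Nat.odd_iff.2 (by omega)) (by omega),
    jacobiSym.mod_left' (a₂ := 10 * u ^ 2), jacobiSym.mul_left,
    jacobiSym_ten_of_mod_forty (by omega), jacobiSym.sq_one', mul_one]
  · refine Int.isCoprime_iff_gcd_eq_one.1 ⟨-2 * u, d + 2 * u, ?_⟩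
    rw [hd]
    linear_combination huv
  · refine Int.emod_eq_emod_iff_emod_sub_eq_zero.2 (Int.emod_eq_zero_of_dvd ⟨v + u, ?_⟩)
    rw [hW, hd]
    ring

theorem oneAddRootThreeRe_ne_sq {f j : ℕ} (hj : ¬ 3 ∣ j) (s : ℤ) :
    oneAddRootThreeRe (2 * (6 * 3 ^ f) * j) ≠ s ^ 2 := by
  intro h
  obtain ⟨hv, hu⟩ := pellThree_mod_forty f
  set k := 6 * 3 ^ f
  have huv := pellThree_sq k
  obtain ⟨hv0, hu0⟩ := pellThree_nonneg k
  obtain ⟨hre, him⟩ := pellThree_two_mul k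
  obtain ⟨hre3, him3⟩ := pellThree_three_mul (2 * k)
  obtain ⟨hre4, him4⟩ := pellThree_two_mul (2 * k)
  have hsq := pellThree_sq (2 * k)
  have hk0 : pellThreeIm k ≠ 0 := by intro h0; rw [h0] at hu; omega
  set u := pellThreeIm k
  set v := pellThreeRe k
  obtain ⟨W, hW⟩ : ∃ W : ℕ, (W : ℤ) = v ^ 2 + 9 * u ^ 2 :=
    ⟨(v ^ 2 + 9 * u ^ 2).toNat, Int.toNat_of_nonneg (by positivity)⟩
  have hW8 : W % 8 = 1 := by
    have hz : (W : ℤ) % 8 = 1 := by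
      have h1 : v % 8 = 7 := by omega
      have h2 : u % 8 = 4 := by omega
      rw [hW]
      simp [pow_succ, Int.mul_emod, Int.add_emod, h1, h2]
    omega
  have hWV : (W : ℤ) = 2 * pellThreeRe (2 * k) - 1 := by
    rw [hW, hre]
    linear_combination -huv
  have hvu : u < v := by nlinarith
  -- Jacobi symbols modulo `W`
  have hWodd : Odd W := Nat.odd_iff.2 (by omega)
  have Jtwo : jacobiSym 2 W = 1 := by
    rw [jacobiSym.at_two hWodd, ZMod.χ₈_nat_mod_eight, hW8]; rfl
  have Jneg : jacobiSym (-1) W = 1 := by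
    rw [jacobiSym.at_neg_one hWodd, ZMod.χ₄_nat_one_mod_four (by omega)]
  have Ju : jacobiSym (3 * u) W = 1 := by
    have := jacobiSym_eq_one_of_dvd_sub_sq (a := (3 * u).toNat) (v := v) (by omega) hW8
    rw [Int.toNat_of_nonneg (by omega)] at this
    exact this ⟨3 * u, by rw [hW]; ring⟩ ⟨v, -u, by linear_combination huv⟩
  have Jm : jacobiSym (v - u) W = -1 :=
    jacobiSym_sub_eq_neg_one hW hW8 huv rfl (by omega) (by omega)
  have Jp : jacobiSym (v + u) W = -1 :=
    jacobiSym_sub_eq_neg_one (u := -u) (v := v) (by rw [hW]; ring) hW8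
      (by linear_combination huv) (by ring) (by omega) (by omega)
  have Jx : ∀ (e : ℕ) (d : ℤ), jacobiSym d W = -1 →
      (W : ℤ) ∣ 2 * s ^ 2 - (-1) ^ e * (2 ^ 2 * (3 * u) * d) → False := by
    intro e d hd hdvd
    have := jacobiSym.mod_left' (Int.emod_eq_emod_iff_emod_sub_eq_zero.2
      (Int.emod_eq_zero_of_dvd hdvd))
    rw [jacobiSym.mul_left, jacobiSym.mul_left, jacobiSym.mul_left, jacobiSym.mul_left,
      jacobiSym.pow_left, jacobiSym.pow_left, jacobiSym.pow_left, Jtwo, Jneg, Ju, hd] at this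
    simp only [one_pow, one_mul] at this
    nlinarith [sq_nonneg (jacobiSym s W)]
  -- reduction of the index modulo `6 * k`
  have key := dvd_oneAddRootThreeRe_sub (m := W) (c := -1) (T := 3 * (2 * k))
    ⟨(pellThreeRe (2 * k) + 1) * (2 * pellThreeRe (2 * k) - 1), by rw [hWV, hre3]; ring⟩
    ⟨pellThreeIm (2 * k) * (2 * pellThreeRe (2 * k) + 1), by rw [hWV, him3]; ring⟩
    (2 * k * (j % 3)) (j / 3)
  rw [show 2 * k * (j % 3) + 3 * (2 * k) * (j / 3) = 2 * k * (j % 3 + 3 * (j / 3)) by ring,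
    Nat.mod_add_div, h] at key
  obtain ⟨c, hc⟩ := key
  rcases (show j % 3 = 1 ∨ j % 3 = 2 by omega) with hj3 | hj3 <;> rw [hj3] at hc
  · rw [mul_one, oneAddRootThreeRe] at hc
    refine Jx (j / 3) _ Jm ⟨2 * c + 2 * (-1) ^ (j / 3), ?_⟩
    rw [hre, him] at hc
    linear_combination 2 * hc - 2 * (-1) ^ (j / 3) * hW
  · rw [mul_comm _ 2, oneAddRootThreeRe, hre4, him4] at hc
    refine Jx (j / 3) _ Jp ⟨2 * c + (-1) ^ (j / 3) *
      (2 * pellThreeRe (2 * k) + 6 * pellThreeIm (2 * k)), ?_⟩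
    linear_combination 2 * hc + (-1) ^ (j / 3) * (-2 * hsq + 2 * huv + 6 * him + 2 * hre -
      (2 * pellThreeRe (2 * k) + 6 * pellThreeIm (2 * k)) * hWV)

theorem sq_eq_one_of_pow_four_add_two {s t : ℤ} (h : s ^ 4 + 2 = 3 * t ^ 2) : s ^ 2 = 1 := by
  have hs : s ≠ 0 := by rintro rfl; omega
  have ht : t ≠ 0 := by rintro rfl; nlinarith [sq_nonneg (s ^ 2)]
  obtain ⟨n, hn, -⟩ := exists_eq_oneAddRootThreeRe (x := s ^ 2) (t := |t|) (by positivity)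
    (by positivity) (by rw [sq_abs, ← h]; ring)
  have h4 := four_dvd_of_oneAddRootThreeRe_eq_sq hn.symm
  have h3 := three_dvd_of_oneAddRootThreeRe_eq_sq hn.symm
  obtain ⟨m, rfl⟩ : 12 ∣ n := by omega
  rcases eq_or_ne m 0 with rfl | hm
  · simpa [oneAddRootThreeRe] using hn
  · obtain ⟨f, j, hj, rfl⟩ := Nat.exists_eq_pow_mul_and_not_dvd hm 3 (by norm_num)
    refine absurd hn.symm ?_
    rw [show 12 * (3 ^ f * j) = 2 * (6 * 3 ^ f) * j by ring]
    exact oneAddRootThreeRe_ne_sq hj s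

/-! ### The main theorem -/

theorem Int.exists_three_mul_sq_of_three_mul_eq_sq {a b : ℤ} (h : 3 * a = b ^ 2) :
    ∃ c, a = 3 * c ^ 2 := by
  obtain ⟨c, rfl⟩ : (3 : ℤ) ∣ b := Int.prime_three.dvd_of_dvd_pow ⟨a, h.symm⟩
  exact ⟨c, by linarith⟩

theorem eq_of_three_mul_mul_eq_sq {z y : ℤ} (hz : 3 ≤ z) (h : 3 * z * (z ^ 2 + 2) = y ^ 2) :
    z = 24 := by
  rcases Int.even_or_odd' z with ⟨w, rfl | hw⟩
  · by_cases h3w : (3 : ℤ) ∣ w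
    · obtain ⟨t, rfl⟩ := h3w
      have hcop : IsCoprime (12 * (3 * t)) (2 * (3 * t) ^ 2 + 1) := by
        rw [show 12 * (3 * t) = 2 ^ 2 * 3 * (3 * t) by ring]
        refine ((IsCoprime.pow_left ⟨-(3 * t) ^ 2, 1, by ring⟩).mul_left ?_).mul_left
          ⟨-2 * (3 * t), 1, by ring⟩
        exact ⟨-6 * t ^ 2, 1, by ring⟩
      obtain ⟨d, b, hd0, -, hd, hb⟩ := Int.exists_eq_pow_of_isCoprime (by omega) (by positivity)
        hcop (show _ = y ^ 2 by rw [← h]; ring)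
      obtain ⟨k, rfl⟩ : (6 : ℤ) ∣ d := by
        have h2 : (2 : ℤ) ∣ d := Int.prime_two.dvd_of_dvd_pow (n := 2) ⟨18 * t, by rw [← hd]; ring⟩
        have h3 : (3 : ℤ) ∣ d :=
          Int.prime_three.dvd_of_dvd_pow (n := 2) ⟨12 * t, by rw [← hd]; ring⟩
        omega
      have ht : t = k ^ 2 := by linarith
      subst ht
      have hk := eq_two_of_eighteen_mul_pow_four (k := k) (t := b)
        (by
          have : k ≠ 0 := by rintro rfl; omega
          omega) (by rw [← hb]; ring)
      subst hk
      norm_num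
    · have h3c : IsCoprime w 3 := (Int.prime_three.coprime_iff_not_dvd.2 h3w).symm
      have hcop : IsCoprime (4 * w) (3 * (2 * w ^ 2 + 1)) := by
        rw [show 4 * w = 2 ^ 2 * w by ring]
        exact ((IsCoprime.pow_left ⟨-1, 1, by norm_num⟩).mul_left h3c).mul_right
          ((IsCoprime.pow_left ⟨-w ^ 2, 1, by ring⟩).mul_left ⟨-2 * w, 1, by ring⟩)
      obtain ⟨d, b, -, -, hd, hb⟩ := Int.exists_eq_pow_of_isCoprime (by omega) (by positivity)
        hcop (show _ = y ^ 2 by rw [← h]; ring)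
      obtain ⟨s, rfl⟩ : (2 : ℤ) ∣ d :=
        Int.prime_two.dvd_of_dvd_pow (n := 2) ⟨2 * w, by rw [← hd]; ring⟩
      obtain rfl : w = s ^ 2 := by linarith
      obtain ⟨t, ht⟩ := Int.exists_three_mul_sq_of_three_mul_eq_sq hb
      have := sq_eq_one_of_two_mul_pow_four (s := s) (t := t) (by rw [← ht]; ring)
      omega
  · have hzc : IsCoprime z (z ^ 2 + 2) := ⟨1 + w * z, -w, by rw [hw]; ring⟩
    by_cases h3z : (3 : ℤ) ∣ z
    · obtain ⟨t, ht⟩ := h3z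
      have hcop : IsCoprime (3 * z) (z ^ 2 + 2) :=
        IsCoprime.mul_left ⟨1 + 3 * t ^ 2, -1, by rw [ht]; ring⟩ hzc
      obtain ⟨-, b, -, -, -, hb⟩ := Int.exists_eq_pow_of_isCoprime (by omega) (by positivity)
        hcop h
      have h2 : b ^ 2 % 3 = 2 := by
        rw [← hb, ht, show (3 * t) ^ 2 + 2 = 2 + 3 * (3 * t ^ 2) by ring]
        omega
      rw [pow_two] at h2
      rcases (show b % 3 = 0 ∨ b % 3 = 1 ∨ b % 3 = 2 by omega) with h | h | h <;>
        simp [Int.mul_emod, h] at h2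
    · have h3c : IsCoprime z 3 := (Int.prime_three.coprime_iff_not_dvd.2 h3z).symm
      obtain ⟨s, b, -, -, hs, hb⟩ := Int.exists_eq_pow_of_isCoprime (by omega) (by positivity)
        (h3c.mul_right hzc) (show _ = y ^ 2 by rw [← h]; ring)
      obtain ⟨t, ht⟩ := Int.exists_three_mul_sq_of_three_mul_eq_sq hb
      have := sq_eq_one_of_pow_four_add_two (s := s) (t := t) (by rw [← ht, hs]; ring)
      omega

/-- The only solutions in integers `x ≥ 1`, `y` to
`(x+1)³ + (x+2)³ + (x+3)³ = yˡ` with `ℓ` prime are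
`(x, y, ℓ) = (22, ±204, 2)` and `(2, 6, 3)`. -/
theorem sum_three_consecutive_cubes_perfect_power (ℓ : ℕ) (hℓ : ℓ.Prime)
    (x y : ℤ) (hx : 1 ≤ x) :
    (x + 1) ^ 3 + (x + 2) ^ 3 + (x + 3) ^ 3 = y ^ ℓ ↔
      (x = 22 ∧ y = 204 ∧ ℓ = 2) ∨ (x = 22 ∧ y = -204 ∧ ℓ = 2) ∨
        (x = 2 ∧ y = 6 ∧ ℓ = 3) := by
  constructor
  · intro h
    have hz : 3 * (x + 2) * ((x + 2) ^ 2 + 2) = y ^ ℓ := by rw [← h]; ring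
    rcases hℓ.two_le.eq_or_lt with rfl | h3
    · obtain rfl : x = 22 := by linarith [eq_of_three_mul_mul_eq_sq (by omega) hz]
      have hy : y ^ 2 = 204 ^ 2 := by rw [← h]; norm_num
      rcases sq_eq_sq_iff_eq_or_eq_neg.1 hy with rfl | rfl <;> simp
    · obtain ⟨hx4, rfl, rfl⟩ := eq_of_odd_prime_pow hℓ h3 (by omega) hz
      exact Or.inr (Or.inr ⟨by omega, rfl, rfl⟩)
  · rintro (⟨rfl, rfl, rfl⟩ | ⟨rfl, rfl, rfl⟩ | ⟨rfl, rfl, rfl⟩) <;> norm_num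
end
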